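/- Every non-zero Turing degree that is bounded by a 2-random Turing degree is the join of a minimal pair of 1-generic Turing degrees: if c ≠ 0 is bounded by a 2-random degree, then there exist 1-generic degrees a and b forming a minimal pair with a ∨ b = c. -/

import Mathlib

/-
Common framework: oracle (relative) partial computability via codes,
Turing reducibility, the jump, Cantor-space measure, Martin-Löf randomness
and genericity relative to an oracle, Turing functionals.
-/

open scoped ENNReal

namespace TypicalDegree

/-- Codes for partial functions recursive in an oracle (Kleene-style),
    following `Nat.Partrec.Code` with an extra `oracle` constructor. -/
inductive OracleCode : Type
  | zero : OracleCode
  | succ : OracleCode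
  | left : OracleCode
  | right : OracleCode
  | oracle : OracleCode
  | pair : OracleCode → OracleCode → OracleCode
  | comp : OracleCode → OracleCode → OracleCode
  | prec : OracleCode → OracleCode → OracleCode
  | rfind' : OracleCode → OracleCode

/-- Evaluation of an oracle code relative to an oracle `g : ℕ →. ℕ`. -/
def OracleCode.eval (g : ℕ →. ℕ) : OracleCode → ℕ →. ℕ
  | .zero => pure 0
  | .succ => Nat.succ
  | .left => ↑fun n : ℕ => n.unpair.1
  | .right => ↑fun n : ℕ => n.unpair.2
  | .oracle => g
  | .pair cf cg => fun n => Nat.pair <$> OracleCode.eval g cf n <*> OracleCode.eval g cg n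
  | .comp cf cg => fun n => OracleCode.eval g cg n >>= OracleCode.eval g cf
  | .prec cf cg =>
    Nat.unpaired fun a n =>
      n.rec (OracleCode.eval g cf a) fun y IH => do
        let i ← IH
        OracleCode.eval g cg (Nat.pair a (Nat.pair y i))
  | .rfind' cf =>
    Nat.unpaired fun a m =>
      (Nat.rfind fun n => (fun m => m = 0) <$> OracleCode.eval g cf (Nat.pair a (n + m))).map
        (· + m)

/-- An effective injective numbering of oracle codes. -/
def OracleCode.encodeCode : OracleCode → ℕ
  | .zero => 0
  | .succ => 1
  | .left => 2
  | .right => 3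
  | .oracle => 4
  | .pair cf cg => 4 * Nat.pair cf.encodeCode cg.encodeCode + 5
  | .comp cf cg => 4 * Nat.pair cf.encodeCode cg.encodeCode + 6
  | .prec cf cg => 4 * Nat.pair cf.encodeCode cg.encodeCode + 7
  | .rfind' cf => 4 * Nat.pair cf.encodeCode cf.encodeCode + 8

/-- The characteristic (total) oracle of an element of Cantor space. -/
def chi (X : ℕ → Bool) : ℕ →. ℕ := fun n => Part.some (cond (X n) 1 0)

/-- `f` is partial recursive relative to the oracle `g`. -/
def RedIn (f g : ℕ →. ℕ) : Prop := ∃ c : OracleCode, c.eval g = f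

/-- A total function `ℕ → ℕ` viewed as a partial function. -/
def natFun (f : ℕ → ℕ) : ℕ →. ℕ := fun n => Part.some (f n)

/-- Turing reducibility between elements of Cantor space. -/
def TRed (X Y : ℕ → Bool) : Prop := RedIn (chi X) (chi Y)

/-- Turing equivalence. -/
def TEquiv (X Y : ℕ → Bool) : Prop := TRed X Y ∧ TRed Y X

/-- `X` is computable. -/
def ComputableSeq (X : ℕ → Bool) : Prop := TRed X fun _ => false

/-- `f : ℕ → ℕ` is computable. -/
def ComputableFun (f : ℕ → ℕ) : Prop := RedIn (natFun f) (chi fun _ => false)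

/-- The Turing jump of `X`: the halting problem relative to `X`,
    under the numbering `encodeCode`. -/
noncomputable def jump (X : ℕ → Bool) : ℕ → Bool := fun n =>
  @decide (∃ c : OracleCode, c.encodeCode = n ∧ (c.eval (chi X) n).Dom) (Classical.dec _)

/-- `∅'`, the halting problem. -/
noncomputable def zeroJump : ℕ → Bool := jump fun _ => false

/-- `X` extends the finite binary string `σ` (i.e. `σ ⊂ X`). -/
def extendsStr (X : ℕ → Bool) (σ : List Bool) : Prop :=
  ∀ i : Fin σ.length, X i.1 = σ.get i

/-- `⟦V⟧`: the open set of infinite sequences extending some string in `V`. -/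
def openOf (V : Set (List Bool)) : Set (ℕ → Bool) := {X | ∃ σ ∈ V, extendsStr X σ}

/-- The (fair-coin) measure of the open set `⟦V⟧` determined by a set of strings `V`:
    the supremum over `n` of the proportion of length-`n` strings with a prefix in `V`. -/
noncomputable def stringMeasure (V : Set (List Bool)) : ℝ≥0∞ :=
  ⨆ n : ℕ, (Nat.card {f : Fin n → Bool // ∃ σ ∈ V, σ <+: List.ofFn f} : ℝ≥0∞) / 2 ^ n

/-- The fair-coin (Lebesgue) measure on Cantor space, as the outer measure obtained from
    open coverings by sets of strings; it agrees with Lebesgue measure on measurable sets. -/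
noncomputable def cantorMeasure (S : Set (ℕ → Bool)) : ℝ≥0∞ :=
  ⨅ (V : Set (List Bool)) (_ : S ⊆ openOf V), stringMeasure V

/-- `W` is computably enumerable relative to `X`. -/
def CEIn (X : ℕ → Bool) (W : Set (List Bool)) : Prop :=
  ∃ c : OracleCode, ∀ σ : List Bool, σ ∈ W ↔ (c.eval (chi X) (Encodable.encode σ)).Dom

/-- `W` is computably enumerable. -/
def CE (W : Set (List Bool)) : Prop := CEIn (fun _ => false) W

/-- The c.e. set of strings with index `d`. -/
def ceSetOf (d : OracleCode) : Set (List Bool) :=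
  {σ | (d.eval (chi fun _ => false) (Encodable.encode σ)).Dom}

/-- The sequence `V` of sets of strings is uniformly c.e. relative to `X`. -/
def UniformCEIn (X : ℕ → Bool) (V : ℕ → Set (List Bool)) : Prop :=
  ∃ c : OracleCode, ∀ (i : ℕ) (σ : List Bool),
    σ ∈ V i ↔ (c.eval (chi X) (Nat.pair i (Encodable.encode σ))).Dom

/-- A Martin-Löf test relative to `X`. -/
def MLTest (X : ℕ → Bool) (V : ℕ → Set (List Bool)) : Prop :=
  UniformCEIn X V ∧ ∀ i : ℕ, stringMeasure (V i) < (2 : ℝ≥0∞)⁻¹ ^ i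

/-- `Y` is Martin-Löf random relative to `X`. -/
def MLRandomIn (X Y : ℕ → Bool) : Prop :=
  ∀ V : ℕ → Set (List Bool), MLTest X V → ∃ i, Y ∉ openOf (V i)

/-- `Y` is 1-random. -/
def OneRandom (Y : ℕ → Bool) : Prop := MLRandomIn (fun _ => false) Y

/-- `Y` is 2-random: Martin-Löf random relative to `∅'`. -/
def TwoRandom (Y : ℕ → Bool) : Prop := MLRandomIn zeroJump Y

/-- `Y` is weakly 2-random: it avoids every null `Π⁰₂` class
    (every null intersection of a uniformly c.e. sequence of open sets). -/
def Weak2Random (Y : ℕ → Bool) : Prop :=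
  ∀ V : ℕ → Set (List Bool), UniformCEIn (fun _ => false) V →
    cantorMeasure (⋂ i, openOf (V i)) = 0 → Y ∉ ⋂ i, openOf (V i)

/-- `Y` is 1-generic relative to `X`. -/
def OneGenericIn (X Y : ℕ → Bool) : Prop :=
  ∀ W : Set (List Bool), CEIn X W →
    ∃ σ : List Bool, extendsStr Y σ ∧ (σ ∈ W ∨ ∀ τ : List Bool, σ <+: τ → τ ∉ W)

/-- `Y` is 1-generic. -/
def OneGeneric (Y : ℕ → Bool) : Prop := OneGenericIn (fun _ => false) Y

/-- `Y` is 2-generic: 1-generic relative to `∅'`. -/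
def TwoGeneric (Y : ℕ → Bool) : Prop := OneGenericIn zeroJump Y

/-- The Turing functional coded by `c` is total on oracle `X` with value `Y ∈ 2^ω`
    (i.e. `Ψ^X = Y`). -/
def FTotal (c : OracleCode) (X : ℕ → Bool) (Y : ℕ → Bool) : Prop :=
  c.eval (chi X) = chi Y

/-- `Ψ^X ⊇ σ`: the output of the functional `c` on oracle `X` extends the string `σ`. -/
def FExtends (c : OracleCode) (X : ℕ → Bool) (σ : List Bool) : Prop :=
  ∀ i : Fin σ.length, c.eval (chi X) i.1 = Part.some (cond (σ.get i) 1 0)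

/-- `π(Ψ,σ) = μ({X : Ψ^X ⊇ σ})`. -/
noncomputable def piMeasure (c : OracleCode) (σ : List Bool) : ℝ≥0∞ :=
  cantorMeasure {X | FExtends c X σ}

/-- A Turing functional is special if every infinite binary sequence
    in its range is incomputable. -/
def Special (c : OracleCode) : Prop :=
  ∀ X Y : ℕ → Bool, FTotal c X Y → ¬ ComputableSeq Y

/-- The code `c` computes the total function `T` on strings (no oracle). -/
def ComputesFun (c : OracleCode) (T : List Bool → Bool) : Prop :=
  ∀ σ : List Bool, c.eval (chi fun _ => false) (Encodable.encode σ) = Part.some (cond (T σ) 1 0)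

/-- `T` is (the characteristic function of) a tree: closed under prefixes. -/
def IsTree (T : List Bool → Bool) : Prop :=
  ∀ σ τ : List Bool, σ <+: τ → T τ = true → T σ = true

/-- The set of infinite paths through the tree `T`; `Π⁰₁` classes are the
    sets of paths through computable trees. -/
def pathsOf (T : List Bool → Bool) : Set (ℕ → Bool) :=
  {X | ∀ n : ℕ, T (List.ofFn fun i : Fin n => X i.1) = true}

/-- The computable join `X ⊕ Y`. -/
def join (X Y : ℕ → Bool) : ℕ → Bool := fun n =>
  if n % 2 = 0 then X (n / 2) else Y (n / 2)

/-- A finite string used as a (partial) oracle. -/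
def strOracle (τ : List Bool) : ℕ →. ℕ := fun n =>
  if h : n < τ.length then Part.some (cond (τ.get ⟨n, h⟩) 1 0) else Part.none

/-- `Ψ^{τ₀}` and `Ψ^{τ₁}` are incompatible: they give different outputs somewhere. -/
def SplitPair (c : OracleCode) (τ₀ τ₁ : List Bool) : Prop :=
  ∃ (n v₀ v₁ : ℕ), v₀ ∈ c.eval (strOracle τ₀) n ∧ v₁ ∈ c.eval (strOracle τ₁) n ∧ v₀ ≠ v₁

/-- `(U,V)` is a `Ψ`-splitting above `τ`. -/
def SplittingAbove (c : OracleCode) (τ : List Bool) (U V : Finset (List Bool)) : Prop :=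
  (∃ ℓ : ℕ, ∀ σ ∈ U ∪ V, σ.length = ℓ ∧ τ <+: σ) ∧
    ∀ σ₀ ∈ U, ∀ σ₁ ∈ V, SplitPair c σ₀ σ₁

/-- The output sequence `Ψ^X` of the functional `c` on oracle `X`
    (defaults to `false` when not total). -/
noncomputable def outSeq (c : OracleCode) (X : ℕ → Bool) : ℕ → Bool := fun n =>
  @dite _ (∃ Y : ℕ → Bool, FTotal c X Y) (Classical.dec _) (fun h => h.choose n) fun _ => false

/-- `Ψ^X ↾ n`, as a finite string. -/
noncomputable def outStr (c : OracleCode) (X : ℕ → Bool) (n : ℕ) : List Bool :=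
  List.ofFn fun i : Fin n => outSeq c X i.1

/-- The degree of `M` is a minimal Turing degree. -/
def MinimalDeg (M : ℕ → Bool) : Prop :=
  ¬ ComputableSeq M ∧ ∀ Z : ℕ → Bool, TRed Z M → ComputableSeq Z ∨ TRed M Z

section
/-! ### Part I: computability interface -/

/-- The first `n` bits of `X`. -/
def pre (X : ℕ → Bool) (n : ℕ) : List Bool := (List.range n).map X

@[simp] theorem pre_length (X : ℕ → Bool) (n : ℕ) : (pre X n).length = n := by simp [pre]

theorem pre_succ (X : ℕ → Bool) (n : ℕ) : pre X (n + 1) = pre X n ++ [X n] := by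
  simp [pre, List.range_succ]

@[simp] theorem pre_zero (X : ℕ → Bool) : pre X 0 = [] := rfl

theorem pre_getElem (X : ℕ → Bool) (n i : ℕ) (h : i < (pre X n).length) : (pre X n)[i] = X i := by
  simp [pre]

theorem pre_getElem? (X : ℕ → Bool) (n i : ℕ) (h : i < n) : (pre X n)[i]? = some (X i) := by
  simp [pre, h]

theorem pre_take (X : ℕ → Bool) (n m : ℕ) (h : m ≤ n) : (pre X n).take m = pre X m := by
  simp [pre, ← List.map_take, List.take_range, h]

theorem pre_pfx (X : ℕ → Bool) {m n : ℕ} (h : m ≤ n) : pre X m <+: pre X n := by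
  rw [← pre_take X n m h]; exact List.take_prefix _ _

/-- Translation of ordinary codes into oracle codes. -/
def ofCode : Nat.Partrec.Code → OracleCode
  | .zero => .zero
  | .succ => .succ
  | .left => .left
  | .right => .right
  | .pair a b => .pair (ofCode a) (ofCode b)
  | .comp a b => .comp (ofCode a) (ofCode b)
  | .prec a b => .prec (ofCode a) (ofCode b)
  | .rfind' a => .rfind' (ofCode a)

theorem eval_ofCode (g : ℕ →. ℕ) (c : Nat.Partrec.Code) : (ofCode c).eval g = c.eval := by
  induction c with
  | zero => rfl
  | succ => rfl
  | left => rfl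
  | right => rfl
  | pair a b iha ihb => simp only [ofCode, OracleCode.eval, iha, ihb]; rfl
  | comp a b iha ihb => simp only [ofCode, OracleCode.eval, iha, ihb]; rfl
  | prec a b iha ihb => simp only [ofCode, OracleCode.eval, iha, ihb]; rfl
  | rfind' a iha => simp only [ofCode, OracleCode.eval, iha]; rfl

theorem mem_eval_pair (a b : OracleCode) (g : ℕ →. ℕ) (n v : ℕ) :
    v ∈ (OracleCode.pair a b).eval g n ↔
        ∃ x ∈ a.eval g n, ∃ y ∈ b.eval g n, Nat.pair x y = v := by
  simp [OracleCode.eval, Seq.seq, Part.bind_map]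

theorem mem_eval_comp (a b : OracleCode) (g : ℕ →. ℕ) (n v : ℕ) :
    v ∈ (OracleCode.comp a b).eval g n ↔ ∃ x ∈ b.eval g n, v ∈ a.eval g x :=
  Part.mem_bind_iff

theorem mem_eval_prec_zero (a b : OracleCode) (g : ℕ →. ℕ) (n v : ℕ) :
    v ∈ (OracleCode.prec a b).eval g (Nat.pair n 0) ↔ v ∈ a.eval g n := by
  simp [OracleCode.eval]

theorem mem_eval_prec_succ (a b : OracleCode) (g : ℕ →. ℕ) (n k v : ℕ) :
    v ∈ (OracleCode.prec a b).eval g (Nat.pair n (k + 1)) ↔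
        ∃ i ∈ (OracleCode.prec a b).eval g (Nat.pair n k),
          v ∈ b.eval g (Nat.pair n (Nat.pair k i)) := by
  simp [OracleCode.eval]

theorem mem_eval_rfind (a : OracleCode) (g : ℕ →. ℕ) (n v : ℕ) :
    v ∈ (OracleCode.rfind' a).eval g n ↔
        ∃ k, (0 ∈ a.eval g (Nat.pair n.unpair.1 (k + n.unpair.2)) ∧
          ∀ m < k, ∃ z ∈ a.eval g (Nat.pair n.unpair.1 (m + n.unpair.2)), z ≠ 0) ∧
            k + n.unpair.2 = v := by
  have h : ∀ k, k ∈ (Nat.rfind fun k => Part.map (fun m => decide (m = 0))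
      (a.eval g (Nat.pair n.unpair.1 (k + n.unpair.2)))) ↔
        (0 ∈ a.eval g (Nat.pair n.unpair.1 (k + n.unpair.2)) ∧
          ∀ m < k, ∃ z ∈ a.eval g (Nat.pair n.unpair.1 (m + n.unpair.2)), z ≠ 0) := by
    intro k
    refine Nat.mem_rfind.trans ?_
    refine and_congr ?_ (forall_congr' fun m => ?_)
    · refine (Part.mem_map_iff _).trans ?_
      simp
    · refine imp_congr Iff.rfl ((Part.mem_map_iff _).trans ?_)
      simp
  simp only [OracleCode.eval, Nat.unpaired]
  rw [Part.mem_map_iff]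
  exact exists_congr fun k => and_congr (h k) Iff.rfl

theorem exists_oracleCode {f : ℕ →. ℕ} (hf : Partrec f) :
    ∃ c : OracleCode, ∀ g, c.eval g = f := by
  obtain ⟨c, hc⟩ := Nat.Partrec.Code.exists_code.1 (Partrec.nat_iff.1 hf)
  exact ⟨ofCode c, fun g => by rw [eval_ofCode, hc]⟩

theorem partrec_eval {α : Type*} [Primcodable α] {O : α → ℕ →. ℕ} (hO : Partrec₂ O)
    (c : OracleCode) : Partrec₂ fun a n => c.eval (O a) n := by
  induction c with
  | zero => exact (Computable.const 0 : Computable fun _ : α × ℕ => 0)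
  | succ => exact (Computable.succ.comp Computable.snd : Computable fun p : α × ℕ => p.2.succ)
  | left => exact ((Computable.fst.comp Computable.unpair).comp Computable.snd :
      Computable fun p : α × ℕ => p.2.unpair.1)
  | right => exact ((Computable.snd.comp Computable.unpair).comp Computable.snd :
      Computable fun p : α × ℕ => p.2.unpair.2)
  | oracle => exact hO
  | pair a b iha ihb =>
    have h : Partrec fun p : α × ℕ => (a.eval (O p.1) p.2).bind fun x =>
        (b.eval (O p.1) p.2).map fun y => Nat.pair x y := by
      refine Partrec.bind iha ?_
      refine Partrec.map (ihb.comp (Computable.fst.comp Computable.fst)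
        (Computable.snd.comp Computable.fst)) ?_
      exact (Primrec₂.natPair.comp (Primrec.snd.comp Primrec.fst) Primrec.snd).to_comp
    refine h.of_eq fun p => ?_
    simp [OracleCode.eval, Seq.seq, Part.bind_map]
  | comp a b iha ihb =>
    have h : Partrec fun p : α × ℕ => (b.eval (O p.1) p.2).bind fun x => a.eval (O p.1) x :=
      Partrec.bind ihb (iha.comp (Computable.fst.comp Computable.fst) Computable.snd)
    exact h
  | prec a b iha ihb =>
    have h : Partrec fun p : α × ℕ => (p.2.unpair.2.rec (a.eval (O p.1) p.2.unpair.1)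
        fun y IH => IH.bind fun i => b.eval (O p.1) (Nat.pair p.2.unpair.1 (Nat.pair y i)) :
          Part ℕ) := by
      have hu : Computable fun p : α × ℕ => p.2.unpair := Computable.unpair.comp Computable.snd
      have hb : Partrec₂ fun (p : α × ℕ) (q : ℕ × ℕ) =>
          b.eval (O p.1) (Nat.pair p.2.unpair.1 (Nat.pair q.1 q.2)) := ?_
      · exact Partrec.nat_rec (Computable.snd.comp hu)
          (iha.comp Computable.fst (Computable.fst.comp hu)) hb
      refine ihb.comp (Computable.fst.comp Computable.fst) ?_
      refine Primrec₂.natPair.to_comp.comp ((Computable.fst.comp hu).comp Computable.fst) ?_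
      exact Primrec₂.natPair.to_comp.comp (Computable.fst.comp Computable.snd)
        (Computable.snd.comp Computable.snd)
    exact h
  | rfind' a iha =>
    have h : Partrec fun p : α × ℕ => (Nat.rfind fun n => (fun m => decide (m = 0)) <$>
        a.eval (O p.1) (Nat.pair p.2.unpair.1 (n + p.2.unpair.2))).map
          (fun x => x + p.2.unpair.2) := by
      have hu : Computable fun p : α × ℕ => p.2.unpair := Computable.unpair.comp Computable.snd
      refine Partrec.map (Partrec.rfind ?_) ?_
      · refine Partrec.map (iha.comp (Computable.fst.comp Computable.fst) ?_) ?_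
        · refine Primrec₂.natPair.to_comp.comp ((Computable.fst.comp hu).comp Computable.fst) ?_
          exact Primrec.nat_add.to_comp.comp Computable.snd
            ((Computable.snd.comp hu).comp Computable.fst)
        · exact (Primrec.eq.comp Primrec.snd (Primrec.const 0)).decide.to_comp
      · exact Primrec.nat_add.to_comp.comp Computable.snd
          ((Computable.snd.comp hu).comp Computable.fst)
    exact h

theorem partrec_strOracle : Partrec₂ strOracle := by
  have h : Partrec fun p : List Bool × ℕ =>
      ((p.1[p.2]?).map (fun b => cond b 1 0) : Part ℕ) := by
    refine Computable.ofOption ?_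
    refine Computable.option_map Primrec.list_getElem?.to_comp ?_
    exact ((Primrec.cond Primrec.snd (Primrec.const 1) (Primrec.const 0)).to_comp)
  refine h.of_eq fun p => ?_
  unfold strOracle
  split_ifs with h
  · simp [h]
  · simp [h]

theorem partrec_false (c : OracleCode) : Partrec fun n => c.eval (chi fun _ => false) n := by
  have h : Partrec₂ (fun (_ : Unit) (n : ℕ) => chi (fun _ => false) n) :=
    (Computable.const 0 : Computable fun _ : Unit × ℕ => 0)
  exact (partrec_eval h c).comp (Computable.const ()) Computable.id

theorem exists_code_false (c : OracleCode) :
    ∃ d : Nat.Partrec.Code, ∀ n, d.eval n = c.eval (chi fun _ => false) n := by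
  obtain ⟨d, hd⟩ := Nat.Partrec.Code.exists_code.1 (Partrec.nat_iff.1 (partrec_false c))
  exact ⟨d, fun n => by rw [hd]⟩

/-- Continuity of evaluation in the oracle. -/
theorem eval_cont (G : ℕ → ℕ →. ℕ) (g : ℕ →. ℕ)
    (hm : ∀ N M n v, N ≤ M → v ∈ G N n → v ∈ G M n)
    (hg : ∀ n v, v ∈ g n ↔ ∃ N, v ∈ G N n) (c : OracleCode) :
    (∀ N M n v, N ≤ M → v ∈ c.eval (G N) n → v ∈ c.eval (G M) n) ∧
    ∀ n v, v ∈ c.eval g n ↔ ∃ N, v ∈ c.eval (G N) n := by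
  induction c with
  | zero => exact ⟨fun _ _ _ _ _ h => h, fun n v => ⟨fun h => ⟨0, h⟩, fun ⟨_, h⟩ => h⟩⟩
  | succ => exact ⟨fun _ _ _ _ _ h => h, fun n v => ⟨fun h => ⟨0, h⟩, fun ⟨_, h⟩ => h⟩⟩
  | left => exact ⟨fun _ _ _ _ _ h => h, fun n v => ⟨fun h => ⟨0, h⟩, fun ⟨_, h⟩ => h⟩⟩
  | right => exact ⟨fun _ _ _ _ _ h => h, fun n v => ⟨fun h => ⟨0, h⟩, fun ⟨_, h⟩ => h⟩⟩
  | oracle => exact ⟨hm, hg⟩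
  | pair a b iha ihb =>
    simp only [mem_eval_pair]
    refine ⟨?_, fun n v => ⟨?_, ?_⟩⟩
    · rintro N M n v h ⟨x, hx, y, hy, rfl⟩
      exact ⟨x, iha.1 _ _ _ _ h hx, y, ihb.1 _ _ _ _ h hy, rfl⟩
    · rintro ⟨x, hx, y, hy, rfl⟩
      obtain ⟨N, hN⟩ := (iha.2 _ _).1 hx
      obtain ⟨M, hM⟩ := (ihb.2 _ _).1 hy
      exact ⟨max N M, x, iha.1 _ _ _ _ (le_max_left _ _) hN, y,
        ihb.1 _ _ _ _ (le_max_right _ _) hM, rfl⟩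
    · rintro ⟨N, x, hx, y, hy, rfl⟩
      exact ⟨x, (iha.2 _ _).2 ⟨N, hx⟩, y, (ihb.2 _ _).2 ⟨N, hy⟩, rfl⟩
  | comp a b iha ihb =>
    simp only [mem_eval_comp]
    refine ⟨?_, fun n v => ⟨?_, ?_⟩⟩
    · rintro N M n v h ⟨x, hx, hy⟩
      exact ⟨x, ihb.1 _ _ _ _ h hx, iha.1 _ _ _ _ h hy⟩
    · rintro ⟨x, hx, hy⟩
      obtain ⟨N, hN⟩ := (ihb.2 _ _).1 hx
      obtain ⟨M, hM⟩ := (iha.2 _ _).1 hy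
      exact ⟨max N M, x, ihb.1 _ _ _ _ (le_max_left _ _) hN,
        iha.1 _ _ _ _ (le_max_right _ _) hM⟩
    · rintro ⟨N, x, hx, hy⟩
      exact ⟨x, (ihb.2 _ _).2 ⟨N, hx⟩, (iha.2 _ _).2 ⟨N, hy⟩⟩
  | prec a b iha ihb =>
    have h1 : ∀ N M n k v, N ≤ M → v ∈ (OracleCode.prec a b).eval (G N) (Nat.pair n k) →
        v ∈ (OracleCode.prec a b).eval (G M) (Nat.pair n k) := by
      intro N M n k
      induction k with
      | zero => intro v h; rw [mem_eval_prec_zero, mem_eval_prec_zero]; exact iha.1 _ _ _ _ h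
      | succ k ih =>
        intro v h; rw [mem_eval_prec_succ, mem_eval_prec_succ]; rintro ⟨i, hi, hv⟩
        exact ⟨i, ih _ h hi, ihb.1 _ _ _ _ h hv⟩
    have h2 : ∀ n k v, v ∈ (OracleCode.prec a b).eval g (Nat.pair n k) ↔
        ∃ N, v ∈ (OracleCode.prec a b).eval (G N) (Nat.pair n k) := by
      intro n k
      induction k with
      | zero => intro v; simp only [mem_eval_prec_zero]; exact iha.2 _ _
      | succ k ih =>
        intro v; simp only [mem_eval_prec_succ]
        constructor
        · rintro ⟨i, hi, hv⟩
          obtain ⟨N, hN⟩ := (ih _).1 hi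
          obtain ⟨M, hM⟩ := (ihb.2 _ _).1 hv
          exact ⟨max N M, i, h1 _ _ _ _ _ (le_max_left _ _) hN,
            ihb.1 _ _ _ _ (le_max_right _ _) hM⟩
        · rintro ⟨N, i, hi, hv⟩
          exact ⟨i, (ih _).2 ⟨N, hi⟩, (ihb.2 _ _).2 ⟨N, hv⟩⟩
    refine ⟨fun N M n v h => ?_, fun n v => ?_⟩
    · have := h1 N M n.unpair.1 n.unpair.2 v h
      simpa using this
    · have := h2 n.unpair.1 n.unpair.2 v
      simpa using this
  | rfind' a iha =>
    simp only [mem_eval_rfind]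
    refine ⟨?_, fun n v => ⟨?_, ?_⟩⟩
    · rintro N M n v h ⟨k, ⟨h0, hk⟩, rfl⟩
      refine ⟨k, ⟨iha.1 _ _ _ _ h h0, fun m hm => ?_⟩, rfl⟩
      obtain ⟨z, hz, hz0⟩ := hk m hm
      exact ⟨z, iha.1 _ _ _ _ h hz, hz0⟩
    · rintro ⟨k, ⟨h0, hk⟩, rfl⟩
      obtain ⟨N, hN⟩ := (iha.2 _ _).1 h0
      have : ∃ M, ∀ m < k, ∃ z ∈ a.eval (G M) (Nat.pair n.unpair.1 (m + n.unpair.2)), z ≠ 0 := by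
        clear h0 hN
        induction k with
        | zero => exact ⟨0, by simp⟩
        | succ k ih =>
          obtain ⟨M, hM⟩ := ih fun m hm => hk m (by omega)
          obtain ⟨z, hz, hz0⟩ := hk k (by omega)
          obtain ⟨M', hM'⟩ := (iha.2 _ _).1 hz
          refine ⟨max M M', fun m hm => ?_⟩
          rcases Nat.lt_succ_iff_lt_or_eq.1 hm with h | rfl
          · obtain ⟨w, hw, hw0⟩ := hM m h
            exact ⟨w, iha.1 _ _ _ _ (le_max_left _ _) hw, hw0⟩
          · exact ⟨z, iha.1 _ _ _ _ (le_max_right _ _) hM', hz0⟩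
      obtain ⟨M, hM⟩ := this
      refine ⟨max N M, k, ⟨iha.1 _ _ _ _ (le_max_left _ _) hN, fun m hm => ?_⟩, rfl⟩
      obtain ⟨z, hz, hz0⟩ := hM m hm
      exact ⟨z, iha.1 _ _ _ _ (le_max_right _ _) hz, hz0⟩
    · rintro ⟨N, k, ⟨h0, hk⟩, rfl⟩
      refine ⟨k, ⟨(iha.2 _ _).2 ⟨N, h0⟩, fun m hm => ?_⟩, rfl⟩
      obtain ⟨z, hz, hz0⟩ := hk m hm
      exact ⟨z, (iha.2 _ _).2 ⟨N, hz⟩, hz0⟩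

theorem mem_strOracle (τ : List Bool) (n v : ℕ) :
    v ∈ strOracle τ n ↔ ∃ b, τ[n]? = some b ∧ v = cond b 1 0 := by
  unfold strOracle
  split_ifs with h
  · simp [h]
  · simp [h]

theorem strOracle_mono {τ τ' : List Bool} (h : τ <+: τ') {n v : ℕ} (hv : v ∈ strOracle τ n) :
    v ∈ strOracle τ' n := by
  rw [mem_strOracle] at *
  obtain ⟨b, hb, rfl⟩ := hv
  refine ⟨b, ?_, rfl⟩
  obtain ⟨r, rfl⟩ := h
  rw [List.getElem?_append]
  split_ifs with h
  · exact hb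
  · simp [List.getElem?_eq_none (not_lt.1 h)] at hb

theorem eval_strOracle_mono (c : OracleCode) {τ τ' : List Bool} (h : τ <+: τ') {n v : ℕ}
    (hv : v ∈ c.eval (strOracle τ) n) : v ∈ c.eval (strOracle τ') n := by
  have := (eval_cont (fun N => if N = 0 then strOracle τ else strOracle τ') (strOracle τ')
    ?_ ?_ c).1 0 1 n v (by omega)
  · simpa using this hv
  · intro N M n v hNM hv
    by_cases hN : N = 0
    · by_cases hM : M = 0
      · simpa [hN, hM] using hv
      · simp only [hN, hM, if_true, if_false] at hv ⊢
        exact strOracle_mono h hv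
    · have hM : M ≠ 0 := by omega
      simpa [hN, hM] using hv
  · intro n v
    constructor
    · intro h; exact ⟨1, by simpa using h⟩
    · rintro ⟨N, hN⟩
      by_cases hN0 : N = 0
      · simp only [hN0, if_true] at hN; exact strOracle_mono h hN
      · simpa [hN0] using hN

theorem mem_eval_chi (c : OracleCode) (X : ℕ → Bool) (n v : ℕ) :
    v ∈ c.eval (chi X) n ↔ ∃ N, v ∈ c.eval (strOracle (pre X N)) n := by
  refine (eval_cont (fun N => strOracle (pre X N)) (chi X) ?_ ?_ c).2 n v
  · intro N M n v h; exact strOracle_mono (pre_pfx X h)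
  · intro n v
    simp only [mem_strOracle, chi, Part.mem_some_iff]
    constructor
    · rintro rfl; exact ⟨n + 1, X n, pre_getElem? _ _ _ (by omega), rfl⟩
    · rintro ⟨N, b, hb, rfl⟩
      have : n < N := by
        by_contra hn
        rw [List.getElem?_eq_none (by simp; omega)] at hb; simp at hb
      rw [pre_getElem? _ _ _ this] at hb
      simp at hb; rw [hb]

/-- Primitive recursive, monotone approximation to an oracle computation. -/
theorem exists_approx (c : OracleCode) : ∃ G : List Bool → ℕ → Option ℕ, Primrec₂ G ∧
    (∀ τ τ' n v, τ <+: τ' → G τ n = some v → G τ' n = some v) ∧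
    ∀ X n v, v ∈ c.eval (chi X) n ↔ ∃ N, G (pre X N) n = some v := by
  have hp : Partrec fun k : ℕ =>
      (((Encodable.decode k : Option (List Bool × ℕ)) : Part (List Bool × ℕ)).bind
        fun p => c.eval (strOracle p.1) p.2) := by
    refine Partrec.bind (Computable.ofOption Computable.decode) ?_
    exact (partrec_eval partrec_strOracle c).comp (Computable.fst.comp Computable.snd)
      (Computable.snd.comp Computable.snd)
  obtain ⟨d, hd⟩ := Nat.Partrec.Code.exists_code.1 (Partrec.nat_iff.1 hp)
  have hd' : ∀ (τ : List Bool) (n : ℕ), d.eval (Encodable.encode (τ, n)) = c.eval (strOracle τ) n := by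
    intro τ n; rw [hd]
    simp only [Encodable.encodek]
    simp
  let G : List Bool → ℕ → Option ℕ := fun τ n =>
    ((List.range (τ.length + 1)).filterMap fun k =>
      d.evaln τ.length (Encodable.encode (τ.take k, n))).head?
  have hG : Primrec₂ G := by
    refine Primrec.list_head?.comp ?_
    refine Primrec.listFilterMap (Primrec.list_range.comp
      (Primrec.succ.comp (Primrec.list_length.comp Primrec.fst))) ?_
    refine Nat.Partrec.Code.primrec_evaln.comp (Primrec.pair (Primrec.pair
      (Primrec.list_length.comp (Primrec.fst.comp Primrec.fst)) (Primrec.const d)) ?_)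
    refine Primrec.encode.comp (Primrec.pair ?_ (Primrec.snd.comp Primrec.fst))
    exact Primrec.list_take.comp Primrec.snd (Primrec.fst.comp Primrec.fst)
  have hs : ∀ τ n v, G τ n = some v → ∃ k ≤ τ.length,
      v ∈ d.evaln τ.length (Encodable.encode (τ.take k, n)) := by
    intro τ n v h
    have := List.mem_of_head? h
    rw [List.mem_filterMap] at this
    obtain ⟨k, hk, hv⟩ := this
    exact ⟨k, by simp at hk; omega, hv⟩
  have hs' : ∀ τ n v, G τ n = some v → v ∈ c.eval (strOracle τ) n := by
    intro τ n v h
    obtain ⟨k, -, hv⟩ := hs τ n v h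
    have := Nat.Partrec.Code.evaln_sound hv
    rw [hd'] at this
    exact eval_strOracle_mono c (List.take_prefix _ _) this
  have hc : ∀ τ n v k, v ∈ d.evaln τ.length (Encodable.encode (τ.take k, n)) → k ≤ τ.length →
      G τ n = some v := by
    intro τ n v k hv hk
    have h1 : v ∈ (List.range (τ.length + 1)).filterMap fun k =>
      d.evaln τ.length (Encodable.encode (τ.take k, n)) :=
      List.mem_filterMap.2 ⟨k, by simp; omega, hv⟩
    have h2 : ∃ w, G τ n = some w := by
      rw [← Option.isSome_iff_exists]
      simp only [G]
      rw [List.isSome_head?]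
      exact List.ne_nil_of_mem h1
    obtain ⟨w, hw⟩ := h2
    have h3 := hs' τ n w hw
    have h4 := Nat.Partrec.Code.evaln_sound hv
    rw [hd'] at h4
    have h5 := eval_strOracle_mono c (List.take_prefix _ _) h4
    rw [hw, Part.mem_unique h3 h5]
  refine ⟨G, hG, ?_, ?_⟩
  · intro τ τ' n v hτ h
    obtain ⟨k, hk, hv⟩ := hs τ n v h
    refine hc τ' n v k ?_ (hk.trans hτ.length_le)
    have : τ'.take k = τ.take k := by
      obtain ⟨r, rfl⟩ := hτ
      rw [List.take_append_of_le_length hk]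
    rw [this]
    exact Nat.Partrec.Code.evaln_mono hτ.length_le hv
  · intro X n v
    rw [mem_eval_chi]
    constructor
    · rintro ⟨N, hN⟩
      rw [← hd'] at hN
      obtain ⟨k, hk⟩ := Nat.Partrec.Code.evaln_complete.1 hN
      refine ⟨max N k, hc _ _ _ N ?_ (by simp)⟩
      rw [pre_take _ _ _ (le_max_left _ _)]
      refine Nat.Partrec.Code.evaln_mono ?_ hk
      simp
    · rintro ⟨N, hN⟩
      exact ⟨N, hs' _ _ _ hN⟩

/-- Oracle computations from computable approximations. -/
theorem exists_oracle_search (F : List Bool → ℕ → Option ℕ) (hF : Computable₂ F) :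
    ∃ c : OracleCode, ∀ X n, (∀ v ∈ c.eval (chi X) n, ∃ N, F (pre X N) n = some v) ∧
      ((∃ N, (F (pre X N) n).isSome) → (c.eval (chi X) n).Dom) := by
  -- code appending a bit
  have h1 : Computable fun k : ℕ => Encodable.encode
      (((Encodable.decode k.unpair.1 : Option (List Bool)).getD []) ++ [decide (k.unpair.2 = 1)]) := by
    refine Computable.encode.comp (Primrec.to_comp ?_)
    refine Primrec.list_concat.comp ?_ ?_
    · exact Primrec.option_getD.comp (Primrec.decode.comp (Primrec.fst.comp Primrec.unpair))
        (Primrec.const _)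
    · exact (Primrec.eq.comp (Primrec.snd.comp Primrec.unpair) (Primrec.const 1)).decide
  obtain ⟨ca, hca⟩ := exists_oracleCode h1.partrec
  obtain ⟨ce, hce⟩ := exists_oracleCode
    (Computable.const (Encodable.encode ([] : List Bool)) : Computable fun _ : ℕ => _).partrec
  let cp : OracleCode := .prec ce (.comp ca (.pair (.comp .right .right)
    (.comp .oracle (.comp .left .right))))
  have mleft : ∀ (g : ℕ →. ℕ) n, n.unpair.1 ∈ OracleCode.left.eval g n :=
    fun g n => Part.mem_some _
  have mright : ∀ (g : ℕ →. ℕ) n, n.unpair.2 ∈ OracleCode.right.eval g n :=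
    fun g n => Part.mem_some _
  have hcp : ∀ X n N, Encodable.encode (pre X N) ∈ cp.eval (chi X) (Nat.pair n N) := by
    intro X n N
    induction N with
    | zero => rw [mem_eval_prec_zero, hce]; exact Part.mem_some _
    | succ N ih =>
      rw [mem_eval_prec_succ]
      refine ⟨_, ih, ?_⟩
      rw [mem_eval_comp]
      refine ⟨Nat.pair (Encodable.encode (pre X N)) (cond (X N) 1 0), ?_, ?_⟩
      · rw [mem_eval_pair]
        refine ⟨_, ?_, _, ?_, rfl⟩
        · rw [mem_eval_comp]
          exact ⟨_, mright _ _, by simpa using mright (chi X) (Nat.pair N (Encodable.encode (pre X N)))⟩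
        · rw [mem_eval_comp]
          refine ⟨N, ?_, Part.mem_some _⟩
          rw [mem_eval_comp]
          exact ⟨_, mright _ _, by simpa using mleft (chi X) (Nat.pair N (Encodable.encode (pre X N)))⟩
      · rw [hca, PFun.coe_val, Part.mem_some_iff, pre_succ]
        cases X N <;> simp
  -- the test
  have h2 : Computable fun k : ℕ => Encodable.encode
      (F ((Encodable.decode k.unpair.2 : Option (List Bool)).getD []) k.unpair.1.unpair.1) := by
    refine Computable.encode.comp (hF.comp ?_ ?_)
    · exact (Primrec.option_getD.comp (Primrec.decode.comp (Primrec.snd.comp Primrec.unpair))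
        (Primrec.const _)).to_comp
    · exact (Primrec.fst.comp (Primrec.unpair.comp (Primrec.fst.comp Primrec.unpair))).to_comp
  obtain ⟨cf, hcf⟩ := exists_oracleCode h2.partrec
  have h3 : Computable fun k : ℕ => if k = 0 then 1 else 0 :=
    (Primrec.ite (Primrec.eq.comp Primrec.id (Primrec.const 0)) (Primrec.const 1)
      (Primrec.const 0)).to_comp
  obtain ⟨ct, hct⟩ := exists_oracleCode h3.partrec
  have h4 : Computable fun k : ℕ => k - 1 := Primrec.pred.to_comp
  obtain ⟨cq, hcq⟩ := exists_oracleCode h4.partrec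
  let idc : OracleCode := .pair .left .right
  have hidc : ∀ g n, n ∈ idc.eval g n := fun g n => by
    rw [mem_eval_pair]; exact ⟨_, mleft _ _, _, mright _ _, Nat.pair_unpair n⟩
  let cF : OracleCode := .comp cf (.pair idc cp)
  have hcF : ∀ X n N, Encodable.encode (F (pre X N) n) ∈ cF.eval (chi X) (Nat.pair n N) := by
    intro X n N
    rw [mem_eval_comp]
    refine ⟨Nat.pair (Nat.pair n N) (Encodable.encode (pre X N)), ?_, ?_⟩
    · rw [mem_eval_pair]; exact ⟨_, hidc _ _, _, hcp _ _ _, rfl⟩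
    · rw [hcf, PFun.coe_val, Part.mem_some_iff]; simp
  have hct : ∀ X n N v, v ∈ (OracleCode.comp ct cF).eval (chi X) (Nat.pair n N) ↔
      v = if F (pre X N) n = none then 1 else 0 := by
    intro X n N v
    have : (if F (pre X N) n = none then 1 else 0) ∈
        (OracleCode.comp ct cF).eval (chi X) (Nat.pair n N) := by
      rw [mem_eval_comp]
      refine ⟨_, hcF X n N, ?_⟩
      rw [hct, PFun.coe_val, Part.mem_some_iff]
      cases F (pre X N) n <;> simp
    exact ⟨fun h => Part.mem_unique h this, fun h => h ▸ this⟩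
  let cr : OracleCode := .comp (.rfind' (.comp ct cF)) (.pair idc .zero)
  have hcr : ∀ X n N, N ∈ cr.eval (chi X) n ↔
      (F (pre X N) n ≠ none ∧ ∀ m < N, F (pre X m) n = none) := by
    intro X n N
    rw [mem_eval_comp]
    have h0 : ∀ x, x ∈ (OracleCode.pair idc .zero).eval (chi X) n ↔ x = Nat.pair n 0 := by
      intro x
      have : Nat.pair n 0 ∈ (OracleCode.pair idc .zero).eval (chi X) n := by
        rw [mem_eval_pair]; exact ⟨_, hidc _ _, 0, Part.mem_some _, rfl⟩
      exact ⟨fun h => Part.mem_unique h this, fun h => h ▸ this⟩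
    simp only [h0, exists_eq_left, mem_eval_rfind, Nat.unpair_pair, hct]
    simp
  refine ⟨.comp (.comp cq cF) (.pair idc cr), fun X n => ?_⟩
  have main : ∀ v, v ∈ (OracleCode.comp (.comp cq cF) (.pair idc cr)).eval (chi X) n ↔
      ∃ N ∈ cr.eval (chi X) n, v = Encodable.encode (F (pre X N) n) - 1 := by
    intro v
    simp only [mem_eval_comp, mem_eval_pair]
    constructor
    · rintro ⟨x, ⟨y, hy, N, hN, rfl⟩, z, hz, hv⟩
      refine ⟨N, hN, ?_⟩
      rw [Part.mem_unique hy (hidc _ _)] at hz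
      rw [Part.mem_unique hz (hcF _ _ _), hcq, PFun.coe_val, Part.mem_some_iff] at hv
      exact hv
    · rintro ⟨N, hN, rfl⟩
      refine ⟨_, ⟨_, hidc _ _, N, hN, rfl⟩, _, hcF _ _ _, ?_⟩
      rw [hcq, PFun.coe_val, Part.mem_some_iff]
  constructor
  · intro v hv
    obtain ⟨N, hN, rfl⟩ := (main v).1 hv
    refine ⟨N, ?_⟩
    have := ((hcr X n N).1 hN).1
    obtain ⟨w, hw⟩ := Option.ne_none_iff_exists'.1 this
    rw [hw]; simp
  · intro hex
    rw [Part.dom_iff_mem]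
    classical
    refine ⟨_, (main _).2 ⟨Nat.find hex, (hcr _ _ _).2 ⟨?_, fun m hm => ?_⟩, rfl⟩⟩
    · have := Nat.find_spec hex
      intro h; rw [h] at this; simp at this
    · have := Nat.find_min hex hm
      simpa using this

theorem tred_of_approx (F : List Bool → ℕ → Option Bool) (hF : Computable₂ F) (X Y : ℕ → Bool)
    (h1 : ∀ k, ∃ N, (F (pre X N) k).isSome)
    (h2 : ∀ k N b, F (pre X N) k = some b → b = Y k) : TRed Y X := by
  obtain ⟨c, hc⟩ := exists_oracle_search (fun τ n => (F τ n).map fun b => cond b 1 0) (by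
    refine Computable.option_map hF ?_
    exact (Primrec.cond Primrec.snd (Primrec.const 1) (Primrec.const 0)).to_comp)
  refine ⟨c, ?_⟩
  funext n
  have hd : (c.eval (chi X) n).Dom := (hc X n).2 (by
    obtain ⟨N, hN⟩ := h1 n; exact ⟨N, by simpa using hN⟩)
  obtain ⟨v, hv⟩ := Part.dom_iff_mem.1 hd
  obtain ⟨N, hN⟩ := (hc X n).1 v hv
  rw [Option.map_eq_some_iff] at hN
  obtain ⟨b, hb, rfl⟩ := hN
  rw [Part.eq_some_iff.2 hv, h2 _ _ _ hb]
  rfl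

/-- approximations for a Turing reduction -/
theorem TRed.approx {Y X : ℕ → Bool} (h : TRed Y X) :
    ∃ G : List Bool → ℕ → Option Bool, Primrec₂ G ∧
    (∀ τ τ' n v, τ <+: τ' → G τ n = some v → G τ' n = some v) ∧
    (∀ n, ∃ N, G (pre X N) n = some (Y n)) ∧ (∀ n N b, G (pre X N) n = some b → b = Y n) := by
  obtain ⟨c, hc⟩ := h
  obtain ⟨G, hG, hm, hv⟩ := exists_approx c
  refine ⟨fun τ n => (G τ n).map fun v => decide (v = 1), ?_, ?_, ?_, ?_⟩
  · refine Primrec.option_map hG ?_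
    exact (Primrec.eq.comp Primrec.snd (Primrec.const 1)).decide
  · intro τ τ' n v hτ h
    simp only [Option.map_eq_some_iff] at h ⊢
    obtain ⟨a, ha, rfl⟩ := h
    exact ⟨a, hm _ _ _ _ hτ ha, rfl⟩
  · intro n
    obtain ⟨N, hN⟩ := (hv X n (cond (Y n) 1 0)).1 (by rw [hc]; exact Part.mem_some _)
    refine ⟨N, ?_⟩
    simp only [hN, Option.map_some]
    cases Y n <;> simp
  · intro n N b hb
    simp only [Option.map_eq_some_iff] at hb
    obtain ⟨a, ha, rfl⟩ := hb
    have := (hv X n a).2 ⟨N, ha⟩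
    rw [hc] at this
    have : a = cond (Y n) 1 0 := by simpa [chi] using this
    rw [this]; cases Y n <;> simp

theorem computableSeq_of_computable {X : ℕ → Bool} (h : Computable X) : ComputableSeq X := by
  refine tred_of_approx (fun _ n => some (X n)) ?_ _ _ (by simp) (by simp)
  exact Computable.option_some.comp (h.comp Computable.snd)

theorem encodeCode_injective : Function.Injective OracleCode.encodeCode := by
  intro a
  induction a with
  | zero => intro b h; cases b <;> simp [OracleCode.encodeCode] at h ⊢
  | succ => intro b h; cases b <;> simp [OracleCode.encodeCode] at h ⊢
  | left => intro b h; cases b <;> simp [OracleCode.encodeCode] at h ⊢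
  | right => intro b h; cases b <;> simp [OracleCode.encodeCode] at h ⊢
  | oracle => intro b h; cases b <;> simp [OracleCode.encodeCode] at h ⊢
  | pair a1 a2 ih1 ih2 =>
    intro b h
    cases b <;> simp only [OracleCode.encodeCode] at h <;> try omega
    have h' := Nat.pair_eq_pair.1 (Nat.eq_of_mul_eq_mul_left (by norm_num : 0 < 4)
      (Nat.add_right_cancel h))
    rw [ih1 h'.1, ih2 h'.2]
  | comp a1 a2 ih1 ih2 =>
    intro b h
    cases b <;> simp only [OracleCode.encodeCode] at h <;> try omega
    have h' := Nat.pair_eq_pair.1 (Nat.eq_of_mul_eq_mul_left (by norm_num : 0 < 4)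
      (Nat.add_right_cancel h))
    rw [ih1 h'.1, ih2 h'.2]
  | prec a1 a2 ih1 ih2 =>
    intro b h
    cases b <;> simp only [OracleCode.encodeCode] at h <;> try omega
    have h' := Nat.pair_eq_pair.1 (Nat.eq_of_mul_eq_mul_left (by norm_num : 0 < 4)
      (Nat.add_right_cancel h))
    rw [ih1 h'.1, ih2 h'.2]
  | rfind' a1 ih1 =>
    intro b h
    cases b <;> simp only [OracleCode.encodeCode] at h <;> try omega
    have h' := Nat.pair_eq_pair.1 (Nat.eq_of_mul_eq_mul_left (by norm_num : 0 < 4)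
      (Nat.add_right_cancel h))
    rw [ih1 h'.1]

/-- numeral codes -/
def numCode : ℕ → OracleCode
  | 0 => .zero
  | k + 1 => .comp .succ (numCode k)

theorem eval_numCode (g : ℕ →. ℕ) (k n : ℕ) : (numCode k).eval g n = Part.some k := by
  induction k with
  | zero => rfl
  | succ k ih =>
    rw [Part.eq_some_iff] at ih ⊢
    rw [numCode, mem_eval_comp]
    exact ⟨k, ih, Part.mem_some _⟩

theorem primrec_numCode : Primrec fun k => (numCode k).encodeCode := by
  have : Primrec fun k : ℕ => (Nat.rec 0 (fun _ r => 4 * Nat.pair 1 r + 6) k : ℕ) := by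
    refine Primrec.nat_rec₁ 0 ?_
    refine Primrec.nat_add.comp (Primrec.nat_mul.comp (Primrec.const 4)
      (Primrec₂.natPair.comp (Primrec.const 1) Primrec.snd)) (Primrec.const 6)
  refine this.of_eq fun k => ?_
  induction k with
  | zero => rfl
  | succ k ih => simp only [numCode, OracleCode.encodeCode, ih]

/-- `Σ₂` predicates are c.e. in `∅'`. -/
theorem exists_code_sigma2 (P : ℕ → ℕ → ℕ → Bool)
    (hP : Computable fun p : ℕ × ℕ × ℕ => P p.1 p.2.1 p.2.2) :
    ∃ c : OracleCode, ∀ z, (c.eval (chi zeroJump) z).Dom ↔ ∃ a, ∀ t, P z a t = true := by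
  have h1 : Partrec fun q : ℕ => Nat.rfind fun t =>
      (Part.some (!P q.unpair.1 q.unpair.2 t) : Part Bool) := by
    refine Partrec.rfind ?_
    have hu : Computable fun q : ℕ × ℕ => q.1.unpair := Computable.unpair.comp Computable.fst
    have hq : Computable fun q : ℕ × ℕ => (q.1.unpair.1, q.1.unpair.2, q.2) :=
      (Computable.fst.comp hu).pair ((Computable.snd.comp hu).pair Computable.snd)
    have h2 := Primrec.not.to_comp.comp (hP.comp hq)
    dsimp only at h2
    exact h2.partrec
  obtain ⟨d, hd⟩ := exists_oracleCode h1
  let s : ℕ → ℕ → ℕ := fun z a => (OracleCode.comp d (numCode (Nat.pair z a))).encodeCode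
  have hs : Primrec₂ s := by
    have : Primrec fun p : ℕ × ℕ =>
        4 * Nat.pair d.encodeCode (numCode (Nat.pair p.1 p.2)).encodeCode + 6 :=
      Primrec.nat_add.comp (Primrec.nat_mul.comp (Primrec.const 4)
        (Primrec₂.natPair.comp (Primrec.const _)
          (primrec_numCode.comp (Primrec₂.natPair.comp Primrec.fst Primrec.snd)))) (Primrec.const 6)
    exact this
  have hz : ∀ z a, zeroJump (s z a) = true ↔ ∃ t, P z a t = false := by
    intro z a
    unfold zeroJump jump
    rw [@decide_eq_true_iff _ (Classical.dec _)]
    have hdom : ∀ n, ((OracleCode.comp d (numCode (Nat.pair z a))).eval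
        (chi fun _ => false) n).Dom ↔ ∃ t, P z a t = false := by
      intro n
      rw [Part.dom_iff_mem]
      simp only [mem_eval_comp, eval_numCode, Part.mem_some_iff, exists_eq_left, hd, Nat.unpair_pair]
      rw [← Part.dom_iff_mem]
      refine Nat.rfind_dom.trans ?_
      simp
    constructor
    · rintro ⟨c, hc, hc2⟩
      rw [encodeCode_injective hc] at hc2
      exact (hdom _).1 hc2
    · intro h
      exact ⟨_, rfl, (hdom _).2 h⟩
  obtain ⟨c, hc⟩ := exists_oracle_search
    (fun τ z => ((List.range τ.length).filterMap fun a =>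
      bif decide (τ[s z a]? = some false) then some a else none).head?) (by
    refine Primrec.to_comp ?_
    refine Primrec.list_head?.comp ?_
    refine Primrec.listFilterMap (Primrec.list_range.comp
      (Primrec.list_length.comp Primrec.fst)) ?_
    refine Primrec.cond ?_ (Primrec.option_some.comp Primrec.snd) (Primrec.const none)
    refine (Primrec.eq.comp ?_ (Primrec.const _)).decide
    exact Primrec.list_getElem?.comp (Primrec.fst.comp Primrec.fst)
      (hs.comp (Primrec.snd.comp Primrec.fst) Primrec.snd))
  refine ⟨c, fun z => ?_⟩
  have key : ∀ a, (∀ t, P z a t = true) ↔ zeroJump (s z a) = false := by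
    intro a
    rw [← Bool.not_eq_true, hz]; simp
  constructor
  · intro h
    obtain ⟨v, hv⟩ := Part.dom_iff_mem.1 h
    obtain ⟨N, hN⟩ := (hc zeroJump z).1 v hv
    have := List.mem_of_head? hN
    rw [List.mem_filterMap] at this
    obtain ⟨a, -, ha⟩ := this
    refine ⟨a, (key a).2 ?_⟩
    by_cases hb : (pre zeroJump N)[s z a]? = some false
    · have hlt : s z a < N := by
        by_contra hn
        rw [List.getElem?_eq_none (by simp; omega)] at hb; simp at hb
      rw [pre_getElem? _ _ _ hlt] at hb
      simpa using hb
    · simp [hb] at ha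
  · rintro ⟨a, ha⟩
    refine (hc zeroJump z).2 ⟨max a (s z a) + 1, ?_⟩
    rw [List.isSome_head?]
    refine List.ne_nil_of_mem (a := a) ?_
    rw [List.mem_filterMap]
    refine ⟨a, by simp, ?_⟩
    have : (pre zeroJump (max a (s z a) + 1))[s z a]? = some false := by
      rw [pre_getElem? _ _ _ (by omega), (key a).1 ha]
    rw [this]; rfl

end

section
/-! ### Part II: counting measure on strings and combinatorial lemmas -/

/-- All strings of length `t`. -/
def strs : ℕ → List (List Bool)
  | 0 => [[]]
  | t + 1 => (strs t).flatMap fun σ => [σ ++ [false], σ ++ [true]]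

theorem mem_strs {t : ℕ} {x : List Bool} : x ∈ strs t ↔ x.length = t := by
  induction t generalizing x with
  | zero => simp [strs]
  | succ t ih =>
    simp only [strs, List.mem_flatMap, ih, List.mem_cons, List.not_mem_nil, or_false]
    constructor
    · rintro ⟨a, rfl, rfl | rfl⟩ <;> simp
    · intro h
      have hx : x ≠ [] := by rintro rfl; simp at h
      refine ⟨x.dropLast, by simp [h], ?_⟩
      have := List.dropLast_append_getLast hx
      cases hb : x.getLast hx
      · left; rw [hb] at this; exact this.symm
      · right; rw [hb] at this; exact this.symm

theorem strs_length (t : ℕ) : (strs t).length = 2 ^ t := by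
  induction t with
  | zero => rfl
  | succ t ih =>
    simp only [strs, List.length_flatMap]
    simp [ih, pow_succ]

theorem strs_nodup (t : ℕ) : (strs t).Nodup := by
  induction t with
  | zero => simp [strs]
  | succ t ih =>
    simp only [strs]
    rw [List.nodup_flatMap]
    refine ⟨fun x _ => by simp, ?_⟩
    refine ih.imp ?_
    intro a b hab
    simp only [Function.onFun, List.disjoint_left, List.mem_cons, List.not_mem_nil, or_false]
    rintro x (rfl | rfl) (h | h)
    · exact hab (List.append_inj' h rfl).1
    · exact absurd (List.append_inj' h rfl).2 (by simp)
    · exact absurd (List.append_inj' h rfl).2 (by simp)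
    · exact hab (List.append_inj' h rfl).1

open Classical in
/-- proportion of strings of length `t` satisfying `P` -/
noncomputable def m (t : ℕ) (P : List Bool → Prop) : ℝ :=
  ((strs t).countP fun x => decide (P x) : ℝ) / 2 ^ t

theorem m_eq_card (t : ℕ) (P : List Bool → Prop) [DecidablePred P] :
    m t P = (((strs t).toFinset.filter P).card : ℝ) / 2 ^ t := by
  unfold m
  congr 2
  rw [List.countP_eq_length_filter, ← List.toFinset_card_of_nodup ((strs_nodup t).filter _),
    List.toFinset_filter]
  congr 1
  ext x
  simp

theorem countP_eq_m (t : ℕ) (p : List Bool → Bool) :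
    ((strs t).countP p : ℝ) = m t (fun x => p x = true) * 2 ^ t := by
  unfold m
  rw [div_mul_cancel₀ _ (by positivity)]
  simp

theorem m_nonneg (t : ℕ) (P : List Bool → Prop) : 0 ≤ m t P := by unfold m; positivity

theorem m_mono {t : ℕ} {P Q : List Bool → Prop} (h : ∀ x, x.length = t → P x → Q x) :
    m t P ≤ m t Q := by
  unfold m
  refine div_le_div_of_nonneg_right ?_ (by positivity)
  norm_cast
  refine List.countP_mono_left fun x hx hp => ?_
  simp only [decide_eq_true_eq] at hp ⊢
  exact h x (mem_strs.1 hx) hp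

theorem m_congr {t : ℕ} {P Q : List Bool → Prop} (h : ∀ x, x.length = t → (P x ↔ Q x)) :
    m t P = m t Q :=
  le_antisymm (m_mono fun x hx => (h x hx).1) (m_mono fun x hx => (h x hx).2)

theorem m_le_one (t : ℕ) (P : List Bool → Prop) : m t P ≤ 1 := by
  unfold m
  rw [div_le_one (by positivity)]
  have := List.countP_le_length (l := strs t) (p := fun x => @decide (P x) (Classical.propDecidable _))
  rw [strs_length] at this
  exact_mod_cast this

theorem m_union {ι : Type*} (t : ℕ) (s : Finset ι) (P : ι → List Bool → Prop) :
    m t (fun x => ∃ i ∈ s, P i x) ≤ ∑ i ∈ s, m t (P i) := by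
  classical
  simp only [m_eq_card]
  rw [← Finset.sum_div]
  refine div_le_div_of_nonneg_right ?_ (by positivity)
  have : (strs t).toFinset.filter (fun x => ∃ i ∈ s, P i x) ⊆
      s.biUnion fun i => (strs t).toFinset.filter (P i) := by
    intro x hx
    simp only [Finset.mem_filter, Finset.mem_biUnion] at hx ⊢
    obtain ⟨h1, i, hi, hp⟩ := hx
    exact ⟨i, hi, h1, hp⟩
  exact_mod_cast (Finset.card_le_card this).trans Finset.card_biUnion_le

theorem m_or (t : ℕ) (P Q : List Bool → Prop) : m t (fun x => P x ∨ Q x) ≤ m t P + m t Q := by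
  have := m_union t (Finset.univ : Finset Bool) (fun b => cond b P Q)
  simp only [Fintype.sum_bool, cond_true, cond_false] at this
  refine le_trans (m_mono fun x _ h => ?_) this
  rcases h with h | h
  · exact ⟨true, Finset.mem_univ _, h⟩
  · exact ⟨false, Finset.mem_univ _, h⟩

theorem m_disjoint_sum {ι : Type*} (t : ℕ) (s : Finset ι) (P : ι → List Bool → Prop)
    (h : ∀ i ∈ s, ∀ k ∈ s, ∀ x, P i x → P k x → i = k) : ∑ i ∈ s, m t (P i) ≤ 1 := by
  classical
  refine le_trans (le_of_eq ?_) (m_le_one t fun x => ∃ i ∈ s, P i x)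
  simp only [m_eq_card]
  rw [← Finset.sum_div]
  congr 1
  have : (strs t).toFinset.filter (fun x => ∃ i ∈ s, P i x) =
      s.biUnion fun i => (strs t).toFinset.filter (P i) := by
    ext x
    simp only [Finset.mem_filter, Finset.mem_biUnion]
    constructor
    · rintro ⟨h1, i, hi, hp⟩; exact ⟨i, hi, h1, hp⟩
    · rintro ⟨i, hi, h1, hp⟩; exact ⟨h1, i, hi, hp⟩
  rw [this, Finset.card_biUnion]
  · push_cast; rfl
  · intro i hi k hk hik
    rw [Function.onFun, Finset.disjoint_left]
    intro x hx hx'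
    exact hik (h i hi k hk x (Finset.mem_filter.1 hx).2 (Finset.mem_filter.1 hx').2)

theorem m_up_succ {P : List Bool → Prop} (hP : ∀ x x', x <+: x' → P x → P x') (t : ℕ) :
    m t P ≤ m (t + 1) P := by
  unfold m
  rw [div_le_div_iff₀ (by positivity) (by positivity), pow_succ]
  have key : ∀ l : List (List Bool), 2 * l.countP (fun x => @decide (P x) (Classical.propDecidable _)) ≤
      (l.flatMap fun σ => [σ ++ [false], σ ++ [true]]).countP
        (fun x => @decide (P x) (Classical.propDecidable _)) := by
    intro l
    induction l with
    | nil => simp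
    | cons a l ih =>
      simp only [List.flatMap_cons, List.countP_append, List.countP_cons]
      by_cases h : P a
      · have h0 := hP a (a ++ [false]) (List.prefix_append _ _) h
        have h1 := hP a (a ++ [true]) (List.prefix_append _ _) h
        simp [h, h0, h1]; omega
      · simp [h]; omega
  have := key (strs t)
  have h2 : (2 * (strs t).countP (fun x => @decide (P x) (Classical.propDecidable _)) : ℝ) ≤
      ((strs (t + 1)).countP (fun x => @decide (P x) (Classical.propDecidable _)) : ℝ) := by
    exact_mod_cast this
  have h3 : (0 : ℝ) < 2 ^ t := by positivity
  nlinarith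

theorem m_up {P : List Bool → Prop} (hP : ∀ x x', x <+: x' → P x → P x') {t t' : ℕ} (h : t ≤ t') :
    m t P ≤ m t' P := by
  induction h with
  | refl => exact le_rfl
  | step _ ih => exact ih.trans (m_up_succ hP _)

/-- `y` extends the string `v` -/
def Ext (v : List Bool) (y : ℕ → Bool) : Prop := pre y v.length = v

/-- the sequence extending `σ` by zeros -/
def ext (σ : List Bool) : ℕ → Bool := fun i => σ.getD i false

theorem ext_Ext (σ : List Bool) : Ext σ (ext σ) := by
  unfold Ext
  refine List.ext_getElem (by simp) fun i h1 h2 => ?_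
  rw [pre_getElem]
  simp [ext, h2]

theorem Ext_pre (y : ℕ → Bool) (n : ℕ) : Ext (pre y n) y := by simp [Ext]

theorem Ext_of_pfx {v v' : List Bool} (h : v <+: v') {y : ℕ → Bool} (hy : Ext v' y) : Ext v y := by
  unfold Ext at *
  rw [← pre_take y v'.length v.length h.length_le, hy]
  exact (List.prefix_iff_eq_take.1 h).symm

theorem Ext_iff_pfx {v : List Bool} {y : ℕ → Bool} {n : ℕ} (hn : v.length ≤ n) :
    Ext v y ↔ v <+: pre y n := by
  constructor
  · intro h; rw [← h]; exact pre_pfx y hn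
  · intro h; exact Ext_of_pfx h (Ext_pre y n)

theorem pre_eq_iff {y y' : ℕ → Bool} {n : ℕ} : pre y n = pre y' n ↔ ∀ i < n, y i = y' i := by
  constructor
  · intro h i hi
    have h1 := pre_getElem? y n i hi
    rw [h, pre_getElem? y' n i hi] at h1
    simpa using h1.symm
  · intro h
    unfold pre
    exact List.map_congr_left fun i hi => h i (by simpa using hi)

theorem Ext_getElem {v : List Bool} {y : ℕ → Bool} (h : Ext v y) (i : ℕ) (hi : i < v.length) :
    y i = v[i] := by
  have : (pre y v.length)[i]'(by simpa using hi) = v[i] := by congr 1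
  rw [← this, pre_getElem]

/-- proper extension: next bit -/
theorem Ext_append_bit {v : List Bool} {y : ℕ → Bool} (h : Ext v y) : Ext (v ++ [y v.length]) y := by
  unfold Ext at *
  simp [pre_succ, h]

theorem Ext_append_iff {v : List Bool} {y : ℕ → Bool} {b : Bool} :
    Ext (v ++ [b]) y ↔ Ext v y ∧ y v.length = b := by
  constructor
  · intro h
    have h1 := Ext_of_pfx (List.prefix_append v [b]) h
    refine ⟨h1, ?_⟩
    rw [Ext_getElem h v.length (by simp)]; simp
  · rintro ⟨h, rfl⟩; exact Ext_append_bit h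

/-- `x` is mapped to the left of `y`, branching at a position in `[n, N)`. -/
def leftP (φ : List Bool → List Bool) (N n : ℕ) (y : ℕ → Bool) (x : List Bool) : Bool :=
  (List.range N).any fun i => decide (n ≤ i) && y i && (pre y i ++ [false]).isPrefixOf (φ x)

theorem leftP_iff {φ : List Bool → List Bool} {N n : ℕ} {y : ℕ → Bool} {x : List Bool} :
    leftP φ N n y x = true ↔ ∃ i, n ≤ i ∧ i < N ∧ y i = true ∧ pre y i ++ [false] <+: φ x := by
  simp only [leftP, List.any_eq_true, List.mem_range, Bool.and_eq_true, decide_eq_true_eq,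
    List.isPrefixOf_iff_prefix]
  constructor
  · rintro ⟨i, h, ⟨h1, h2⟩, h3⟩; exact ⟨i, h1, h, h2, h3⟩
  · rintro ⟨i, h1, h, h2, h3⟩; exact ⟨i, h, ⟨h1, h2⟩, h3⟩

/-- Rightmost lemma. -/
theorem exists_rightmost (φ : List Bool → List Bool) (Λ : List Bool → Prop) (T : ℕ) :
    ∀ (r : ℕ) (ρ : List Bool), ρ.length + r = T → (∃ σ, Λ σ ∧ ρ <+: σ ∧ σ.length ≤ T) →
    ∃ σ', Λ σ' ∧ ρ <+: σ' ∧ σ'.length ≤ T ∧ ∀ σ x, Λ σ → ρ <+: σ → σ.length ≤ T → σ <+: φ x →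
      σ' <+: φ x ∨ leftP φ σ'.length ρ.length (ext σ') x = true := by
  intro r
  induction r with
  | zero =>
    rintro ρ hr ⟨σ, hσ, hρσ, hl⟩
    have : ρ = σ := hρσ.eq_of_length (by have := hρσ.length_le; omega)
    subst this
    refine ⟨ρ, hσ, hρσ, hl, fun σ x _ h1 _ h3 => Or.inl (h1.trans h3)⟩
  | succ r ih =>
    rintro ρ hr ⟨σ, hσ, hρσ, hl⟩
    by_cases h0 : Λ ρ
    · exact ⟨ρ, h0, List.prefix_rfl, by omega, fun σ x _ h1 _ h3 => Or.inl (h1.trans h3)⟩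
    have split : ∀ σ, Λ σ → ρ <+: σ → ρ ++ [false] <+: σ ∨ ρ ++ [true] <+: σ := by
      rintro σ hσ ⟨s, rfl⟩
      cases s with
      | nil => simp at hσ; exact absurd hσ h0
      | cons b s => cases b
                    · left; exact ⟨s, by simp⟩
                    · right; exact ⟨s, by simp⟩
    have left_mono : ∀ (σ' : List Bool) x b, leftP φ σ'.length (ρ ++ [b]).length (ext σ') x = true →
        leftP φ σ'.length ρ.length (ext σ') x = true := by
      intro σ' x b h
      rw [leftP_iff] at h ⊢
      obtain ⟨i, h1, h2⟩ := h
      exact ⟨i, by simp at h1; omega, h2⟩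
    by_cases h1 : ∃ σ, Λ σ ∧ ρ ++ [true] <+: σ ∧ σ.length ≤ T
    · obtain ⟨σ', a1, a2, a3, a4⟩ := ih (ρ ++ [true]) (by simp; omega) h1
      refine ⟨σ', a1, (List.prefix_append _ _).trans a2, a3, fun σ x b1 b2 b3 b4 => ?_⟩
      rcases split σ b1 b2 with h | h
      · right
        rw [leftP_iff]
        have he := ext_Ext σ'
        have he' := Ext_append_iff.1 (Ext_of_pfx a2 he)
        refine ⟨ρ.length, le_rfl, ?_, he'.2, ?_⟩
        · have := a2.length_le; simp at this; omega
        · have : pre (ext σ') ρ.length = ρ := he'.1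
          rw [this]; exact h.trans b4
      · rcases a4 σ x b1 h b3 b4 with h' | h'
        · exact Or.inl h'
        · exact Or.inr (left_mono _ _ _ h')
    · have h2 : ∀ σ, Λ σ → ρ <+: σ → σ.length ≤ T → ρ ++ [false] <+: σ := by
        intro σ b1 b2 b3
        rcases split σ b1 b2 with h | h
        · exact h
        · exact absurd ⟨σ, b1, h, b3⟩ h1
      obtain ⟨σ', a1, a2, a3, a4⟩ := ih (ρ ++ [false]) (by simp; omega) ⟨σ, hσ, h2 σ hσ hρσ hl, hl⟩
      refine ⟨σ', a1, (List.prefix_append _ _).trans a2, a3, fun σ x b1 b2 b3 b4 => ?_⟩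
      rcases a4 σ x b1 (h2 σ b1 b2 b3) b3 b4 with h' | h'
      · exact Or.inl h'
      · exact Or.inr (left_mono _ _ _ h')

/-- Leftmost lemma. -/
theorem exists_leftmost (Rel : (ℕ → Bool) → Prop) (T : ℕ) :
    ∀ (r : ℕ) (ρ : List Bool), ρ.length + r = T → (∃ y, Ext ρ y ∧ Rel y) →
    ∃ u, Ext ρ u ∧ Rel u ∧ ∀ i, ρ.length ≤ i → i < T → u i = true →
      ∀ y, Ext (pre u i ++ [false]) y → ¬ Rel y := by
  intro r
  induction r with
  | zero =>
    rintro ρ hr ⟨y, hy, hy2⟩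
    exact ⟨y, hy, hy2, fun i h1 h2 => by omega⟩
  | succ r ih =>
    rintro ρ hr ⟨y, hy, hy2⟩
    by_cases h0 : ∃ y, Ext (ρ ++ [false]) y ∧ Rel y
    · obtain ⟨u, a1, a2, a3⟩ := ih (ρ ++ [false]) (by simp; omega) h0
      rw [Ext_append_iff] at a1
      refine ⟨u, a1.1, a2, fun i h1 h2 h3 => ?_⟩
      rcases h1.eq_or_lt with rfl | h
      · rw [a1.2] at h3; simp at h3
      · exact a3 i (by simp; omega) h2 h3
    · have hyt : y ρ.length = true := by
        by_contra hb
        exact h0 ⟨y, Ext_append_iff.2 ⟨hy, by simpa using hb⟩, hy2⟩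
      obtain ⟨u, a1, a2, a3⟩ := ih (ρ ++ [true]) (by simp; omega)
        ⟨y, Ext_append_iff.2 ⟨hy, hyt⟩, hy2⟩
      rw [Ext_append_iff] at a1
      refine ⟨u, a1.1, a2, fun i h1 h2 h3 => ?_⟩
      rcases h1.eq_or_lt with rfl | h
      · intro y' hy' hr'
        have : pre u ρ.length = ρ := a1.1
        rw [this] at hy'
        exact h0 ⟨y', hy', hr'⟩
      · exact a3 i (by simp; omega) h2 h3

/-- Region lemma. -/
theorem region {φ : List Bool → List Bool} (hφ : ∀ x x', x <+: x' → φ x <+: φ x')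
    (Good : (ℕ → Bool) → Prop) (t tb : ℕ) (τ : List Bool) (θ : ℝ) (hτ : τ.length ≤ t) (htb : tb ≤ t)
    (hθ : θ ≤ m tb fun x => τ <+: φ x)
    (h : ∀ y, Ext τ y → ¬ Good y → ∃ s ≤ t, θ ≤ m s fun x => leftP φ s τ.length y x = true)
    (T : ℕ) (hT : t ≤ T) :
    θ ≤ m T fun x => ∃ v, v <+: φ x ∧ τ <+: v ∧ ∀ y, Ext v y → Good y := by
  by_cases hex : ∃ y, Ext τ y ∧ ¬ Good y
  · obtain ⟨u, a1, a2, a3⟩ := exists_leftmost (fun y => ¬ Good y) t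
      (t - τ.length) τ
      (by omega) hex
    obtain ⟨s, hs, hs2⟩ := h u a1 a2
    refine hs2.trans ((m_up ?_ (hs.trans hT)).trans (m_mono ?_))
    · intro x x' hx h
      rw [leftP_iff] at h ⊢
      obtain ⟨i, h1, h2, h3, h4⟩ := h
      exact ⟨i, h1, h2, h3, h4.trans (hφ _ _ hx)⟩
    · intro x _ hx
      rw [leftP_iff] at hx
      obtain ⟨i, h1, h2, h3, h4⟩ := hx
      refine ⟨_, h4, ?_, fun y hy => by_contra fun hg => a3 i h1 (by omega) h3 y hy hg⟩
      refine List.IsPrefix.trans ?_ (List.prefix_append _ _)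
      exact (Ext_iff_pfx h1).1 a1
  · push Not at hex
    refine hθ.trans ((m_up ?_ (htb.trans hT)).trans (m_mono ?_))
    · intro x x' hx h
      exact h.trans (hφ _ _ hx)
    · intro x _ hx
      exact ⟨τ, hx, List.prefix_rfl, hex⟩

end

section
/-! ### Part III: the construction -/

/-- words over pairs of bits -/
abbrev Wd := List (Bool × Bool)

/-- states of the construction -/
abbrev St := Wd × List (Option (Bool × Wd)) × Option (ℕ × ℕ × Option (ℕ × Bool))

/-- parameters of the construction -/
structure Par where
  φ : List Bool → List Bool
  ev : ℕ → Bool → Wd → ℕ → Option Wd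
  φ_mono : ∀ x x', x <+: x' → φ x <+: φ x'
  φ_len : ∀ x, (φ x).length ≤ x.length
  ev_stable : ∀ e p d t t' w, t ≤ t' → ev e p d t = some w → ev e p d t' = some w
  ev_legal : ∀ e p d t w, ev e p d t = some w → (true, true) ∉ w

namespace Par

variable (P : Par) (j : ℕ)

/-- number of strings mapped above `τ` -/
def cnt (t : ℕ) (τ : List Bool) : ℕ := (strs t).countP fun x => τ.isPrefixOf (P.φ x)

/-- release condition -/
def rl (t N : ℕ) (y : ℕ → Bool) (e n tb : ℕ) (p : Bool) : Bool :=
  decide (P.cnt tb (pre y n) * 2 ^ t ≤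
    (strs t).countP (leftP P.φ N n y) * 2 ^ tb * 2 ^ (cond p 2 1 * (e + j + 3)))

/-- is `x` in the pool because of `σ` with state `s` -/
def poolHit (e : ℕ) (x σ : List Bool) (s : St) : Bool :=
  match s.2.2 with
  | some (e', n, none) => decide (e' = e) && (σ.take n).isPrefixOf (P.φ x)
  | _ => false

/-- batch condition -/
def btf (t : ℕ) (f : List Bool → St) (e : ℕ) : Bool :=
  decide (2 ^ t ≤ ((strs t).countP fun x => (strs t).any fun σ => P.poolHit e x σ (f σ)) *
    2 ^ (e + j + 3))

/-- does entry `e` of the list need attention -/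
def bad (t : ℕ) (L : List (Option (Bool × Wd))) (e : ℕ) : Bool :=
  match L[e]? with
  | some (some (p, d)) => (P.ev e p d t).isSome
  | _ => false

/-- first entry requiring attention -/
def firstBad (t : ℕ) (L : List (Option (Bool × Wd))) : Option ℕ :=
  ((List.range L.length).filter (P.bad t L)).head?

/-- one step of the construction -/
def step (t : ℕ) (b : ℕ → Bool) (y : ℕ → Bool) (s : St) : St :=
  match s.2.2 with
  | none =>
    match P.firstBad t s.2.1 with
    | some e => (s.1, s.2.1, some (e, t, none))
    | none => (s.1 ++ [(true, true), (false, y s.2.1.length)],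
        s.2.1 ++ [some (false, s.1 ++ [(true, true), (false, y s.2.1.length)])], none)
  | some (e, n, none) =>
    bif b e then (s.1, s.2.1, some (e, n, some (t, false))) else s
  | some (e, n, some (tb, p)) =>
    match P.ev e p s.1 t with
    | some w => bif p then (s.1 ++ w, s.2.1.set e none, none)
        else (s.1, s.2.1, some (e, n, some (tb, true)))
    | none => bif P.rl j t t y e n tb p then
        (s.1 ++ cond p ((P.ev e false s.1 t).getD []) [], s.2.1.set e (some (p, s.1)), none)
        else s

/-- state at time `t` along `y` -/
def stf : ℕ → (ℕ → Bool) → St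
  | 0 => fun _ => ([], [], none)
  | t + 1 => fun y => P.step j t (P.btf j t fun σ => stf t (ext σ)) y (stf t y)

/-- batch condition at time `t` -/
def bt (t e : ℕ) : Bool := P.btf j t (fun σ => P.stf j t (ext σ)) e

/-- the word built by time `t` -/
def Dd (t : ℕ) (y : ℕ → Bool) : Wd := (P.stf j t y).1
/-- the list of entries at time `t` -/
def LL (t : ℕ) (y : ℕ → Bool) : List (Option (Bool × Wd)) := (P.stf j t y).2.1
/-- the mode at time `t` -/
def md (t : ℕ) (y : ℕ → Bool) : Option (ℕ × ℕ × Option (ℕ × Bool)) := (P.stf j t y).2.2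

/-- the possible transitions -/
inductive StepCase (t : ℕ) (y : ℕ → Bool) : Prop
  | pool (e : ℕ) (h0 : P.md j t y = none) (hb : P.firstBad t (P.LL j t y) = some e)
      (hD : P.Dd j (t + 1) y = P.Dd j t y) (hL : P.LL j (t + 1) y = P.LL j t y)
      (hm : P.md j (t + 1) y = some (e, t, none))
  | code (h0 : P.md j t y = none) (hb : P.firstBad t (P.LL j t y) = none)
      (hD : P.Dd j (t + 1) y = P.Dd j t y ++ [(true, true), (false, y (P.LL j t y).length)])
      (hL : P.LL j (t + 1) y = P.LL j t y ++ [some (false, P.Dd j (t + 1) y)])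
      (hm : P.md j (t + 1) y = none)
  | batch (e n : ℕ) (h0 : P.md j t y = some (e, n, none)) (hb : P.bt j t e = true)
      (hD : P.Dd j (t + 1) y = P.Dd j t y) (hL : P.LL j (t + 1) y = P.LL j t y)
      (hm : P.md j (t + 1) y = some (e, n, some (t, false)))
  | wait (e n : ℕ) (h0 : P.md j t y = some (e, n, none)) (hb : P.bt j t e = false)
      (hD : P.Dd j (t + 1) y = P.Dd j t y) (hL : P.LL j (t + 1) y = P.LL j t y)
      (hm : P.md j (t + 1) y = some (e, n, none))
  | ev0 (e n tb : ℕ) (w : Wd) (h0 : P.md j t y = some (e, n, some (tb, false)))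
      (hw : P.ev e false (P.Dd j t y) t = some w)
      (hD : P.Dd j (t + 1) y = P.Dd j t y) (hL : P.LL j (t + 1) y = P.LL j t y)
      (hm : P.md j (t + 1) y = some (e, n, some (tb, true)))
  | ev1 (e n tb : ℕ) (w : Wd) (h0 : P.md j t y = some (e, n, some (tb, true)))
      (hw : P.ev e true (P.Dd j t y) t = some w)
      (hD : P.Dd j (t + 1) y = P.Dd j t y ++ w) (hL : P.LL j (t + 1) y = (P.LL j t y).set e none)
      (hm : P.md j (t + 1) y = none)
  | rel (e n tb : ℕ) (p : Bool) (h0 : P.md j t y = some (e, n, some (tb, p)))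
      (hw : P.ev e p (P.Dd j t y) t = none) (hr : P.rl j t t y e n tb p = true)
      (hD : P.Dd j (t + 1) y = P.Dd j t y ++ cond p ((P.ev e false (P.Dd j t y) t).getD []) [])
      (hL : P.LL j (t + 1) y = (P.LL j t y).set e (some (p, P.Dd j t y)))
      (hm : P.md j (t + 1) y = none)
  | stay (e n tb : ℕ) (p : Bool) (h0 : P.md j t y = some (e, n, some (tb, p)))
      (hw : P.ev e p (P.Dd j t y) t = none) (hr : P.rl j t t y e n tb p = false)
      (hD : P.Dd j (t + 1) y = P.Dd j t y) (hL : P.LL j (t + 1) y = P.LL j t y)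
      (hm : P.md j (t + 1) y = some (e, n, some (tb, p)))

theorem stf_succ (t : ℕ) (y : ℕ → Bool) :
    P.stf j (t + 1) y = P.step j t (P.bt j t) y (P.stf j t y) := rfl

theorem stepCase (t : ℕ) (y : ℕ → Bool) : P.StepCase j t y := by
  have hs := P.stf_succ j t y
  unfold step at hs
  rcases hmd : P.md j t y with _ | ⟨e, n, _ | ⟨tb, p⟩⟩
  · have hmd' := hmd
    unfold md at hmd
    rw [hmd] at hs
    dsimp only at hs
    rcases hb : P.firstBad t (P.LL j t y) with _ | e
    · have hb' := hb
      unfold LL at hb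
      rw [hb] at hs
      exact .code hmd' hb' (by simp [Dd, LL, hs]) (by simp [LL, Dd, hs]) (by simp [md, hs])
    · have hb' := hb
      unfold LL at hb
      rw [hb] at hs
      exact .pool e hmd' hb' (by simp [Dd, hs]) (by simp [LL, hs]) (by simp [md, hs])
  · have hmd' := hmd
    unfold md at hmd
    rw [hmd] at hs
    dsimp only at hs
    cases hb : P.bt j t e
    · rw [hb] at hs
      exact .wait e n hmd' hb (by simp [Dd, hs]) (by simp [LL, hs]) (by simp [md, hs, hmd])
    · rw [hb] at hs
      exact .batch e n hmd' hb (by simp [Dd, hs]) (by simp [LL, hs]) (by simp [md, hs])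
  · have hmd' := hmd
    unfold md at hmd
    rw [hmd] at hs
    dsimp only at hs
    rcases hw : P.ev e p (P.Dd j t y) t with _ | w
    · have hw' := hw
      unfold Dd at hw
      rw [hw] at hs
      dsimp only at hs
      cases hr : P.rl j t t y e n tb p
      · rw [hr] at hs
        exact .stay e n tb p hmd' hw' hr (by simp [Dd, hs]) (by simp [LL, hs]) (by simp [md, hs, hmd])
      · rw [hr] at hs
        exact .rel e n tb p hmd' hw' hr (by simp [Dd, hs]) (by simp [Dd, LL, hs]) (by simp [md, hs])
    · have hw' := hw
      unfold Dd at hw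
      rw [hw] at hs
      dsimp only at hs
      cases p
      · exact .ev0 e n tb w hmd' hw' (by simp [Dd, hs]) (by simp [LL, hs]) (by simp [md, hs])
      · exact .ev1 e n tb w hmd' hw' (by simp [Dd, hs]) (by simp [LL, hs]) (by simp [md, hs])

theorem firstBad_some {t : ℕ} {L : List (Option (Bool × Wd))} {e : ℕ} (h : P.firstBad t L = some e) :
    e < L.length ∧ P.bad t L e = true ∧ ∀ e' < e, P.bad t L e' = false := by
  unfold firstBad at h
  rw [List.head?_filter, List.find?_range_eq_some] at h
  simp only [List.mem_range, Bool.not_eq_true'] at h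
  exact ⟨h.2.1, h.1, h.2.2⟩

theorem firstBad_none {t : ℕ} {L : List (Option (Bool × Wd))} (h : P.firstBad t L = none) :
    ∀ e < L.length, P.bad t L e = false := by
  unfold firstBad at h
  rw [List.head?_filter, List.find?_range_eq_none] at h
  simpa using h

theorem LL_length_le (t : ℕ) (y : ℕ → Bool) : (P.LL j t y).length ≤ t := by
  induction t with
  | zero => simp [LL, stf]
  | succ t ih => cases P.stepCase j t y <;> simp_all <;> omega

theorem LL_length_mono (t : ℕ) (y : ℕ → Bool) : (P.LL j t y).length ≤ (P.LL j (t + 1) y).length := by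
  cases P.stepCase j t y <;> simp_all

theorem mode_inv (t : ℕ) (y : ℕ → Bool) : ∀ e n o, P.md j t y = some (e, n, o) →
    n < t ∧ e < (P.LL j t y).length := by
  induction t with
  | zero => simp [md, stf]
  | succ t ih =>
    intro e n o h
    cases P.stepCase j t y with
    | pool e' h0 hb hD hL hm =>
      rw [hm] at h; simp at h; obtain ⟨rfl, rfl, rfl⟩ := h
      exact ⟨by omega, by rw [hL]; exact (P.firstBad_some hb).1⟩
    | code h0 hb hD hL hm => rw [hm] at h; simp at h
    | ev1 e n tb w h0 hw hD hL hm => rw [hm] at h; simp at h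
    | rel e n tb p h0 hw hr hD hL hm => rw [hm] at h; simp at h
    | _ =>
      rename_i hD hL hm
      rw [hm] at h; simp at h; obtain ⟨rfl, rfl, rfl⟩ := h
      rw [hL]
      have := ih _ _ _ ‹_›
      omega

theorem try_inv (t : ℕ) (y : ℕ → Bool) : ∀ e n tb p, P.md j t y = some (e, n, some (tb, p)) →
    tb < t ∧ n < tb ∧ P.bt j tb e = true ∧ P.md j tb y = some (e, n, none) ∧
    P.Dd j tb y = P.Dd j t y ∧
    (p = true → ∃ t', tb < t' ∧ t' < t ∧ (P.ev e false (P.Dd j t y) t').isSome) := by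
  induction t with
  | zero => simp [md, stf]
  | succ t ih =>
    intro e n tb p h
    cases P.stepCase j t y with
    | batch e' n' h0 hb hD hL hm =>
      rw [hm] at h; simp at h; obtain ⟨rfl, rfl, rfl, rfl⟩ := h
      exact ⟨by omega, (P.mode_inv j _ y _ _ _ h0).1, hb, h0, hD.symm, by simp⟩
    | ev0 e' n' tb' w h0 hw hD hL hm =>
      rw [hm] at h; simp at h; obtain ⟨rfl, rfl, rfl, rfl⟩ := h
      obtain ⟨h1, h2, h3, h4, h5, h6⟩ := ih _ _ _ _ h0
      refine ⟨by omega, h2, h3, h4, by rw [hD, h5], fun _ => ⟨t, h1, by omega, ?_⟩⟩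
      rw [hD, hw]; rfl
    | stay e' n' tb' p' h0 hw hr hD hL hm =>
      rw [hm] at h; simp at h; obtain ⟨rfl, rfl, rfl, rfl⟩ := h
      obtain ⟨h1, h2, h3, h4, h5, h6⟩ := ih _ _ _ _ h0
      refine ⟨by omega, h2, h3, h4, by rw [hD, h5], fun hp => ?_⟩
      obtain ⟨t', a, b, c⟩ := h6 hp
      exact ⟨t', a, by omega, by rwa [hD]⟩
    | _ => rename_i hm; rw [hm] at h; simp at h

theorem rl_congr {t N : ℕ} {y y' : ℕ → Bool} {e n tb : ℕ} {p : Bool} (hn : n ≤ N)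
    (h : ∀ i < N, y i = y' i) : P.rl j t N y e n tb p = P.rl j t N y' e n tb p := by
  have h1 : pre y n = pre y' n := pre_eq_iff.2 fun i hi => h i (by omega)
  have h2 : leftP P.φ N n y = leftP P.φ N n y' := by
    funext x
    rw [Bool.eq_iff_iff, leftP_iff, leftP_iff]
    refine exists_congr fun i => and_congr_right fun _ => and_congr_right fun hi => ?_
    have : pre y i = pre y' i := pre_eq_iff.2 fun k hk => h k (by omega)
    rw [h i hi, this]
  unfold rl
  rw [h1, h2]

theorem stf_loc (t : ℕ) (y y' : ℕ → Bool) (h : ∀ i < t, y i = y' i) :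
    P.stf j t y = P.stf j t y' := by
  induction t with
  | zero => rfl
  | succ t ih =>
    have ih := ih fun i hi => h i (by omega)
    rw [stf_succ, stf_succ, ← ih]
    have h1 : y (P.LL j t y).length = y' (P.LL j t y).length :=
      h _ (by have := P.LL_length_le j t y; omega)
    have h2 : ∀ e n tb p, P.md j t y = some (e, n, some (tb, p)) →
        P.rl j t t y e n tb p = P.rl j t t y' e n tb p := fun e n tb p hm =>
      P.rl_congr j (P.mode_inv j t y _ _ _ hm).1.le fun i hi => h i (by omega)
    unfold step
    unfold LL at h1
    unfold md at h2
    rw [h1]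
    rcases hmd : (P.stf j t y).2.2 with _ | ⟨e, n, _ | ⟨tb, p⟩⟩
    · rfl
    · rfl
    · dsimp only
      rw [h2 _ _ _ _ hmd]

theorem stf_pre (t N : ℕ) (y : ℕ → Bool) (h : t ≤ N) : P.stf j t (ext (pre y N)) = P.stf j t y := by
  refine P.stf_loc j t _ _ fun i hi => ?_
  simp [ext, pre_getElem? y N i (by omega)]

theorem stf_ext {t : ℕ} {σ : List Bool} {y : ℕ → Bool} (hy : Ext σ y) (h : t ≤ σ.length) :
    P.stf j t y = P.stf j t (ext σ) := by
  rw [← P.stf_pre j t σ.length y h, hy]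

theorem pool_uniform (t : ℕ) (y y' : ℕ → Bool) : ∀ e n, P.md j t y = some (e, n, none) →
    (∀ i < n, y i = y' i) → P.stf j t y' = P.stf j t y := by
  induction t with
  | zero => simp [md, stf]
  | succ t ih =>
    intro e n h hy
    have fin : P.Dd j (t + 1) y' = P.Dd j (t + 1) y → P.LL j (t + 1) y' = P.LL j (t + 1) y →
        P.md j (t + 1) y' = P.md j (t + 1) y → P.stf j (t + 1) y' = P.stf j (t + 1) y := by
      intro a b c
      exact Prod.ext a (Prod.ext b c)
    cases P.stepCase j t y with
    | pool e' h0 hb hD hL hm =>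
      rw [hm] at h; simp at h; obtain ⟨rfl, rfl⟩ := h
      have hs := P.stf_loc j t y y' hy
      have e1 : P.Dd j t y = P.Dd j t y' := by unfold Dd; rw [hs]
      have e2 : P.LL j t y = P.LL j t y' := by unfold LL; rw [hs]
      have e3 : P.md j t y = P.md j t y' := by unfold md; rw [hs]
      rw [e3] at h0
      rw [e2] at hb
      cases P.stepCase j t y' with
      | pool e'' h0' hb' hD' hL' hm' =>
        rw [hb] at hb'; simp at hb'; subst hb'
        exact fin (by rw [hD, hD', e1]) (by rw [hL, hL', e2]) (by rw [hm, hm'])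
      | code h0' hb' => rw [hb] at hb'; simp at hb'
      | _ => rename_i h0' _ _ _ _ ; simp_all
    | wait e' n' h0 hb hD hL hm =>
      rw [hm] at h; simp at h; obtain ⟨rfl, rfl⟩ := h
      have hs := (ih _ _ h0 hy).symm
      have e1 : P.Dd j t y = P.Dd j t y' := by unfold Dd; rw [hs]
      have e2 : P.LL j t y = P.LL j t y' := by unfold LL; rw [hs]
      have e3 : P.md j t y = P.md j t y' := by unfold md; rw [hs]
      rw [e3] at h0
      cases P.stepCase j t y' with
      | wait e'' n'' h0' hb' hD' hL' hm' =>
        rw [h0] at h0'; simp at h0'; obtain ⟨rfl, rfl⟩ := h0'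
        exact fin (by rw [hD, hD', e1]) (by rw [hL, hL', e2]) (by rw [hm, hm'])
      | batch e'' n'' h0' hb' =>
        rw [h0] at h0'; simp at h0'; obtain ⟨rfl, rfl⟩ := h0'
        rw [hb] at hb'; simp at hb'
      | _ => simp_all
    | _ => rename_i hm; rw [hm] at h; simp at h

theorem Dd_succ (t : ℕ) (y : ℕ → Bool) : P.Dd j t y <+: P.Dd j (t + 1) y := by
  cases P.stepCase j t y <;> simp_all

theorem Dd_mono {t t' : ℕ} (h : t ≤ t') (y : ℕ → Bool) : P.Dd j t y <+: P.Dd j t' y := by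
  induction h with
  | refl => exact List.prefix_rfl
  | step _ ih => exact ih.trans (P.Dd_succ j _ y)

theorem LL_length_mono' {t t' : ℕ} (h : t ≤ t') (y : ℕ → Bool) :
    (P.LL j t y).length ≤ (P.LL j t' y).length := by
  induction h with
  | refl => exact le_rfl
  | step _ ih => exact ih.trans (P.LL_length_mono j _ y)

/-- meaning of the entries -/
def EntryOK (e : ℕ) (D : Wd) : Option (Bool × Wd) → Prop
  | none => ∃ d w t', d ++ w <+: D ∧ P.ev e true d t' = some w
  | some (false, d) => d <+: D
  | some (true, d) => ∃ w t', d ++ w <+: D ∧ P.ev e false d t' = some w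

theorem EntryOK.mono {P : Par} {e : ℕ} {D D' : Wd} (h : D <+: D') {o : Option (Bool × Wd)}
    (ho : P.EntryOK e D o) : P.EntryOK e D' o := by
  rcases o with _ | ⟨_ | _, d⟩
  · obtain ⟨d, w, t', h1, h2⟩ := ho; exact ⟨d, w, t', h1.trans h, h2⟩
  · exact List.IsPrefix.trans ho h
  · obtain ⟨w, t', h1, h2⟩ := ho; exact ⟨w, t', h1.trans h, h2⟩

theorem entries_ok (t : ℕ) (y : ℕ → Bool) : ∀ e o, (P.LL j t y)[e]? = some o →
    P.EntryOK e (P.Dd j t y) o := by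
  induction t with
  | zero => simp [LL, stf]
  | succ t ih =>
    intro e o h
    have hmono := P.Dd_succ j t y
    cases P.stepCase j t y with
    | code h0 hb hD hL hm =>
      rw [hL, List.getElem?_append] at h
      split_ifs at h with hl
      · exact (ih _ _ h).mono hmono
      · rw [List.getElem?_singleton] at h
        split_ifs at h
        simp at h; subst h
        exact List.prefix_rfl
    | ev1 e' n tb w h0 hw hD hL hm =>
      rw [hL, List.getElem?_set] at h
      split_ifs at h with h1 h2
      · simp at h; subst h; subst h1
        exact ⟨_, w, t, by rw [hD], hw⟩
      · exact (ih _ _ h).mono hmono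
    | rel e' n tb p h0 hw hr hD hL hm =>
      rw [hL, List.getElem?_set] at h
      split_ifs at h with h1 h2
      · simp at h; subst h; subst h1
        cases p
        · exact hmono
        · obtain ⟨t', a, b, c⟩ := (P.try_inv j t y _ _ _ _ h0).2.2.2.2.2 rfl
          obtain ⟨w, hw⟩ := Option.isSome_iff_exists.1 c
          have := P.ev_stable _ _ _ _ _ _ b.le hw
          refine ⟨w, t, ?_, this⟩
          rw [hD, this]; simp
      · exact (ih _ _ h).mono hmono
    | _ =>
      rename_i hD hL hm
      rw [hL] at h; rw [hD]; exact ih _ _ h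

/-- one decoding step -/
def decStep (q : Bool × List Bool) (s : Bool × Bool) : Bool × List Bool :=
  bif q.1 then (false, q.2 ++ [s.2]) else (s.1 && s.2, q.2)

/-- decoder -/
def dec (D : Wd) : Bool × List Bool := D.foldl decStep (false, [])

theorem foldl_decStep_legal (w : Wd) (hw : (true, true) ∉ w) (o : List Bool) :
    w.foldl decStep (false, o) = (false, o) := by
  induction w with
  | nil => rfl
  | cons a w ih =>
    simp only [List.mem_cons, not_or] at hw
    have : decStep (false, o) a = (false, o) := by
      rcases a with ⟨_ | _, _ | _⟩ <;> simp_all [decStep]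
    rw [List.foldl_cons, this, ih hw.2]

theorem foldl_decStep_pfx (w : Wd) (q : Bool × List Bool) :
    q.2 <+: (w.foldl decStep q).2 ∧ (w.foldl decStep q).2.length ≤ q.2.length + w.length := by
  induction w generalizing q with
  | nil => simp
  | cons a w ih =>
    have h1 : q.2 <+: (decStep q a).2 ∧ (decStep q a).2.length ≤ q.2.length + 1 := by
      unfold decStep; cases q.1 <;> simp
    have h2 := ih (decStep q a)
    rw [List.foldl_cons]
    refine ⟨h1.1.trans h2.1, ?_⟩
    simp only [List.length_cons]; omega

theorem dec_append_legal (D w : Wd) (hw : (true, true) ∉ w) {o : List Bool}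
    (h : dec D = (false, o)) : dec (D ++ w) = (false, o) := by
  unfold dec at *
  rw [List.foldl_append, h, foldl_decStep_legal w hw]

theorem dec_inv (t : ℕ) (y : ℕ → Bool) :
    dec (P.Dd j t y) = (false, pre y (P.LL j t y).length) := by
  induction t with
  | zero => rfl
  | succ t ih =>
    cases P.stepCase j t y with
    | code h0 hb hD hL hm =>
      rw [hD, hL]
      unfold dec at *
      rw [List.foldl_append, ih]
      simp [decStep, pre_succ]
    | ev1 e' n tb w h0 hw hD hL hm =>
      rw [hD, hL, List.length_set]
      exact dec_append_legal _ _ (P.ev_legal _ _ _ _ _ hw) ih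
    | rel e' n tb p h0 hw hr hD hL hm =>
      rw [hD, hL, List.length_set]
      refine dec_append_legal _ _ ?_ ih
      cases p
      · simp
      · rcases hw' : P.ev e' false (P.Dd j t y) t with _ | w
        · simp
        · simpa using P.ev_legal _ _ _ _ _ hw'
    | _ => rename_i hD hL hm; rw [hD, hL, ih]

end Par

end

section
namespace Par
variable (P : Par) (j : ℕ)

/-! ### Part IV: measure estimates -/

/-- threshold for requirement `e` -/
noncomputable def dl (e : ℕ) : ℝ := (1 / 2) ^ (e + j + 3)

theorem dl_pos (e : ℕ) : 0 < dl j e := by unfold dl; positivity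

theorem dl_le_one (e : ℕ) : dl j e ≤ 1 := by
  unfold dl; exact pow_le_one₀ (by norm_num) (by norm_num)

/-- mass of a cylinder at level `t` -/
noncomputable def lam (t : ℕ) (τ : List Bool) : ℝ := m t fun x => τ <+: P.φ x

theorem lam_nonneg (t : ℕ) (τ : List Bool) : 0 ≤ P.lam t τ := m_nonneg _ _

theorem cnt_real (t : ℕ) (τ : List Bool) : (P.cnt t τ : ℝ) = P.lam t τ * 2 ^ t := by
  unfold cnt lam
  rw [countP_eq_m]
  simp

theorem half_aux (a b : ℝ) (k : ℕ) : a ≤ b * 2 ^ k ↔ a * (1 / 2) ^ k ≤ b := by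
  rw [one_div, inv_pow, ← div_eq_mul_inv, div_le_iff₀ (by positivity)]

theorem rl_iff (t N : ℕ) (y : ℕ → Bool) (e n tb : ℕ) (p : Bool) :
    P.rl j t N y e n tb p = true ↔
      P.lam tb (pre y n) * dl j e ^ (cond p 2 1) ≤ m t fun x => leftP P.φ N n y x = true := by
  unfold rl dl
  rw [decide_eq_true_iff, ← Nat.cast_le (α := ℝ)]
  push_cast
  rw [cnt_real, countP_eq_m, ← pow_mul, mul_comm (e + j + 3), ← half_aux]
  have h1 : (0:ℝ) < 2 ^ t * 2 ^ tb := by positivity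
  refine Iff.trans ?_ (mul_le_mul_iff_left₀ h1)
  constructor <;> intro h <;> linarith

theorem poolHit_iff (e : ℕ) (x σ : List Bool) (s : St) : P.poolHit e x σ s = true ↔
    ∃ n, s.2.2 = some (e, n, none) ∧ σ.take n <+: P.φ x := by
  unfold poolHit
  split
  · rename_i e' n h
    simp only [h, Bool.and_eq_true, decide_eq_true_eq, List.isPrefixOf_iff_prefix]
    constructor
    · rintro ⟨rfl, h⟩; exact ⟨n, rfl, h⟩
    · rintro ⟨n', h1, h2⟩
      simp at h1
      obtain ⟨rfl, rfl⟩ := h1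
      exact ⟨rfl, h2⟩
  · rename_i h
    constructor
    · simp
    · rintro ⟨n, h1, h2⟩
      exact (h _ _ h1).elim

theorem bt_iff (t e : ℕ) : P.bt j t e = true ↔ dl j e ≤ m t fun x =>
    ∃ σ n, σ.length = t ∧ P.md j t (ext σ) = some (e, n, none) ∧ σ.take n <+: P.φ x := by
  unfold bt btf dl
  rw [decide_eq_true_iff, ← Nat.cast_le (α := ℝ)]
  push_cast
  rw [countP_eq_m]
  have h0 : m t (fun x => ∃ σ n, σ.length = t ∧ P.md j t (ext σ) = some (e, n, none) ∧
      σ.take n <+: P.φ x) = m t (fun x => ((strs t).any fun σ => P.poolHit e x σ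
        (P.stf j t (ext σ))) = true) := by
    refine m_congr fun x _ => ?_
    rw [List.any_eq_true]
    simp only [mem_strs, poolHit_iff, md]
    constructor
    · rintro ⟨σ, n, h1, h2, h3⟩; exact ⟨σ, h1, n, h2, h3⟩
    · rintro ⟨σ, h1, n, h2, h3⟩; exact ⟨σ, n, h1, h2, h3⟩
  rw [h0]
  generalize m t _ = μ
  have h1 : (0:ℝ) < 2 ^ t := by positivity
  have h2 : (0:ℝ) < 2 ^ (e + j + 3) := by positivity
  rw [show ((1:ℝ) / 2) ^ (e + j + 3) = 1 * (1 / 2) ^ (e + j + 3) by rw [one_mul], ← half_aux]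
  refine Iff.trans ?_ (mul_le_mul_iff_left₀ h1)
  constructor <;> intro h <;> linarith

/-- a good entry never needs attention again -/
def GoodEntry (e : ℕ) (o : Option (Bool × Wd)) : Prop :=
  ∀ p d, o = some (p, d) → ∀ t, P.ev e p d t = none

/-- requirement `e` is settled at `t` with the entry `o` -/
def Settled (e t : ℕ) (y : ℕ → Bool) (o : Option (Bool × Wd)) : Prop :=
  (P.LL j t y)[e]? = some o ∧ ∀ n q, P.md j t y ≠ some (e, n, q)

theorem Settled.succ {P : Par} {j e t : ℕ} {y : ℕ → Bool} {o : Option (Bool × Wd)}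
    (ho : P.GoodEntry e o) (h : P.Settled j e t y o) : P.Settled j e (t + 1) y o := by
  obtain ⟨h1, h2⟩ := h
  have key : ∀ e' n q, P.md j t y = some (e', n, q) → e' ≠ e := by
    rintro e' n q h rfl; exact h2 _ _ h
  have hlt : e < (P.LL j t y).length := (List.getElem?_eq_some_iff.1 h1).1
  cases P.stepCase j t y with
  | pool e' h0 hb hD hL hm =>
    refine ⟨by rw [hL, h1], fun n q hh => ?_⟩
    rw [hm] at hh; simp at hh
    obtain ⟨rfl, -⟩ := hh
    have := (P.firstBad_some hb).2.1
    unfold bad at this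
    rw [h1] at this
    rcases o with _ | ⟨p, d⟩
    · simp at this
    · simp [ho p d rfl] at this
  | code h0 hb hD hL hm =>
    refine ⟨?_, by simp [hm]⟩
    rw [hL, List.getElem?_append_left hlt, h1]
  | ev1 e' n tb w h0 hw hD hL hm =>
    refine ⟨?_, by simp [hm]⟩
    rw [hL, List.getElem?_set_ne (key _ _ _ h0), h1]
  | rel e' n tb p h0 hw hr hD hL hm =>
    refine ⟨?_, by simp [hm]⟩
    rw [hL, List.getElem?_set_ne (key _ _ _ h0), h1]
  | batch e' n' h0 hb hD hL hm =>
    refine ⟨by rw [hL, h1], fun n q hh => ?_⟩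
    rw [hm] at hh; simp at hh; exact key _ _ _ h0 hh.1
  | wait e' n' h0 hb hD hL hm =>
    refine ⟨by rw [hL, h1], fun n q hh => ?_⟩
    rw [hm] at hh; simp at hh; exact key _ _ _ h0 hh.1
  | ev0 e' n' tb' w h0 hw hD hL hm =>
    refine ⟨by rw [hL, h1], fun n q hh => ?_⟩
    rw [hm] at hh; simp at hh; exact key _ _ _ h0 hh.1
  | stay e' n' tb' p' h0 hw hr hD hL hm =>
    refine ⟨by rw [hL, h1], fun n q hh => ?_⟩
    rw [hm] at hh; simp at hh; exact key _ _ _ h0 hh.1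

theorem Settled.mono {P : Par} {j e t t' : ℕ} {y : ℕ → Bool} {o : Option (Bool × Wd)}
    (ho : P.GoodEntry e o) (h : P.Settled j e t y o) (htt : t ≤ t') : P.Settled j e t' y o := by
  induction htt with
  | refl => exact h
  | step _ ih => exact ih.succ ho

/-- a try which is known to end well -/
def Kp (e n tb t : ℕ) (y : ℕ → Bool) : Prop :=
  ∃ p, P.md j t y = some (e, n, some (tb, p)) ∧
    ((∀ t', P.ev e p (P.Dd j t y) t' = none) ∨ (p = true ∧ (P.ev e true (P.Dd j t y) t).isSome))

theorem Kp.next {P : Par} {j e n tb t : ℕ} {y : ℕ → Bool} (h : P.Kp j e n tb t y) :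
    (P.Kp j e n tb (t + 1) y) ∨ ∃ o, P.GoodEntry e o ∧ P.Settled j e (t + 1) y o := by
  obtain ⟨p, hm, hp⟩ := h
  have hlt := (P.mode_inv j t y _ _ _ hm).2
  cases P.stepCase j t y with
  | ev0 e' n' tb' w h0 hw hD hL hm' =>
    rw [hm] at h0; simp at h0; obtain ⟨rfl, rfl, rfl, rfl⟩ := h0
    rcases hp with hp | hp
    · rw [hp] at hw; simp at hw
    · simp at hp
  | ev1 e' n' tb' w h0 hw hD hL hm' =>
    rw [hm] at h0; simp at h0; obtain ⟨rfl, rfl, rfl, rfl⟩ := h0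
    exact .inr ⟨none, by intro p d hh; simp at hh, by rw [hL]; simp [hlt], by simp [hm']⟩
  | rel e' n' tb' p' h0 hw hr hD hL hm' =>
    rw [hm] at h0; simp at h0; obtain ⟨rfl, rfl, rfl, rfl⟩ := h0
    rcases hp with hp | hp
    · refine .inr ⟨some (p, P.Dd j t y), ?_, by rw [hL]; simp [hlt], by simp [hm']⟩
      intro p' d hh; simp at hh; obtain ⟨rfl, rfl⟩ := hh; exact hp
    · rw [hp.1] at hw; rw [hw] at hp; simp at hp
  | stay e' n' tb' p' h0 hw hr hD hL hm' =>
    rw [hm] at h0; simp at h0; obtain ⟨rfl, rfl, rfl, rfl⟩ := h0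
    rcases hp with hp | hp
    · exact .inl ⟨p, hm', .inl (by rw [hD]; exact hp)⟩
    · rw [hp.1] at hw; rw [hw] at hp; simp at hp
  | _ => simp_all

theorem Kp.later {P : Par} {j e n tb t : ℕ} {y : ℕ → Bool} (h : P.Kp j e n tb t y) {t' : ℕ}
    (htt : t ≤ t') :
    (P.Kp j e n tb t' y) ∨ ∃ o, P.GoodEntry e o ∧ P.Settled j e t' y o := by
  induction htt with
  | refl => exact .inl h
  | step _ ih =>
    rcases ih with h | ⟨o, h1, h2⟩
    · exact h.next
    · exact .inr ⟨o, h1, h2.succ h1⟩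

theorem Kp.unique {P : Par} {j e n tb t n' tb' t' : ℕ} {y : ℕ → Bool} (h : P.Kp j e n tb t y)
    (h' : P.Kp j e n' tb' t' y) : n = n' ∧ tb = tb' := by
  wlog htt : t ≤ t' generalizing n tb t n' tb' t'
  · obtain ⟨a, b⟩ := this h' h (by omega)
    exact ⟨a.symm, b.symm⟩
  obtain ⟨p', hm', -⟩ := h'
  rcases h.later htt with ⟨p, hm, -⟩ | ⟨o, -, -, h2⟩
  · rw [hm] at hm'; simp at hm'; exact ⟨hm'.1, hm'.2.1⟩
  · exact (h2 _ _ hm').elim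

/-- a key: a cylinder in a batch -/
def IsKey (e : ℕ) (κ : List Bool × ℕ) : Prop :=
  P.bt j κ.2 e = true ∧ P.md j κ.2 (ext κ.1) = some (e, κ.1.length, none)

/-- the strings mapped into the region of a key which ends well -/
def SK (e : ℕ) (κ : List Bool × ℕ) (x : List Bool) : Prop :=
  κ.1 <+: P.φ x ∧ ∃ t, P.Kp j e κ.1.length κ.2 t (ext (P.φ x))

theorem SK_disj (e : ℕ) (κ κ' : List Bool × ℕ) (x : List Bool) (h : P.SK j e κ x)
    (h' : P.SK j e κ' x) : κ = κ' := by
  obtain ⟨h1, t, h2⟩ := h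
  obtain ⟨h1', t', h2'⟩ := h'
  obtain ⟨a, b⟩ := h2.unique h2'
  refine Prod.ext ?_ b
  rw [List.prefix_iff_eq_take] at h1 h1'
  rw [h1, h1', a]

theorem SK_sum (e T : ℕ) (s : Finset (List Bool × ℕ)) : ∑ κ ∈ s, m T (P.SK j e κ) ≤ 1 :=
  m_disjoint_sum T s _ fun κ _ κ' _ x h h' => P.SK_disj j e κ κ' x h h'

/-- progress of a try -/
theorem try_prog {e n tb : ℕ} {y : ℕ → Bool} (hb : P.bt j tb e = true)
    (hm : P.md j tb y = some (e, n, none)) (t : ℕ) (ht : tb < t) :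
    (P.md j t y = some (e, n, some (tb, decide (tb + 1 < t ∧
        (P.ev e false (P.Dd j tb y) (t - 1)).isSome = true))) ∧ P.Dd j t y = P.Dd j tb y) ∨
    (∃ s, tb < s ∧ s < t ∧ P.md j s y = some (e, n, some (tb, true)) ∧
      P.Dd j s y = P.Dd j tb y ∧ (P.ev e true (P.Dd j tb y) s).isSome) ∨
    (∃ s p, tb < s ∧ s < t ∧ P.rl j s s y e n tb p = true ∧ P.ev e p (P.Dd j tb y) s = none ∧
      (p = true → tb + 1 < s ∧ (P.ev e false (P.Dd j tb y) (s - 1)).isSome)) := by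
  induction ht with
  | refl =>
    left
    cases P.stepCase j tb y with
    | batch e' n' h0 hb' hD hL hm' =>
      rw [hm] at h0; simp at h0; obtain ⟨rfl, rfl⟩ := h0
      simp [hm', hD]
    | _ => simp_all
  | @step t ht ih =>
    rcases ih with ⟨ih, hD0⟩ | ⟨s, a, b, c⟩ | ⟨s, p, a, b, c⟩
    · change tb < t at ht
      have hev : ∀ (u v : ℕ), u ≤ v → (P.ev e false (P.Dd j tb y) u).isSome →
          (P.ev e false (P.Dd j tb y) v).isSome := by
        intro u v huv hu
        obtain ⟨w, hw⟩ := Option.isSome_iff_exists.1 hu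
        rw [P.ev_stable _ _ _ _ _ _ huv hw]; rfl
      cases P.stepCase j t y with
      | ev0 e' n' tb' w h0 hw hD hL hm' =>
        rw [ih] at h0
        simp only [Option.some.injEq, Prod.mk.injEq] at h0
        obtain ⟨rfl, rfl, rfl, h0⟩ := h0
        left
        rw [hm', hD, hD0]
        rw [hD0] at hw
        simp [hw]; omega
      | ev1 e' n' tb' w h0 hw hD hL hm' =>
        rw [ih] at h0
        simp only [Option.some.injEq, Prod.mk.injEq] at h0
        obtain ⟨rfl, rfl, rfl, h0⟩ := h0
        rw [h0] at ih
        right; left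
        exact ⟨t, ht, by omega, ih, hD0, by rw [← hD0, hw]; rfl⟩
      | rel e' n' tb' p' h0 hw hr hD hL hm' =>
        rw [ih] at h0
        simp only [Option.some.injEq, Prod.mk.injEq] at h0
        obtain ⟨rfl, rfl, rfl, h0⟩ := h0
        right; right
        refine ⟨t, p', ht, by omega, hr, by rw [← hD0]; exact hw, fun hp => ?_⟩
        rw [hp] at h0
        exact of_decide_eq_true h0
      | stay e' n' tb' p' h0 hw hr hD hL hm' =>
        rw [ih] at h0
        simp only [Option.some.injEq, Prod.mk.injEq] at h0
        obtain ⟨rfl, rfl, rfl, h0⟩ := h0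
        left
        rw [hm', hD, hD0]
        refine ⟨?_, rfl⟩
        simp only [Option.some.injEq, Prod.mk.injEq, true_and]
        cases p'
        · rw [hD0] at hw
          simp [hw]
        · have := of_decide_eq_true h0
          symm
          rw [decide_eq_true_iff]
          exact ⟨by omega, hev _ _ (by omega) this.2⟩
      | _ => simp_all
    · exact .inr (.inl ⟨s, a, by omega, c⟩)
    · exact .inr (.inr ⟨s, p, a, by omega, c⟩)

end Par

end

section
namespace Par
variable (P : Par) (j : ℕ)

theorem key_region {e : ℕ} {κ : List Bool × ℕ} (θ : ℝ) (t : ℕ)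
    (hk : P.IsKey j e κ) (ht : κ.2 < t) (hθ : θ ≤ P.lam κ.2 κ.1)
    (h : ∀ y, Ext κ.1 y → (∃ s, P.Kp j e κ.1.length κ.2 s y) ∨
      ∃ s ≤ t, θ ≤ m s fun x => leftP P.φ s κ.1.length y x = true) (T : ℕ) (hT : t ≤ T) :
    θ ≤ m T (P.SK j e κ) := by
  have hl := (P.mode_inv j _ _ _ _ _ hk.2).1
  refine (region P.φ_mono (fun y => ∃ s, P.Kp j e κ.1.length κ.2 s y) t κ.2 κ.1 θ (by omega)
    ht.le hθ (fun y hy hn => (h y hy).resolve_left hn) T hT).trans (m_mono ?_)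
  rintro x - ⟨v, h1, h2, h3⟩
  exact ⟨h2.trans h1, h3 _ (Ext_of_pfx h1 (ext_Ext _))⟩

theorem key_uniform {e : ℕ} {κ : List Bool × ℕ} (hk : P.IsKey j e κ) {y : ℕ → Bool}
    (hy : Ext κ.1 y) : P.md j κ.2 y = some (e, κ.1.length, none) ∧
      P.Dd j κ.2 y = P.Dd j κ.2 (ext κ.1) := by
  have := P.pool_uniform j κ.2 (ext κ.1) y _ _ hk.2
    (pre_eq_iff.1 ((ext_Ext κ.1).trans hy.symm))
  unfold Dd md
  rw [this]
  exact ⟨hk.2, rfl⟩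

theorem ev_up {e : ℕ} {p : Bool} {d : Wd} {t t' : ℕ} (h : t ≤ t') (hs : (P.ev e p d t).isSome) :
    (P.ev e p d t').isSome := by
  obtain ⟨w, hw⟩ := Option.isSome_iff_exists.1 hs
  rw [P.ev_stable _ _ _ _ _ _ h hw]; rfl

theorem key_mass0 {e : ℕ} {κ : List Bool × ℕ} (hk : P.IsKey j e κ)
    (h0 : ∀ t, P.ev e false (P.Dd j κ.2 (ext κ.1)) t = none) (T : ℕ) (hT : κ.2 + 1 ≤ T) :
    P.lam κ.2 κ.1 ≤ m T (P.SK j e κ) := by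
  refine P.key_region j _ (κ.2 + 1) hk (by omega) le_rfl (fun y hy => .inl ?_) T hT
  obtain ⟨hm, hD⟩ := P.key_uniform j hk hy
  rcases P.try_prog j hk.1 hm (κ.2 + 1) (by omega) with ⟨h, hd⟩ | ⟨s, a, b, c⟩ | ⟨s, p, a, b, c⟩
  · refine ⟨_, _, h, .inl fun t => ?_⟩
    rw [hd, hD]
    simpa using h0 t
  · omega
  · omega

theorem rl_mass {e n tb s : ℕ} {y : ℕ → Bool} {p : Bool} (h : P.rl j s s y e n tb p = true) :
    P.lam tb (pre y n) * dl j e ^ 2 ≤ m s fun x => leftP P.φ s n y x = true := by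
  rw [rl_iff] at h
  refine le_trans (mul_le_mul_of_nonneg_left ?_ (P.lam_nonneg _ _)) h
  exact pow_le_pow_of_le_one (dl_pos j e).le (dl_le_one j e) (by cases p <;> simp)

theorem key_mass1 {e : ℕ} {κ : List Bool × ℕ} (hk : P.IsKey j e κ)
    (h0 : ∃ t, (P.ev e false (P.Dd j κ.2 (ext κ.1)) t).isSome)
    (h1 : ∀ t, P.ev e true (P.Dd j κ.2 (ext κ.1)) t = none) :
    ∃ T0, ∀ T, T0 ≤ T → P.lam κ.2 κ.1 * dl j e ≤ m T (P.SK j e κ) := by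
  classical
  obtain ⟨t0, hfind, hmin⟩ : ∃ t0, (P.ev e false (P.Dd j κ.2 (ext κ.1)) t0).isSome ∧
      ∀ t < t0, ¬ (P.ev e false (P.Dd j κ.2 (ext κ.1)) t).isSome :=
    ⟨Nat.find h0, Nat.find_spec h0, fun _ h => Nat.find_min h0 h⟩
  refine ⟨max t0 (κ.2 + 1) + 1, P.key_region j _ _ hk (by omega) ?_ fun y hy => ?_⟩
  · exact mul_le_of_le_one_right (P.lam_nonneg _ _) (dl_le_one j e)
  obtain ⟨hm, hD⟩ := P.key_uniform j hk hy
  rcases P.try_prog j hk.1 hm (max t0 (κ.2 + 1) + 1) (by omega) with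
    ⟨h, hd⟩ | ⟨s, a, b, c1, c2, c3⟩ | ⟨s, p, a, b, c, c', d⟩
  · left
    rw [decide_eq_true (by
      rw [hD]
      exact ⟨by omega, P.ev_up (by omega) hfind⟩)] at h
    refine ⟨_, true, h, .inl fun t => ?_⟩
    rw [hd, hD]
    exact h1 t
  · rw [hD, h1] at c3; simp at c3
  · right
    refine ⟨s, by omega, ?_⟩
    rw [rl_iff, hy] at c
    cases p
    · simpa using c
    · obtain ⟨d1, d2⟩ := d rfl
      rw [hD] at d2
      have hs : t0 ≤ s - 1 := by
        by_contra hlt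
        exact hmin _ (by omega) d2
      omega

theorem key_mass2 {e : ℕ} {κ : List Bool × ℕ} (hk : P.IsKey j e κ)
    (h0 : ∃ t, (P.ev e false (P.Dd j κ.2 (ext κ.1)) t).isSome)
    (h1 : ∃ t, (P.ev e true (P.Dd j κ.2 (ext κ.1)) t).isSome) :
    ∃ T0, ∀ T, T0 ≤ T → P.lam κ.2 κ.1 * dl j e ^ 2 ≤ m T (P.SK j e κ) := by
  obtain ⟨t0, h0⟩ := h0
  obtain ⟨t1, h1⟩ := h1
  refine ⟨max (max t0 t1) (κ.2 + 1) + 1, P.key_region j _ _ hk (by omega) ?_ fun y hy => ?_⟩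
  · exact mul_le_of_le_one_right (P.lam_nonneg _ _)
      (pow_le_one₀ (dl_pos j e).le (dl_le_one j e))
  obtain ⟨hm, hD⟩ := P.key_uniform j hk hy
  rcases P.try_prog j hk.1 hm (max (max t0 t1) (κ.2 + 1) + 1) (by omega) with
    ⟨h, hd⟩ | ⟨s, a, b, c1, c2, c3⟩ | ⟨s, p, a, b, c, c', d⟩
  · left
    rw [decide_eq_true (by
      rw [hD]
      exact ⟨by omega, P.ev_up (by omega) h0⟩)] at h
    refine ⟨_, true, h, .inr ⟨rfl, ?_⟩⟩
    rw [hd, hD]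
    exact P.ev_up (by omega) h1
  · left
    exact ⟨s, true, c1, .inr ⟨rfl, by rw [c2]; exact c3⟩⟩
  · right
    refine ⟨s, by omega, ?_⟩
    have := P.rl_mass j c
    rwa [hy] at this

theorem key_mass {e : ℕ} {κ : List Bool × ℕ} (hk : P.IsKey j e κ) :
    ∃ T0, ∀ T, T0 ≤ T → P.lam κ.2 κ.1 * dl j e ^ 2 ≤ m T (P.SK j e κ) := by
  by_cases h0 : ∃ t, (P.ev e false (P.Dd j κ.2 (ext κ.1)) t).isSome
  · by_cases h1 : ∃ t, (P.ev e true (P.Dd j κ.2 (ext κ.1)) t).isSome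
    · exact P.key_mass2 j hk h0 h1
    · obtain ⟨T0, h⟩ := P.key_mass1 j hk h0 (by simpa using h1)
      refine ⟨T0, fun T hT => le_trans ?_ (h T hT)⟩
      refine mul_le_mul_of_nonneg_left ?_ (P.lam_nonneg _ _)
      nlinarith [dl_pos j e, dl_le_one j e]
  · refine ⟨κ.2 + 1, fun T hT => le_trans ?_ (P.key_mass0 j hk (by simpa using h0) T hT)⟩
    exact mul_le_of_le_one_right (P.lam_nonneg _ _)
      (pow_le_one₀ (dl_pos j e).le (dl_le_one j e))

/-- all strings of length at most `n` -/
def strsLe (n : ℕ) : Finset (List Bool) := (Finset.range (n + 1)).biUnion fun k => (strs k).toFinset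

theorem mem_strsLe {n : ℕ} {σ : List Bool} : σ ∈ strsLe n ↔ σ.length ≤ n := by
  simp [strsLe, mem_strs]

open Classical in
/-- the keys below `n` -/
noncomputable def keys (e n : ℕ) : Finset (List Bool × ℕ) :=
  (strsLe n ×ˢ Finset.range (n + 1)).filter (P.IsKey j e)

theorem mem_keys {e n : ℕ} {κ : List Bool × ℕ} : κ ∈ P.keys j e n ↔ κ.2 ≤ n ∧ P.IsKey j e κ := by
  simp only [keys, Finset.mem_filter, Finset.mem_product, mem_strsLe, Finset.mem_range]
  constructor
  · rintro ⟨⟨h1, h2⟩, h3⟩; exact ⟨by omega, h3⟩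
  · rintro ⟨h1, h3⟩
    have := (P.mode_inv j _ _ _ _ _ h3.2).1
    exact ⟨⟨by omega, by omega⟩, h3⟩

theorem exists_common {ι : Type*} (s : Finset ι) (Q : ι → ℕ → Prop)
    (h : ∀ i ∈ s, ∃ T0, ∀ T, T0 ≤ T → Q i T) : ∃ T, ∀ i ∈ s, Q i T := by
  classical
  choose! f hf using h
  exact ⟨s.sup f, fun i hi => hf i hi _ (Finset.le_sup hi)⟩

open Classical in
theorem batch_mass {e tb : ℕ} (hb : P.bt j tb e = true) :
    dl j e ≤ ∑ κ ∈ (P.keys j e tb).filter (fun κ => κ.2 = tb), P.lam κ.2 κ.1 := by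
  have hb' := (P.bt_iff j tb e).1 hb
  have hun := m_union tb ((P.keys j e tb).filter (fun κ => κ.2 = tb)) (fun κ x => κ.1 <+: P.φ x)
  have hsum : ∑ κ ∈ (P.keys j e tb).filter (fun κ => κ.2 = tb), m tb (fun x => κ.1 <+: P.φ x) =
      ∑ κ ∈ (P.keys j e tb).filter (fun κ => κ.2 = tb), P.lam κ.2 κ.1 := by
    refine Finset.sum_congr rfl fun κ hκ => ?_
    rw [(Finset.mem_filter.1 hκ).2]
    rfl
  rw [← hsum]
  refine hb'.trans (le_trans (m_mono ?_) hun)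
  · rintro x - ⟨σ, n, h1, h2, h3⟩
    have hn := (P.mode_inv j _ _ _ _ _ h2).1
    have hlen : (σ.take n).length = n := by simp; omega
    refine ⟨(σ.take n, tb), ?_, h3⟩
    rw [Finset.mem_filter, mem_keys]
    refine ⟨⟨le_rfl, hb, ?_⟩, rfl⟩
    dsimp only
    rw [hlen]
    have := P.pool_uniform j tb (ext σ) (ext (σ.take n)) _ _ h2 (fun i hi => by
      simp [ext, List.getD, List.getElem?_take, hi])
    unfold md at *
    rw [this, h2]

theorem batch_finite (e : ℕ) : {tb | P.bt j tb e = true}.Finite := by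
  classical
  by_contra hinf
  have hpos := dl_pos j e
  obtain ⟨N, hN⟩ := exists_nat_gt (1 / dl j e ^ 3)
  obtain ⟨s, hs, hcard⟩ := Set.Infinite.exists_subset_card_eq (s := {tb | P.bt j tb e = true}) hinf N
  obtain ⟨M, hM⟩ : ∃ M, ∀ tb ∈ s, tb ≤ M := ⟨s.sup id, fun tb h => Finset.le_sup (f := id) h⟩
  set K := (P.keys j e M).filter (fun κ => κ.2 ∈ s) with hK
  obtain ⟨T, hT⟩ := exists_common K (fun κ T => P.lam κ.2 κ.1 * dl j e ^ 2 ≤ m T (P.SK j e κ))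
    fun κ hκ => P.key_mass j ((P.mem_keys j).1 (Finset.mem_filter.1 hκ).1).2
  have h1 := (Finset.sum_le_sum hT).trans (P.SK_sum j e T K)
  have h2 : ∑ tb ∈ s, ∑ κ ∈ K.filter (fun κ => κ.2 = tb), P.lam κ.2 κ.1 * dl j e ^ 2 =
      ∑ κ ∈ K, P.lam κ.2 κ.1 * dl j e ^ 2 :=
    Finset.sum_fiberwise_of_maps_to (fun κ hκ => (Finset.mem_filter.1 hκ).2) _
  rw [← h2] at h1
  have h3 : ∀ tb ∈ s, dl j e ^ 3 ≤ ∑ κ ∈ K.filter (fun κ => κ.2 = tb), P.lam κ.2 κ.1 * dl j e ^ 2 := by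
    intro tb htb
    rw [← Finset.sum_mul]
    have hb := P.batch_mass j (hs htb)
    have : (P.keys j e tb).filter (fun κ => κ.2 = tb) = K.filter (fun κ => κ.2 = tb) := by
      ext κ
      simp only [hK, Finset.mem_filter, mem_keys]
      constructor
      · rintro ⟨⟨a, b⟩, rfl⟩; exact ⟨⟨⟨hM _ htb, b⟩, htb⟩, rfl⟩
      · rintro ⟨⟨⟨a, b⟩, c⟩, rfl⟩; exact ⟨⟨le_rfl, b⟩, rfl⟩
    rw [this] at hb
    calc dl j e ^ 3 = dl j e * dl j e ^ 2 := by ring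
      _ ≤ _ := mul_le_mul_of_nonneg_right hb (by positivity)
  have h4 := (Finset.sum_le_sum h3).trans h1
  rw [Finset.sum_const, hcard, nsmul_eq_mul] at h4
  rw [div_lt_iff₀ (by positivity)] at hN
  linarith

end Par

end

section
namespace Par
variable (P : Par) (j : ℕ)

/-- approximation at `t` to the statement that `σ` is lost, given the state `s` at `σ` and the
batch condition `b` at `t` -/
def lostS (σ : List Bool) (t : ℕ) (s : St) (b : ℕ → Bool) : Bool :=
  match s.2.2 with
  | none => false
  | some (e, _, none) => decide (t < σ.length) || !b e
  | some (e, n, some (tb, p)) => decide (t < σ.length) ||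
      ((P.ev e p s.1 t).isNone && !P.rl j t σ.length (ext σ) e n tb p &&
      decide (P.cnt t σ * 2 ^ tb * 2 ^ (cond p 2 1 * (e + j + 3)) ≤
        P.cnt tb (pre (ext σ) n) * 2 ^ t))

/-- `σ` is lost -/
def Lost (σ : List Bool) : Prop :=
  ∀ t, P.lostS j σ t (P.stf j σ.length (ext σ)) (P.bt j t) = true

/-- the strings lost while waiting in the pool -/
def Lost1 (e : ℕ) (x : List Bool) : Prop :=
  ∃ σ n, σ <+: P.φ x ∧ P.md j σ.length (ext σ) = some (e, n, none) ∧
    ∀ t, σ.length ≤ t → P.bt j t e = false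

/-- strings lost in a try -/
def LostT (e : ℕ) (κ : List Bool × ℕ) (p : Bool) (σ : List Bool) : Prop :=
  P.md j σ.length (ext σ) = some (e, κ.1.length, some (κ.2, p)) ∧
    ∀ t, σ.length ≤ t → P.ev e p (P.Dd j σ.length (ext σ)) t = none ∧
      P.rl j t σ.length (ext σ) e κ.1.length κ.2 p = false ∧
      P.lam t σ ≤ P.lam κ.2 κ.1 * dl j e ^ (cond p 2 1)

/-- the strings mapped above a string lost in a try -/
def Lost2 (e : ℕ) (κ : List Bool × ℕ) (x : List Bool) : Prop :=
  ∃ σ p, σ <+: P.φ x ∧ κ.1 <+: σ ∧ P.LostT j e κ p σ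

theorem Lost.split {P : Par} {j : ℕ} {σ x : List Bool} (hσ : σ <+: P.φ x) (h : P.Lost j σ) :
    ∃ e < σ.length, P.Lost1 j e x ∨ ∃ κ : List Bool × ℕ, κ.2 < σ.length ∧ P.Lost2 j e κ x := by
  unfold Lost lostS at h
  rcases hm : P.md j σ.length (ext σ) with _ | ⟨e, n, _ | ⟨tb, p⟩⟩
  · have := h 0
    rw [show (P.stf j σ.length (ext σ)).2.2 = none from hm] at this
    simp at this
  · have hi := P.mode_inv j _ _ _ _ _ hm
    refine ⟨e, hi.2.trans_le (P.LL_length_le _ _ _), .inl ⟨σ, n, hσ, hm, fun t ht => ?_⟩⟩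
    have := h t
    rw [show (P.stf j σ.length (ext σ)).2.2 = some (e, n, none) from hm] at this
    simpa [Nat.not_lt.2 ht] using this
  · have hi := P.mode_inv j _ _ _ _ _ hm
    have ht := P.try_inv j _ _ _ _ _ _ hm
    have hlen : (pre (ext σ) n).length = n := by simp
    refine ⟨e, hi.2.trans_le (P.LL_length_le _ _ _), .inr ⟨(pre (ext σ) n, tb), ht.1, σ, p, hσ,
      ?_, ?_, fun t ht => ?_⟩⟩
    · have := pre_pfx (ext σ) hi.1.le
      rwa [ext_Ext σ] at this
    · dsimp only
      rw [hlen]; exact hm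
    · have := h t
      rw [show (P.stf j σ.length (ext σ)).2.2 = some (e, n, some (tb, p)) from hm] at this
      simp only [Nat.not_lt.2 ht, decide_false, Bool.false_or, Bool.and_eq_true,
        Option.isNone_iff_eq_none, Bool.not_eq_true', decide_eq_true_eq] at this
      obtain ⟨⟨h1, h2⟩, h3⟩ := this
      dsimp only
      refine ⟨h1, by rw [hlen]; exact h2, ?_⟩
      rw [← Nat.cast_le (α := ℝ)] at h3
      push_cast at h3
      rw [cnt_real, cnt_real] at h3
      unfold dl
      rw [← pow_mul, mul_comm (e + j + 3)]
      generalize (cond p 2 1 * (e + j + 3)) = k at *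
      have hh : ((1:ℝ) / 2) ^ k * 2 ^ k = 1 := by rw [← mul_pow]; norm_num
      have e1 : (0:ℝ) < 2 ^ t * 2 ^ tb := by positivity
      have e2 : (0:ℝ) < 2 ^ k := by positivity
      have h4 : P.lam t σ * 2 ^ k ≤ P.lam tb (pre (ext σ) n) := by
        rw [← mul_le_mul_iff_left₀ e1]
        nlinarith
      rw [← mul_le_mul_iff_left₀ e2, mul_assoc, hh, mul_one]
      exact h4

theorem pool_pad {e n t t' : ℕ} {y : ℕ → Bool} (h : P.md j t y = some (e, n, none)) (htt : t ≤ t')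
    (hb : ∀ s, t ≤ s → s < t' → P.bt j s e = false) : P.md j t' y = some (e, n, none) := by
  induction htt with
  | refl => exact h
  | @step t' htt ih =>
    have ih := ih fun s h1 h2 => hb s h1 (Nat.lt_succ_of_lt h2)
    have hb' := hb t' htt (Nat.lt_succ_self t')
    cases P.stepCase j t' y with
    | wait e' n' h0 hb hD hL hm =>
      rw [ih] at h0; simp at h0; obtain ⟨rfl, rfl⟩ := h0
      exact hm
    | batch e' n' h0 hb hD hL hm =>
      rw [ih] at h0; simp at h0; obtain ⟨rfl, rfl⟩ := h0
      rw [hb] at hb'; simp at hb'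
    | _ => simp_all

theorem lost1_bound (e T : ℕ) : m T (P.Lost1 j e) ≤ dl j e := by
  cases hb : P.bt j T e
  · have hb' : ¬ (P.bt j T e = true) := by simp [hb]
    rw [bt_iff, not_le] at hb'
    refine le_trans (m_mono ?_) hb'.le
    rintro x hx ⟨σ, n, h1, h2, h3⟩
    have hlT : σ.length ≤ T := h1.length_le.trans (hx ▸ P.φ_len x)
    have hn := (P.mode_inv j _ _ _ _ _ h2).1
    have hpad := P.pool_pad j h2 hlT fun s a _ => h3 s a
    refine ⟨pre (ext σ) T, n, by simp, ?_, ?_⟩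
    · have := P.stf_pre j T T (ext σ) le_rfl
      unfold md at *
      rw [this, hpad]
    · rw [pre_take _ _ _ (by omega)]
      have := pre_pfx (ext σ) hn.le
      rw [ext_Ext σ] at this
      exact this.trans h1
  · refine le_trans (m_mono (Q := fun _ => False) ?_) (le_trans (le_of_eq ?_) (dl_pos j e).le)
    · rintro x hx ⟨σ, n, h1, h2, h3⟩
      have hlT : σ.length ≤ T := h1.length_le.trans (hx ▸ P.φ_len x)
      rw [h3 T hlT] at hb; simp at hb
    · simp [m]

theorem m_false (t : ℕ) : m t (fun _ => False) = 0 := by simp [m]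

theorem lost2_bound (e T : ℕ) (κ : List Bool × ℕ) (p : Bool) :
    m T (fun x => ∃ σ, σ <+: P.φ x ∧ κ.1 <+: σ ∧ P.LostT j e κ p σ) ≤
      2 * (P.lam κ.2 κ.1 * dl j e ^ (cond p 2 1)) := by
  have hnn : 0 ≤ P.lam κ.2 κ.1 * dl j e ^ (cond p 2 1) :=
    mul_nonneg (P.lam_nonneg _ _) (pow_nonneg (dl_pos j e).le _)
  by_cases hex : ∃ σ, P.LostT j e κ p σ ∧ κ.1 <+: σ ∧ σ.length ≤ T
  · have hl : κ.1.length ≤ T := by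
      obtain ⟨σ, -, h1, h2⟩ := hex
      exact h1.length_le.trans h2
    obtain ⟨σ', h1, h2, h3, h4⟩ := exists_rightmost P.φ (P.LostT j e κ p) T (T - κ.1.length) κ.1
      (by omega) hex
    have hr := (h1.2 T h3).2.1
    have hr' : ¬ P.rl j T σ'.length (ext σ') e κ.1.length κ.2 p = true := by simp [hr]
    rw [rl_iff, not_le, Ext_of_pfx h2 (ext_Ext σ')] at hr'
    have hc := (h1.2 T h3).2.2
    have : m T (fun x => ∃ σ, σ <+: P.φ x ∧ κ.1 <+: σ ∧ P.LostT j e κ p σ) ≤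
        m T (fun x => σ' <+: P.φ x ∨ leftP P.φ σ'.length κ.1.length (ext σ') x = true) := by
      refine m_mono ?_
      rintro x hx ⟨σ, a, b, c⟩
      exact h4 σ x c b (a.length_le.trans (hx ▸ P.φ_len x)) a
    have h5 := m_or T (fun x => σ' <+: P.φ x)
      (fun x => leftP P.φ σ'.length κ.1.length (ext σ') x = true)
    unfold lam at hc hr' ⊢
    linarith
  · refine le_trans (m_mono (Q := fun _ => False) ?_) ?_
    · rintro x hx ⟨σ, a, b, c⟩
      exact hex ⟨σ, c, b, a.length_le.trans (hx ▸ P.φ_len x)⟩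
    · rw [m_false]; positivity

theorem LostT.key {P : Par} {j e : ℕ} {κ : List Bool × ℕ} {p : Bool} {σ : List Bool}
    (hκ : κ.1 <+: σ) (h : P.LostT j e κ p σ) : P.IsKey j e κ ∧
      (∀ t, P.ev e p (P.Dd j κ.2 (ext κ.1)) t = none) ∧
      (p = true → ∃ t, (P.ev e false (P.Dd j κ.2 (ext κ.1)) t).isSome) := by
  obtain ⟨hm, h⟩ := h
  obtain ⟨h1, h2, h3, h4, h5, h6⟩ := P.try_inv j _ _ _ _ _ _ hm
  have hu := P.pool_uniform j κ.2 (ext σ) (ext κ.1) _ _ h4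
    (pre_eq_iff.1 ((Ext_of_pfx hκ (ext_Ext σ)).trans (ext_Ext κ.1).symm))
  have hD : P.Dd j κ.2 (ext κ.1) = P.Dd j σ.length (ext σ) := by
    rw [← h5]; unfold Dd; rw [hu]
  refine ⟨⟨h3, ?_⟩, fun t => ?_, fun hp => ?_⟩
  · unfold md at *; rw [hu, h4]
  · rw [hD]
    by_contra hne
    have := P.ev_up (t' := max t σ.length) (by omega) (Option.isSome_iff_ne_none.2 hne)
    rw [(h (max t σ.length) (by omega)).1] at this
    simp at this
  · obtain ⟨t', -, -, h7⟩ := h6 hp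
    exact ⟨t', by rw [hD]; exact h7⟩

theorem lost2_key (e T : ℕ) (κ : List Bool × ℕ) :
    ∃ T0, ∀ T', T0 ≤ T' → m T (P.Lost2 j e κ) ≤ 2 * dl j e * m T' (P.SK j e κ) := by
  have hd := dl_pos j e
  by_cases hex : ∃ σ p, κ.1 <+: σ ∧ P.LostT j e κ p σ
  · obtain ⟨σ, p, hκ, hl⟩ := hex
    obtain ⟨hk, h1, h2⟩ := hl.key hκ
    have huniq : ∀ σ' p', κ.1 <+: σ' → P.LostT j e κ p' σ' → p' = p := by
      intro σ' p' hκ' hl'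
      obtain ⟨-, h1', h2'⟩ := hl'.key hκ'
      cases p <;> cases p' <;> try rfl
      · obtain ⟨t, ht⟩ := h2' rfl
        rw [h1] at ht; simp at ht
      · obtain ⟨t, ht⟩ := h2 rfl
        rw [h1'] at ht; simp at ht
    have hb := P.lost2_bound j e T κ p
    have hle : m T (P.Lost2 j e κ) ≤ 2 * (P.lam κ.2 κ.1 * dl j e ^ (cond p 2 1)) := by
      refine le_trans (m_mono ?_) hb
      rintro x - ⟨σ', p', a, b, c⟩
      have := huniq _ _ b c
      subst this
      exact ⟨σ', a, b, c⟩
    cases p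
    · refine ⟨κ.2 + 1, fun T' hT' => hle.trans ?_⟩
      have := P.key_mass0 j hk h1 T' hT'
      simp only [cond_false, pow_one]
      nlinarith
    · obtain ⟨T0, h⟩ := P.key_mass1 j hk (h2 rfl) h1
      refine ⟨T0, fun T' hT' => hle.trans ?_⟩
      have := h T' hT'
      simp only [cond_true]
      nlinarith
  · refine ⟨0, fun T' _ => le_trans (m_mono (Q := fun _ => False) ?_) ?_⟩
    · rintro x - ⟨σ, p, a, b, c⟩
      exact hex ⟨σ, p, b, c⟩
    · rw [m_false]
      have := m_nonneg T' (P.SK j e κ)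
      positivity

theorem lost2_total (e T : ℕ) :
    m T (fun x => ∃ κ : List Bool × ℕ, κ.2 < T ∧ P.Lost2 j e κ x) ≤ 2 * dl j e := by
  obtain ⟨T', hT'⟩ := exists_common (P.keys j e T) (fun κ T' => m T (P.Lost2 j e κ) ≤
    2 * dl j e * m T' (P.SK j e κ)) fun κ _ => P.lost2_key j e T κ
  have h1 := m_union T (P.keys j e T) (fun κ x => P.Lost2 j e κ x)
  have h2 := Finset.sum_le_sum hT'
  rw [← Finset.mul_sum] at h2
  have h3 := P.SK_sum j e T' (P.keys j e T)
  have hd := dl_pos j e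
  refine le_trans (m_mono ?_) (h1.trans (h2.trans ?_))
  · rintro x - ⟨κ, h, h'⟩
    obtain ⟨σ, p, a, b, c⟩ := h'
    exact ⟨κ, (P.mem_keys j).2 ⟨h.le, (c.key b).1⟩, σ, p, a, b, c⟩
  · nlinarith

theorem lost_bound (T : ℕ) : m T (fun x => ∃ σ, σ <+: P.φ x ∧ P.Lost j σ) ≤ 3 / 4 * (1 / 2) ^ j := by
  have h1 : m T (fun x => ∃ σ, σ <+: P.φ x ∧ P.Lost j σ) ≤
      m T (fun x => ∃ e ∈ Finset.range T, (P.Lost1 j e x ∨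
        ∃ κ : List Bool × ℕ, κ.2 < T ∧ P.Lost2 j e κ x)) := by
    refine m_mono ?_
    rintro x hx ⟨σ, h, h'⟩
    have hl : σ.length ≤ T := h.length_le.trans (hx ▸ P.φ_len x)
    obtain ⟨e, he, hh⟩ := Lost.split h h'
    refine ⟨e, Finset.mem_range.2 (by omega), hh.imp id ?_⟩
    rintro ⟨κ, a, b⟩
    exact ⟨κ, by omega, b⟩
  refine h1.trans ((m_union _ _ _).trans ?_)
  have h2 : ∀ e ∈ Finset.range T, m T (fun x => P.Lost1 j e x ∨
      ∃ κ : List Bool × ℕ, κ.2 < T ∧ P.Lost2 j e κ x) ≤ 3 * (1 / 2) ^ (j + 3) * (1 / 2 : ℝ) ^ e := by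
    intro e _
    have a := m_or T (P.Lost1 j e) (fun x => ∃ κ : List Bool × ℕ, κ.2 < T ∧ P.Lost2 j e κ x)
    have b := P.lost1_bound j e T
    have c := P.lost2_total j e T
    have d : 3 * (1 / 2) ^ (j + 3) * (1 / 2 : ℝ) ^ e = 3 * dl j e := by
      unfold dl; rw [add_assoc, add_comm e, pow_add _ (j + 3) e]; ring
    rw [d]; linarith
  refine (Finset.sum_le_sum h2).trans ?_
  rw [← Finset.mul_sum]
  have h3 : ∑ e ∈ Finset.range T, (1 / 2 : ℝ) ^ e ≤ 2 := by
    have := sum_geometric_two_le T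
    simpa using this
  have h4 : (0:ℝ) < (1 / 2) ^ j := by positivity
  rw [pow_add]
  nlinarith

end Par

end

section
namespace Par
variable (P : Par) (j : ℕ)

/-! ### Part V: the path -/

/-- the sequence is not an atom of the induced measure -/
def NonAtom (C : ℕ → Bool) : Prop := ∀ ε > 0, ∃ l, ∀ t, P.lam t (pre C l) ≤ ε

theorem lam_anti (t : ℕ) {σ σ' : List Bool} (h : σ <+: σ') : P.lam t σ' ≤ P.lam t σ :=
  m_mono fun _ _ hx => h.trans hx

variable {P j} {C : ℕ → Bool}

theorem pool_exit (hC : ∀ a, ¬ P.Lost j (pre C a)) {t e n : ℕ}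
    (h : P.md j t C = some (e, n, none)) :
    ∃ t' ≥ t, P.bt j t' e = true ∧ P.md j (t' + 1) C = some (e, n, some (t', false)) := by
  classical
  have h1 : ∃ u, t ≤ u ∧ P.bt j u e = true := by
    have hl := hC t
    unfold Lost lostS at hl
    push Not at hl
    obtain ⟨u, hu⟩ := hl
    rw [pre_length, P.stf_pre j t t C le_rfl,
      show (P.stf j t C).2.2 = some (e, n, none) from h] at hu
    simp only [ne_eq, Bool.or_eq_true, decide_eq_true_eq, Bool.not_eq_true', not_or, not_lt,
      Bool.not_eq_false] at hu
    exact ⟨u, hu⟩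
  obtain ⟨h2, h3⟩ := Nat.find_spec h1
  have h4 : P.md j (Nat.find h1) C = some (e, n, none) := by
    refine P.pool_pad j h h2 fun s a b => ?_
    have := Nat.find_min h1 b
    simpa [a] using this
  refine ⟨_, h2, h3, ?_⟩
  cases P.stepCase j (Nat.find h1) C with
  | batch e' n' h0 hb hD hL hm =>
    rw [h4] at h0; simp at h0; obtain ⟨rfl, rfl⟩ := h0
    exact hm
  | _ => simp_all

theorem try_exit (hC : ∀ a, ¬ P.Lost j (pre C a)) (hna : P.NonAtom C) {t e n tb : ℕ} {p : Bool}
    (h : P.md j t C = some (e, n, some (tb, p))) :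
    ∃ t' ≥ t, P.md j (t' + 1) C = none ∨ (p = false ∧ P.md j (t' + 1) C = some (e, n, some (tb, true))) := by
  by_contra hcon
  push Not at hcon
  have key : ∀ t' ≥ t, P.md j t' C = some (e, n, some (tb, p)) ∧ P.Dd j t' C = P.Dd j t C ∧
      P.ev e p (P.Dd j t C) t' = none ∧ P.rl j t' t' C e n tb p = false := by
    have base : ∀ t' ≥ t, P.md j t' C = some (e, n, some (tb, p)) →
        P.ev e p (P.Dd j t' C) t' = none ∧ P.rl j t' t' C e n tb p = false ∧
        P.md j (t' + 1) C = some (e, n, some (tb, p)) ∧ P.Dd j (t' + 1) C = P.Dd j t' C := by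
      intro t' ht' hm
      have hc := hcon t' ht'
      cases P.stepCase j t' C with
      | stay e' n' tb' p' h0 hw hr hD hL hm' =>
        rw [hm] at h0; simp at h0; obtain ⟨rfl, rfl, rfl, rfl⟩ := h0
        exact ⟨hw, hr, hm', hD⟩
      | ev0 e' n' tb' w h0 hw hD hL hm' =>
        rw [hm] at h0; simp at h0; obtain ⟨rfl, rfl, rfl, rfl⟩ := h0
        exact (hc.2 rfl hm').elim
      | ev1 e' n' tb' w h0 hw hD hL hm' => exact (hc.1 hm').elim
      | rel e' n' tb' p' h0 hw hr hD hL hm' => exact (hc.1 hm').elim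
      | _ => simp_all
    have step : ∀ t' ≥ t, P.md j t' C = some (e, n, some (tb, p)) ∧ P.Dd j t' C = P.Dd j t C := by
      intro t' ht'
      induction ht' with
      | refl => exact ⟨h, rfl⟩
      | step ht' ih =>
        have := base _ ht' ih.1
        exact ⟨this.2.2.1, this.2.2.2.trans ih.2⟩
    intro t' ht'
    obtain ⟨a, b⟩ := step t' ht'
    obtain ⟨c, d, -⟩ := base t' ht' a
    exact ⟨a, b, by rw [← b]; exact c, d⟩
  have hd := dl_pos j e
  have hpos : 0 < P.lam tb (pre C n) := by
    by_contra hle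
    have h0 : P.lam tb (pre C n) = 0 := le_antisymm (not_lt.1 hle) (P.lam_nonneg _ _)
    have := (key t le_rfl).2.2.2
    have h1 : P.rl j t t C e n tb p = true := by
      rw [rl_iff, h0, zero_mul]; exact m_nonneg _ _
    rw [h1] at this; simp at this
  obtain ⟨l, hl⟩ := hna (P.lam tb (pre C n) * dl j e ^ (cond p 2 1)) (by positivity)
  refine hC (max l t) fun u => ?_
  set a := max l t with ha
  have hat : t ≤ a := by omega
  have hn : n ≤ a := (P.mode_inv j _ _ _ _ _ h).1.le.trans hat
  unfold lostS
  rw [pre_length, P.stf_pre j a a C le_rfl,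
    show (P.stf j a C).2.2 = some (e, n, some (tb, p)) from (key a hat).1]
  dsimp only
  by_cases hu : u < a
  · simp [hu]
  push Not at hu
  rw [show (P.stf j a C).1 = P.Dd j t C from (key a hat).2.1]
  have h1 := (key u (by omega)).2.2.1
  have h2 : P.rl j u a (ext (pre C a)) e n tb p = false := by
    rw [P.rl_congr j (y' := C) hn (fun i hi => by simp [ext, pre_getElem? C a i hi])]
    have h3 := (key u (by omega)).2.2.2
    by_contra hne
    rw [Bool.not_eq_false, rl_iff] at hne
    have h4 : P.rl j u u C e n tb p = true := by
      rw [rl_iff]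
      refine hne.trans (m_mono fun x _ hx => ?_)
      rw [leftP_iff] at hx ⊢
      obtain ⟨i, a1, a2, a3⟩ := hx
      exact ⟨i, a1, by omega, a3⟩
    rw [h3] at h4; simp at h4
  have h3 : P.cnt u (pre C a) * 2 ^ tb * 2 ^ (cond p 2 1 * (e + j + 3)) ≤
        P.cnt tb (pre (ext (pre C a)) n) * 2 ^ u := by
    have e1 : pre (ext (pre C a)) n = pre C n :=
      pre_eq_iff.2 fun i hi => by simp [ext, pre_getElem? C a i (by omega)]
    have e2 := (P.lam_anti u (pre_pfx C (show l ≤ a by omega))).trans (hl u)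
    rw [e1, ← Nat.cast_le (α := ℝ)]
    push_cast
    rw [cnt_real, cnt_real]
    unfold dl at e2
    rw [← pow_mul, mul_comm (e + j + 3)] at e2
    generalize (cond p 2 1 * (e + j + 3)) = k at *
    have hh : ((1:ℝ) / 2) ^ k * 2 ^ k = 1 := by rw [← mul_pow]; norm_num
    have e3 : P.lam u (pre C a) * 2 ^ k ≤ P.lam tb (pre C n) := by
      have := mul_le_mul_of_nonneg_right e2 (show (0:ℝ) ≤ 2 ^ k by positivity)
      rwa [mul_assoc, hh, mul_one] at this
    have e4 : (0:ℝ) ≤ 2 ^ u * 2 ^ tb := by positivity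
    have := mul_le_mul_of_nonneg_right e3 e4
    linarith
  simp [h1, h2, h3]

theorem rest_io (hC : ∀ a, ¬ P.Lost j (pre C a)) (hna : P.NonAtom C) (t : ℕ) :
    ∃ t' ≥ t, P.md j t' C = none := by
  have h1 : ∀ t e n tb, P.md j t C = some (e, n, some (tb, true)) → ∃ t' ≥ t, P.md j t' C = none := by
    intro t e n tb h
    obtain ⟨t', h1, h2⟩ := try_exit hC hna h
    simp at h2
    exact ⟨t' + 1, by omega, h2⟩
  have h2 : ∀ t e n tb p, P.md j t C = some (e, n, some (tb, p)) →
      ∃ t' ≥ t, P.md j t' C = none := by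
    intro t e n tb p h
    obtain ⟨t', h1', h2⟩ := try_exit hC hna h
    rcases h2 with h2 | ⟨-, h2⟩
    · exact ⟨t' + 1, by omega, h2⟩
    · obtain ⟨t'', a, b⟩ := h1 _ _ _ _ h2
      exact ⟨t'', by omega, b⟩
  rcases hm : P.md j t C with _ | ⟨e, n, _ | ⟨tb, p⟩⟩
  · exact ⟨t, le_rfl, hm⟩
  · obtain ⟨t', a, -, b⟩ := pool_exit hC hm
    obtain ⟨t'', c, d⟩ := h2 _ _ _ _ _ b
    exact ⟨t'', by omega, d⟩
  · exact h2 _ _ _ _ _ hm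

theorem not_about (hC : ∀ a, ¬ P.Lost j (pre C a)) (hna : P.NonAtom C) (e : ℕ) :
    ∃ t0, ∀ t ≥ t0, ∀ n q, P.md j t C ≠ some (e, n, q) := by
  obtain ⟨B, hB⟩ := (P.batch_finite j e).bddAbove
  obtain ⟨t0, h1, h2⟩ := rest_io hC hna (B + 1)
  refine ⟨t0, fun t ht => ?_⟩
  induction ht with
  | refl => simp [h2]
  | @step t ht ih =>
    intro n q hm
    change t0 ≤ t at ht
    cases P.stepCase j t C with
    | pool e' h0 hb hD hL hm' =>
      rw [hm] at hm'; simp at hm'; obtain ⟨rfl, rfl, rfl⟩ := hm'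
      obtain ⟨t', a, b, -⟩ := pool_exit hC hm
      have := hB b
      omega
    | code h0 hb hD hL hm' => rw [hm] at hm'; simp at hm'
    | ev1 e n tb w h0 hw hD hL hm' => rw [hm] at hm'; simp at hm'
    | rel e n tb p h0 hw hr hD hL hm' => rw [hm] at hm'; simp at hm'
    | batch e' n' h0 hb hD hL hm' =>
      rw [hm] at hm'; simp at hm'; obtain ⟨rfl, rfl, rfl⟩ := hm'; exact ih _ _ h0
    | wait e' n' h0 hb hD hL hm' =>
      rw [hm] at hm'; simp at hm'; obtain ⟨rfl, rfl, rfl⟩ := hm'; exact ih _ _ h0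
    | ev0 e' n' tb' w h0 hw hD hL hm' =>
      rw [hm] at hm'; simp at hm'; obtain ⟨rfl, rfl, rfl⟩ := hm'; exact ih _ _ h0
    | stay e' n' tb' p' h0 hw hr hD hL hm' =>
      rw [hm] at hm'; simp at hm'; obtain ⟨rfl, rfl, rfl⟩ := hm'; exact ih _ _ h0

theorem not_about_lt (hC : ∀ a, ¬ P.Lost j (pre C a)) (hna : P.NonAtom C) (M : ℕ) :
    ∃ t0, ∀ t ≥ t0, ∀ e < M, ∀ n q, P.md j t C ≠ some (e, n, q) := by
  choose f hf using not_about hC hna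
  refine ⟨(Finset.range M).sup f, fun t ht e he => hf e t ?_⟩
  exact (Finset.le_sup (f := f) (Finset.mem_range.2 he)).trans ht

theorem length_unbounded (hC : ∀ a, ¬ P.Lost j (pre C a)) (hna : P.NonAtom C) (M : ℕ) :
    ∃ t, M ≤ (P.LL j t C).length := by
  induction M with
  | zero => exact ⟨0, by omega⟩
  | succ M ih =>
    obtain ⟨t, ht⟩ := ih
    by_contra hcon
    push Not at hcon
    obtain ⟨t0, h0⟩ := not_about_lt hC hna (M + 1)
    have hnone : ∀ u, t0 ≤ u → P.md j u C = none := by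
      intro u hu
      rcases hm : P.md j u C with _ | ⟨e, n, q⟩
      · rfl
      · have := (P.mode_inv j _ _ _ _ _ hm).2
        exact (h0 u hu e (by have := hcon u; omega) _ _ hm).elim
    set u := max t t0 with hu
    have h1 := hnone u (by omega)
    have h2 := hnone (u + 1) (by omega)
    have h3 := P.LL_length_mono' j (show t ≤ u by omega) C
    have h4 := hcon (u + 1)
    cases P.stepCase j u C with
    | code h0 hb hD hL hm' => rw [hL] at h4; simp at h4; omega
    | _ => simp_all

theorem entry_final (hC : ∀ a, ¬ P.Lost j (pre C a)) (hna : P.NonAtom C) (e : ℕ) :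
    ∃ t o, (P.LL j t C)[e]? = some o ∧ P.GoodEntry e o := by
  obtain ⟨t0, h0⟩ := not_about_lt hC hna (e + 1)
  obtain ⟨t1, h1⟩ := length_unbounded hC hna (e + 1)
  set t2 := max t0 t1 with ht2
  have h2 : e < (P.LL j t2 C).length := by
    have := P.LL_length_mono' j (show t1 ≤ t2 by omega) C
    omega
  obtain ⟨o, ho⟩ : ∃ o, (P.LL j t2 C)[e]? = some o := ⟨_, List.getElem?_eq_getElem h2⟩
  refine ⟨t2, o, ho, fun p d hpd s => ?_⟩
  have hst : ∀ t ≥ t2, (P.LL j t C)[e]? = some o := by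
    intro t ht
    induction ht with
    | refl => exact ho
    | @step t ht ih =>
      change t2 ≤ t at ht
      have hab := h0 t (by omega) e (by omega)
      cases P.stepCase j t C with
      | code h0 hb hD hL hm' =>
        rw [hL, List.getElem?_append_left (List.getElem?_eq_some_iff.1 ih).1, ih]
      | ev1 e' n tb w g0 hw hD hL hm' =>
        rw [hL, List.getElem?_set_ne, ih]
        rintro rfl; exact hab _ _ g0
      | rel e' n tb p g0 hw hr hD hL hm' =>
        rw [hL, List.getElem?_set_ne, ih]
        rintro rfl; exact hab _ _ g0
      | _ => rename_i hL _; rw [hL, ih]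
  by_contra hne
  obtain ⟨t, ht, hm⟩ := rest_io hC hna (max s t2)
  have hbad : P.bad t (P.LL j t C) e = true := by
    unfold bad
    rw [hst t (by omega), hpd]
    exact P.ev_up (by omega) (Option.isSome_iff_ne_none.2 hne)
  have hlt : e < (P.LL j t C).length := (List.getElem?_eq_some_iff.1 (hst t (by omega))).1
  cases P.stepCase j t C with
  | pool e' h0' hb hD hL hm' =>
    have := (P.firstBad_some hb).2.2
    have hle : e' ≤ e := by
      by_contra hlt'
      have := this e (by omega)
      rw [hbad] at this; simp at this
    exact h0 (t + 1) (by omega) e' (by omega) _ _ hm'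
  | code h0' hb hD hL hm' =>
    have := P.firstBad_none hb e hlt
    rw [hbad] at this; simp at this
  | _ => simp_all

/-- the three possible outcomes -/
theorem outcome (hC : ∀ a, ¬ P.Lost j (pre C a)) (hna : P.NonAtom C) (e : ℕ) :
    ∃ t, (∃ d, d <+: P.Dd j t C ∧ ∀ s, P.ev e false d s = none) ∨
      (∃ d w s, d ++ w <+: P.Dd j t C ∧ P.ev e false d s = some w ∧ ∀ s, P.ev e true d s = none) ∨
      (∃ d w s, d ++ w <+: P.Dd j t C ∧ P.ev e true d s = some w) := by
  obtain ⟨t, o, h1, h2⟩ := entry_final hC hna e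
  have h3 := P.entries_ok j t C e o h1
  refine ⟨t, ?_⟩
  rcases o with _ | ⟨_ | _, d⟩
  · obtain ⟨d, w, s, a, b⟩ := h3
    exact .inr (.inr ⟨d, w, s, a, b⟩)
  · exact .inl ⟨d, h3, h2 _ _ rfl⟩
  · obtain ⟨w, s, a, b⟩ := h3
    exact .inr (.inl ⟨d, w, s, a, b, h2 _ _ rfl⟩)

end Par

end

section
/-! ### Part VI: effectivity -/

section PrimrecHelpers
variable {α β σ : Type*} [Primcodable α] [Primcodable β] [Primcodable σ]

theorem pr_elim {o : α → Option β} {f : α → σ} {g : α → β → σ} (ho : Primrec o) (hf : Primrec f)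
    (hg : Primrec fun q : α × β => g q.1 q.2) : Primrec fun a => (o a).elim (f a) (g a) :=
  (Primrec.option_casesOn ho hf (g := g) hg).of_eq fun a => by cases o a <;> rfl

theorem pr_filter {f : α → List β} {p : α → β → Bool} (hf : Primrec f)
    (hp : Primrec fun q : α × β => p q.1 q.2) : Primrec fun a => (f a).filter (p a) := by
  have h : Primrec₂ fun (a : α) (b : β) => bif p a b then some b else none :=
    Primrec.cond hp (Primrec.option_some.comp Primrec.snd) (Primrec.const none)
  refine (Primrec.listFilterMap hf h).of_eq fun a => ?_
  induction f a with
  | nil => rfl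
  | cons b l ih => cases hb : p a b <;> simp [hb, ih]

theorem pr_countP {f : α → List β} {p : α → β → Bool} (hf : Primrec f)
    (hp : Primrec fun q : α × β => p q.1 q.2) : Primrec fun a => (f a).countP (p a) :=
  (Primrec.list_length.comp (pr_filter hf hp)).of_eq fun a => by
    rw [List.countP_eq_length_filter]

theorem pr_decide_le {f g : α → ℕ} (hf : Primrec f) (hg : Primrec g) :
    Primrec fun a => decide (f a ≤ g a) :=
  (Primrec.nat_le.decide).comp hf hg

theorem pr_decide_lt {f g : α → ℕ} (hf : Primrec f) (hg : Primrec g) :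
    Primrec fun a => decide (f a < g a) :=
  (Primrec.nat_lt.decide).comp hf hg

theorem pr_decide_eq [DecidableEq β] {f g : α → β} (hf : Primrec f) (hg : Primrec g) :
    Primrec fun a => decide (f a = g a) :=
  (Primrec.eq.decide).comp hf hg

theorem pr_any {f : α → List β} {p : α → β → Bool} (hf : Primrec f)
    (hp : Primrec fun q : α × β => p q.1 q.2) : Primrec fun a => (f a).any (p a) :=
  (pr_decide_lt (Primrec.const 0) (pr_countP hf hp)).of_eq fun a => by
    rw [Bool.eq_iff_iff]
    simp [List.countP_pos_iff]

theorem pr_all {f : α → List β} {p : α → β → Bool} (hf : Primrec f)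
    (hp : Primrec fun q : α × β => p q.1 q.2) : Primrec fun a => (f a).all (p a) :=
  (Primrec.not.comp (pr_any hf (p := fun a b => !p a b) (Primrec.not.comp hp))).of_eq fun a => by
    rw [List.any_eq_not_all_not]; simp

theorem pr_pow {f : α → ℕ} (hf : Primrec f) : Primrec fun a => 2 ^ f a := by
  have h : Primrec fun n : ℕ => 2 ^ n := by
    refine (Primrec.nat_rec₁ (f := fun _ b => 2 * b) 1
      (Primrec.nat_double.comp Primrec.snd)).of_eq fun n => ?_
    induction n with
    | zero => rfl
    | succ n ih => simp only [ih]; rw [pow_succ]; omega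
  exact h.comp hf

theorem pr_pfx [DecidableEq β] {f g : α → List β} (hf : Primrec f) (hg : Primrec g) :
    Primrec fun a => (f a).isPrefixOf (g a) :=
  (pr_decide_eq hf (Primrec.list_take.comp (Primrec.list_length.comp hf) hg)).of_eq fun a => by
    rw [Bool.eq_iff_iff]
    simp [List.prefix_iff_eq_take]

theorem pr_ext {f : α → List Bool} {g : α → ℕ} (hf : Primrec f) (hg : Primrec g) :
    Primrec fun a => ext (f a) (g a) :=
  (Primrec.list_getD false).comp hf hg

theorem pr_pre {f : α → List Bool} {g : α → ℕ} (hf : Primrec f) (hg : Primrec g) :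
    Primrec fun a => pre (ext (f a)) (g a) :=
  Primrec.list_map (Primrec.list_range.comp hg) (g := fun a i => ext (f a) i)
    (pr_ext (hf.comp Primrec.fst) Primrec.snd)

theorem pr_strs {f : α → ℕ} (hf : Primrec f) : Primrec fun a => strs (f a) := by
  have h2 : Primrec₂ fun (_ : ℕ × List (List Bool)) (σ : List Bool) => [σ ++ [false], σ ++ [true]] := by
    have h (b : Bool) : Primrec fun q : (ℕ × List (List Bool)) × List Bool => q.2 ++ [b] :=
      Primrec.list_concat.comp Primrec.snd (Primrec.const b)
    exact Primrec.list_cons.comp (h false) (Primrec.list_cons.comp (h true) (Primrec.const []))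
  have h : Primrec strs := by
    refine (Primrec.nat_rec₁ (f := fun _ (l : List (List Bool)) =>
      l.flatMap fun σ => [σ ++ [false], σ ++ [true]]) [[]]
      (Primrec.list_flatMap (f := fun q : ℕ × List (List Bool) => q.2) Primrec.snd h2)).of_eq
        fun n => ?_
    induction n with
    | zero => rfl
    | succ n ih => simp only [ih]; rfl
  exact h.comp hf

theorem pr_add {f g : α → ℕ} (hf : Primrec f) (hg : Primrec g) : Primrec fun a => f a + g a :=
  Primrec.nat_add.comp hf hg
theorem pr_mul {f g : α → ℕ} (hf : Primrec f) (hg : Primrec g) : Primrec fun a => f a * g a :=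
  Primrec.nat_mul.comp hf hg
theorem pr_app {f g : α → List β} (hf : Primrec f) (hg : Primrec g) :
    Primrec fun a => f a ++ g a :=
  Primrec.list_append.comp hf hg
theorem pr_and {f g : α → Bool} (hf : Primrec f) (hg : Primrec g) : Primrec fun a => f a && g a :=
  Primrec.and.comp hf hg
theorem pr_or {f g : α → Bool} (hf : Primrec f) (hg : Primrec g) : Primrec fun a => f a || g a :=
  Primrec.or.comp hf hg
theorem pr_not {f : α → Bool} (hf : Primrec f) : Primrec fun a => !f a :=
  Primrec.not.comp hf
theorem pr_len {f : α → List β} (hf : Primrec f) : Primrec fun a => (f a).length :=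
  Primrec.list_length.comp hf
theorem pr_single {f : α → β} (hf : Primrec f) : Primrec fun a => [f a] :=
  Primrec.list_cons.comp hf (Primrec.const [])

end PrimrecHelpers

namespace Par
variable {P : Par}

section
variable {α : Type*} [Primcodable α]

theorem pr_cnt (hφ : Primrec P.φ) {f : α → ℕ} {g : α → List Bool} (hf : Primrec f)
    (hg : Primrec g) : Primrec fun a => P.cnt (f a) (g a) :=
  pr_countP (pr_strs hf) (p := fun a x => (g a).isPrefixOf (P.φ x))
    (pr_pfx (hg.comp Primrec.fst) (hφ.comp Primrec.snd))

theorem pr_leftP (hφ : Primrec P.φ) {N n : α → ℕ} {g x : α → List Bool} (hN : Primrec N)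
    (hn : Primrec n) (hg : Primrec g) (hx : Primrec x) :
    Primrec fun a => leftP P.φ (N a) (n a) (ext (g a)) (x a) := by
  have hg' := hg.comp (Primrec.fst (α := α) (β := ℕ))
  have h1 := pr_decide_le (hn.comp (Primrec.fst (α := α) (β := ℕ))) Primrec.snd
  have h2 := pr_ext hg' (Primrec.snd (α := α) (β := ℕ))
  have h3 := pr_pfx (pr_app (pr_pre hg' (Primrec.snd (α := α) (β := ℕ)))
    (Primrec.const [false])) ((hφ.comp hx).comp (Primrec.fst (α := α) (β := ℕ)))
  exact pr_any (Primrec.list_range.comp hN) (p := fun a i => decide (n a ≤ i) && ext (g a) i &&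
    (pre (ext (g a)) i ++ [false]).isPrefixOf (P.φ (x a))) (pr_and (pr_and h1 h2) h3)

theorem pr_rl (hφ : Primrec P.φ) {j t N e n tb : α → ℕ} {p : α → Bool} {g : α → List Bool}
    (hj : Primrec j) (ht : Primrec t) (hN : Primrec N) (hg : Primrec g) (he : Primrec e)
    (hn : Primrec n) (htb : Primrec tb) (hp : Primrec p) :
    Primrec fun a => P.rl (j a) (t a) (N a) (ext (g a)) (e a) (n a) (tb a) (p a) := by
  have h1 := pr_mul (pr_cnt hφ htb (pr_pre hg hn)) (pr_pow ht)
  have h2 := pr_countP (pr_strs ht) (p := fun a x => leftP P.φ (N a) (n a) (ext (g a)) x)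
    (pr_leftP hφ (hN.comp Primrec.fst) (hn.comp Primrec.fst) (hg.comp Primrec.fst) Primrec.snd)
  have h3 := pr_pow (pr_mul (Primrec.cond hp (Primrec.const 2) (Primrec.const 1))
    (pr_add (pr_add he hj) (Primrec.const 3)))
  exact pr_decide_le h1 (pr_mul (pr_mul h2 (pr_pow htb)) h3)

theorem pr_poolHit (hφ : Primrec P.φ) {e : α → ℕ} {x g : α → List Bool} {s : α → St}
    (he : Primrec e) (hx : Primrec x) (hg : Primrec g) (hs : Primrec s) :
    Primrec fun a => P.poolHit (e a) (x a) (g a) (s a) := by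
  have k : Primrec fun q : α × (ℕ × ℕ × Option (ℕ × Bool)) => q.1 := Primrec.fst
  have km : Primrec fun q : α × (ℕ × ℕ × Option (ℕ × Bool)) => q.2 := Primrec.snd
  have h1 := pr_decide_eq (Primrec.fst.comp km) (he.comp k)
  have h2 := pr_pfx (Primrec.list_take.comp (Primrec.fst.comp (Primrec.snd.comp km))
    (hg.comp k)) (hφ.comp (hx.comp k))
  refine (pr_elim (Primrec.snd.comp (Primrec.snd.comp hs)) (Primrec.const false)
    (g := fun a m => m.2.2.elim (decide (m.1 = e a) && ((g a).take m.2.1).isPrefixOf (P.φ (x a)))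
      fun _ => false)
    (pr_elim (o := fun q : α × (ℕ × ℕ × Option (ℕ × Bool)) => q.2.2.2)
      (Primrec.snd.comp (Primrec.snd.comp km)) (pr_and h1 h2)
      (g := fun _ _ => false) (Primrec.const false))).of_eq fun a => ?_
  unfold poolHit
  rcases (s a).2.2 with _ | ⟨e', n, _ | q⟩ <;> rfl

theorem pr_ev (hev : Primrec fun q : ℕ × Bool × Wd × ℕ => P.ev q.1 q.2.1 q.2.2.1 q.2.2.2)
    {e t : α → ℕ} {p : α → Bool} {d : α → Wd} (he : Primrec e) (hp : Primrec p)
    (hd : Primrec d) (ht : Primrec t) : Primrec fun a => P.ev (e a) (p a) (d a) (t a) :=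
  hev.comp (Primrec.pair he (Primrec.pair hp (Primrec.pair hd ht)))

theorem pr_bad (hev : Primrec fun q : ℕ × Bool × Wd × ℕ => P.ev q.1 q.2.1 q.2.2.1 q.2.2.2)
    {e t : α → ℕ} {L : α → List (Option (Bool × Wd))} (he : Primrec e) (ht : Primrec t)
    (hL : Primrec L) : Primrec fun a => P.bad (t a) (L a) (e a) := by
  refine (pr_elim (Primrec.list_getElem?.comp hL he) (Primrec.const false)
    (g := fun a m => m.elim false fun q => (P.ev (e a) q.1 q.2 (t a)).isSome)
    (pr_elim (o := fun q : α × Option (Bool × Wd) => q.2) Primrec.snd (Primrec.const false)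
      (g := fun q r => (P.ev (e q.1) r.1 r.2 (t q.1)).isSome) ?_)).of_eq fun a => ?_
  · have k : Primrec fun q : (α × Option (Bool × Wd)) × (Bool × Wd) => q.1.1 :=
      Primrec.fst.comp Primrec.fst
    exact Primrec.option_isSome.comp (pr_ev hev (he.comp k) (Primrec.fst.comp Primrec.snd)
      (Primrec.snd.comp Primrec.snd) (ht.comp k))
  · unfold bad
    rcases (L a)[e a]? with _ | _ | _ <;> rfl

theorem pr_firstBad (hev : Primrec fun q : ℕ × Bool × Wd × ℕ => P.ev q.1 q.2.1 q.2.2.1 q.2.2.2)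
    {t : α → ℕ} {L : α → List (Option (Bool × Wd))} (ht : Primrec t)
    (hL : Primrec L) : Primrec fun a => P.firstBad (t a) (L a) :=
  Primrec.list_head?.comp (pr_filter (Primrec.list_range.comp (pr_len hL))
    (p := fun a e => P.bad (t a) (L a) e)
    (pr_bad hev Primrec.snd (ht.comp Primrec.fst) (hL.comp Primrec.fst)))

end
end Par

end

section
namespace Par
variable {P : Par}

/-- table of states -/
abbrev Tab := List (List Bool × St)

/-- the batch condition computed from a table -/
def btT (P : Par) (j t : ℕ) (tb : Tab) (e : ℕ) : Bool :=
  decide (2 ^ t ≤ ((strs t).countP fun x => tb.any fun q => P.poolHit e x q.1 q.2) *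
    2 ^ (e + j + 3))

/-- the table at time `t` -/
def tab (P : Par) (j : ℕ) : ℕ → Tab
  | 0 => [([], ([], [], none))]
  | t + 1 => (tab P j t).flatMap fun q =>
      [(q.1 ++ [false], P.step j t (P.btT j t (tab P j t)) (ext (q.1 ++ [false])) q.2),
       (q.1 ++ [true], P.step j t (P.btT j t (tab P j t)) (ext (q.1 ++ [true])) q.2)]

theorem btT_eq (j t : ℕ) :
    P.btT j t ((strs t).map fun σ => (σ, P.stf j t (ext σ))) = P.bt j t := by
  funext e
  simp only [btT, bt, btf, List.any_map]
  rfl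

theorem tab_eq (j t : ℕ) : P.tab j t = (strs t).map fun σ => (σ, P.stf j t (ext σ)) := by
  induction t with
  | zero => rfl
  | succ t ih =>
    have hs : strs (t + 1) = (strs t).flatMap fun σ => [σ ++ [false], σ ++ [true]] := rfl
    rw [tab, hs, ih, btT_eq, List.flatMap_map, List.map_flatMap]
    refine List.flatMap_congr fun σ hσ => ?_
    have hl : σ.length = t := mem_strs.1 hσ
    have key (b : Bool) : P.stf j (t + 1) (ext (σ ++ [b])) =
        P.step j t (P.bt j t) (ext (σ ++ [b])) (P.stf j t (ext σ)) := by
      rw [stf_succ]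
      congr 1
      refine P.stf_ext j ?_ hl.ge
      exact Ext_of_pfx (List.prefix_append _ _) (ext_Ext _)
    simp only [List.map_cons, List.map_nil, key]

theorem lookup_map {β : Type*} (I : BEq (List Bool)) (hI : @LawfulBEq _ I) (l : List (List Bool)) (f : List Bool → β) {σ : List Bool}
    (h : σ ∈ l) : @List.lookup _ _ I σ (l.map fun σ => (σ, f σ)) = some (f σ) := by
  induction l with
  | nil => cases h
  | cons a l ih =>
    by_cases hs : σ = a
    · subst hs; simp
    · have : σ ∈ l := by simpa [hs] using h
      have h2 : (σ == a) = false := by simpa using hs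
      simp only [List.map_cons, List.lookup_cons, h2]
      exact ih this

section
variable {α : Type*} [Primcodable α]

theorem pr_btT (hφ : Primrec P.φ) {j t e : α → ℕ} {tb : α → Tab} (hj : Primrec j)
    (ht : Primrec t) (htb : Primrec tb) (he : Primrec e) :
    Primrec fun a => P.btT (j a) (t a) (tb a) (e a) := by
  have h1 : Primrec fun q : (α × List Bool) × (List Bool × St) =>
      P.poolHit (e q.1.1) q.1.2 q.2.1 q.2.2 :=
    pr_poolHit hφ (he.comp (Primrec.fst.comp Primrec.fst)) (Primrec.snd.comp Primrec.fst)
      (Primrec.fst.comp Primrec.snd) (Primrec.snd.comp Primrec.snd)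
  have h2 : Primrec fun q : α × List Bool => (tb q.1).any fun r => P.poolHit (e q.1) q.2 r.1 r.2 :=
    pr_any (htb.comp Primrec.fst) (p := fun (q : α × List Bool) (r : List Bool × St) =>
      P.poolHit (e q.1) q.2 r.1 r.2) h1
  have h3 := pr_countP (pr_strs ht)
    (p := fun a x => (tb a).any fun r => P.poolHit (e a) x r.1 r.2) h2
  exact pr_decide_le (pr_pow ht) (pr_mul h3 (pr_pow (pr_add (pr_add he hj) (Primrec.const 3))))

/-- mode type -/
abbrev Md := ℕ × ℕ × Option (ℕ × Bool)

theorem step_elim (j t : ℕ) (b y : ℕ → Bool) (s : St) : P.step j t b y s =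
    s.2.2.elim ((P.firstBad t s.2.1).elim
        (s.1 ++ ([(true, true)] ++ [(false, y s.2.1.length)]),
        s.2.1 ++ [some (false, s.1 ++ ([(true, true)] ++ [(false, y s.2.1.length)]))], none)
        fun e => (s.1, s.2.1, some (e, t, none)))
      fun m => m.2.2.elim (bif b m.1 then (s.1, s.2.1, some (m.1, m.2.1, some (t, false))) else s)
        fun r => (P.ev m.1 r.2 s.1 t).elim
          (bif P.rl j t t y m.1 m.2.1 r.1 r.2 then
            (s.1 ++ cond r.2 ((P.ev m.1 false s.1 t).getD []) [],
              s.2.1.set m.1 (some (r.2, s.1)), none)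
            else s)
          fun w => bif r.2 then (s.1 ++ w, s.2.1.set m.1 none, none)
            else (s.1, s.2.1, some (m.1, m.2.1, some (r.1, true))) := by
  unfold step
  rcases hm : s.2.2 with _ | ⟨e, n, _ | ⟨tb, p⟩⟩
  · cases P.firstBad t s.2.1 <;> rfl
  · rfl
  · simp only [Option.elim]
    cases P.ev e p s.1 t <;> rfl

theorem pr_step (hφ : Primrec P.φ)
    (hev : Primrec fun q : ℕ × Bool × Wd × ℕ => P.ev q.1 q.2.1 q.2.2.1 q.2.2.2)
    {j t : α → ℕ} {tb : α → Tab} {g : α → List Bool} {s : α → St} (hj : Primrec j)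
    (ht : Primrec t) (htb : Primrec tb) (hg : Primrec g) (hs : Primrec s) :
    Primrec fun a => P.step (j a) (t a) (P.btT (j a) (t a) (tb a)) (ext (g a)) (s a) := by
  have hD : Primrec fun a => (s a).1 := Primrec.fst.comp hs
  have hL : Primrec fun a => (s a).2.1 := Primrec.fst.comp (Primrec.snd.comp hs)
  have hM : Primrec fun a => (s a).2.2 := Primrec.snd.comp (Primrec.snd.comp hs)
  -- first branch
  have hnew : Primrec fun a => (s a).1 ++ ([(true, true)] ++ [(false, ext (g a) (s a).2.1.length)]) :=
    pr_app hD (pr_app (Primrec.const _) (pr_single (Primrec.pair (Primrec.const false)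
      (pr_ext hg (pr_len hL)))))
  have b1 : Primrec fun a => (((s a).1 ++ ([(true, true)] ++ [(false, ext (g a) (s a).2.1.length)]),
        (s a).2.1 ++ [some (false, (s a).1 ++ ([(true, true)] ++
          [(false, ext (g a) (s a).2.1.length)]))], none) : St) :=
    Primrec.pair hnew (Primrec.pair (pr_app hL (pr_single (Primrec.option_some.comp
      (Primrec.pair (Primrec.const false) hnew)))) (Primrec.const none))
  have b2 : Primrec fun q : α × ℕ => (((s q.1).1, (s q.1).2.1, some (q.2, t q.1, none)) : St) :=
    Primrec.pair (hD.comp Primrec.fst) (Primrec.pair (hL.comp Primrec.fst)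
      (Primrec.option_some.comp (Primrec.pair Primrec.snd (Primrec.pair (ht.comp Primrec.fst)
        (Primrec.const none)))))
  have B1 := pr_elim (pr_firstBad hev ht hL) b1
    (g := fun a e => (((s a).1, (s a).2.1, some (e, t a, none)) : St)) b2
  -- second branch
  have k : Primrec fun q : α × Md => q.1 := Primrec.fst
  have ke : Primrec fun q : α × Md => q.2.1 := Primrec.fst.comp Primrec.snd
  have kn : Primrec fun q : α × Md => q.2.2.1 := Primrec.fst.comp (Primrec.snd.comp Primrec.snd)
  have kr : Primrec fun q : α × Md => q.2.2.2 := Primrec.snd.comp (Primrec.snd.comp Primrec.snd)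
  have B2 : Primrec fun q : α × Md => (bif P.btT (j q.1) (t q.1) (tb q.1) q.2.1 then
      ((s q.1).1, (s q.1).2.1, some (q.2.1, q.2.2.1, some (t q.1, false))) else s q.1 : St) :=
    Primrec.cond (pr_btT hφ (hj.comp k) (ht.comp k) (htb.comp k) ke)
      (Primrec.pair (hD.comp k) (Primrec.pair (hL.comp k) (Primrec.option_some.comp
        (Primrec.pair ke (Primrec.pair kn (Primrec.option_some.comp
          (Primrec.pair (ht.comp k) (Primrec.const false))))))))
      (hs.comp k)
  -- third branch
  have l : Primrec fun q : (α × Md) × (ℕ × Bool) => q.1.1 := Primrec.fst.comp Primrec.fst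
  have le : Primrec fun q : (α × Md) × (ℕ × Bool) => q.1.2.1 := ke.comp Primrec.fst
  have ln : Primrec fun q : (α × Md) × (ℕ × Bool) => q.1.2.2.1 := kn.comp Primrec.fst
  have lt : Primrec fun q : (α × Md) × (ℕ × Bool) => q.2.1 := Primrec.fst.comp Primrec.snd
  have lp : Primrec fun q : (α × Md) × (ℕ × Bool) => q.2.2 := Primrec.snd.comp Primrec.snd
  have c1 : Primrec fun q : (α × Md) × (ℕ × Bool) =>
      (bif P.rl (j q.1.1) (t q.1.1) (t q.1.1) (ext (g q.1.1)) q.1.2.1 q.1.2.2.1 q.2.1 q.2.2 then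
            ((s q.1.1).1 ++ cond q.2.2 ((P.ev q.1.2.1 false (s q.1.1).1 (t q.1.1)).getD []) [],
              (s q.1.1).2.1.set q.1.2.1 (some (q.2.2, (s q.1.1).1)), none)
            else s q.1.1 : St) :=
    Primrec.cond (pr_rl hφ (hj.comp l) (ht.comp l) (ht.comp l) (hg.comp l) le ln lt lp)
      (Primrec.pair (pr_app (hD.comp l) (Primrec.cond lp (Primrec.option_getD.comp
        (pr_ev hev le (Primrec.const false) (hD.comp l) (ht.comp l)) (Primrec.const []))
          (Primrec.const [])))
        (Primrec.pair (Primrec.list_set.comp (hL.comp l) (Primrec.pair le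
          (Primrec.option_some.comp (Primrec.pair lp (hD.comp l))))) (Primrec.const none)))
      (hs.comp l)
  have r : Primrec fun q : ((α × Md) × (ℕ × Bool)) × Wd => q.1 := Primrec.fst
  have c2 : Primrec fun q : ((α × Md) × (ℕ × Bool)) × Wd =>
      (bif q.1.2.2 then ((s q.1.1.1).1 ++ q.2, (s q.1.1.1).2.1.set q.1.1.2.1 none, none)
        else ((s q.1.1.1).1, (s q.1.1.1).2.1,
          some (q.1.1.2.1, q.1.1.2.2.1, some (q.1.2.1, true))) : St) :=
    Primrec.cond (lp.comp r)
      (Primrec.pair (pr_app (hD.comp (l.comp r)) Primrec.snd)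
        (Primrec.pair (Primrec.list_set.comp (hL.comp (l.comp r))
          (Primrec.pair (le.comp r) (Primrec.const none))) (Primrec.const none)))
      (Primrec.pair (hD.comp (l.comp r)) (Primrec.pair (hL.comp (l.comp r))
        (Primrec.option_some.comp (Primrec.pair (le.comp r) (Primrec.pair (ln.comp r)
          (Primrec.option_some.comp (Primrec.pair (lt.comp r) (Primrec.const true))))))))
  have B3 := pr_elim (pr_ev hev le lp (hD.comp l) (ht.comp l)) c1
    (g := fun q w => (bif q.2.2 then ((s q.1.1).1 ++ w, (s q.1.1).2.1.set q.1.2.1 none, none)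
        else ((s q.1.1).1, (s q.1.1).2.1,
          some (q.1.2.1, q.1.2.2.1, some (q.2.1, true))) : St)) c2
  have B23 := pr_elim kr B2 (g := fun (q : α × Md) (v : ℕ × Bool) =>
    (P.ev q.2.1 v.2 (s q.1).1 (t q.1)).elim
      ((bif P.rl (j q.1) (t q.1) (t q.1) (ext (g q.1)) q.2.1 q.2.2.1 v.1 v.2 then
            ((s q.1).1 ++ cond v.2 ((P.ev q.2.1 false (s q.1).1 (t q.1)).getD []) [],
              (s q.1).2.1.set q.2.1 (some (v.2, (s q.1).1)), none)
            else s q.1 : St))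
      fun w => (bif v.2 then ((s q.1).1 ++ w, (s q.1).2.1.set q.2.1 none, none)
        else ((s q.1).1, (s q.1).2.1,
          some (q.2.1, q.2.2.1, some (v.1, true))) : St)) B3
  have B := pr_elim hM B1 (g := fun a m => m.2.2.elim
      (bif P.btT (j a) (t a) (tb a) m.1 then
        ((s a).1, (s a).2.1, some (m.1, m.2.1, some (t a, false))) else s a : St)
      fun v => (P.ev m.1 v.2 (s a).1 (t a)).elim
      ((bif P.rl (j a) (t a) (t a) (ext (g a)) m.1 m.2.1 v.1 v.2 then
            ((s a).1 ++ cond v.2 ((P.ev m.1 false (s a).1 (t a)).getD []) [],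
              (s a).2.1.set m.1 (some (v.2, (s a).1)), none)
            else s a : St))
      fun w => (bif v.2 then ((s a).1 ++ w, (s a).2.1.set m.1 none, none)
        else ((s a).1, (s a).2.1,
          some (m.1, m.2.1, some (v.1, true))) : St)) B23
  exact B.of_eq fun a => (step_elim _ _ _ _ _).symm

end

section

theorem pr_tab (hφ : Primrec P.φ)
    (hev : Primrec fun q : ℕ × Bool × Wd × ℕ => P.ev q.1 q.2.1 q.2.2.1 q.2.2.2) :
    Primrec fun q : ℕ × ℕ => P.tab q.1 q.2 := by
  have hb (b : Bool) : Primrec fun q : (ℕ × ℕ × Tab) × (List Bool × St) =>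
      (q.2.1 ++ [b], P.step q.1.1 q.1.2.1 (P.btT q.1.1 q.1.2.1 q.1.2.2) (ext (q.2.1 ++ [b])) q.2.2) := by
    have h1 : Primrec fun q : (ℕ × ℕ × Tab) × (List Bool × St) => q.2.1 ++ [b] :=
      pr_app (Primrec.fst.comp Primrec.snd) (Primrec.const [b])
    exact Primrec.pair h1 (pr_step hφ hev (Primrec.fst.comp Primrec.fst)
      (Primrec.fst.comp (Primrec.snd.comp Primrec.fst))
      (Primrec.snd.comp (Primrec.snd.comp Primrec.fst)) h1 (Primrec.snd.comp Primrec.snd))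
  have h2 : Primrec₂ fun (j : ℕ) (r : ℕ × Tab) => r.2.flatMap fun q =>
      [(q.1 ++ [false], P.step j r.1 (P.btT j r.1 r.2) (ext (q.1 ++ [false])) q.2),
       (q.1 ++ [true], P.step j r.1 (P.btT j r.1 r.2) (ext (q.1 ++ [true])) q.2)] :=
    Primrec.list_flatMap (f := fun q : ℕ × ℕ × Tab => q.2.2)
      (Primrec.snd.comp Primrec.snd)
      (g := fun p q => [(q.1 ++ [false], P.step p.1 p.2.1 (P.btT p.1 p.2.1 p.2.2) (ext (q.1 ++ [false])) q.2),
       (q.1 ++ [true], P.step p.1 p.2.1 (P.btT p.1 p.2.1 p.2.2) (ext (q.1 ++ [true])) q.2)])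
      (Primrec.list_cons.comp (hb false) (pr_single (hb true)))
  have h3 := Primrec.nat_rec (f := fun _ : ℕ => ([([], ([], [], none))] : Tab)) (Primrec.const _) h2
  refine h3.of_eq fun j t => ?_
  induction t with
  | zero => rfl
  | succ t ih => simp only [tab] at ih ⊢; rw [← ih]

/-- state on a string -/
theorem pr_stf (hφ : Primrec P.φ)
    (hev : Primrec fun q : ℕ × Bool × Wd × ℕ => P.ev q.1 q.2.1 q.2.2.1 q.2.2.2) :
    Primrec fun q : ℕ × List Bool => P.stf q.1 q.2.length (ext q.2) := by
  have h1 : Primrec fun q : ℕ × List Bool => P.tab q.1 q.2.length :=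
    (pr_tab hφ hev).comp (Primrec.pair Primrec.fst (pr_len Primrec.snd))
  have h2 := Primrec.option_getD.comp (Primrec.listLookup.comp Primrec.snd h1)
    (Primrec.const (([], [], none) : St))
  refine h2.of_eq fun q => ?_
  rw [tab_eq]
  have h : ∀ {o : Option St}, o = some (P.stf q.1 q.2.length (ext q.2)) →
      o.getD ([], [], none) = P.stf q.1 q.2.length (ext q.2) := by
    rintro _ rfl
    rfl
  refine h (lookup_map _ ?_ (strs q.2.length)
    (fun σ => P.stf q.1 q.2.length (ext σ)) (mem_strs.2 rfl))
  infer_instance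

theorem pr_bt (hφ : Primrec P.φ)
    (hev : Primrec fun q : ℕ × Bool × Wd × ℕ => P.ev q.1 q.2.1 q.2.2.1 q.2.2.2) :
    Primrec fun q : ℕ × ℕ × ℕ => P.bt q.1 q.2.1 q.2.2 := by
  have hj : Primrec fun q : ℕ × ℕ × ℕ => q.1 := Primrec.fst
  have ht : Primrec fun q : ℕ × ℕ × ℕ => q.2.1 := Primrec.fst.comp Primrec.snd
  have he : Primrec fun q : ℕ × ℕ × ℕ => q.2.2 := Primrec.snd.comp Primrec.snd
  refine (pr_btT hφ hj ht ((pr_tab hφ hev).comp (Primrec.pair hj ht)) he).of_eq fun q => ?_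
  rw [tab_eq, btT_eq]

theorem lostS_elim (j : ℕ) (σ : List Bool) (t : ℕ) (s : St) (b : ℕ → Bool) :
    P.lostS j σ t s b = s.2.2.elim false fun m => m.2.2.elim (decide (t < σ.length) || !b m.1)
      fun r => decide (t < σ.length) || (!(P.ev m.1 r.2 s.1 t).isSome &&
        !P.rl j t σ.length (ext σ) m.1 m.2.1 r.1 r.2 &&
        decide (P.cnt t σ * 2 ^ r.1 * 2 ^ (cond r.2 2 1 * (m.1 + j + 3)) ≤
          P.cnt r.1 (pre (ext σ) m.2.1) * 2 ^ t)) := by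
  unfold lostS
  rcases s.2.2 with _ | ⟨e, n, _ | ⟨tb, p⟩⟩
  · rfl
  · rfl
  · simp only [Option.elim]
    cases P.ev e p s.1 t <;> rfl

set_option maxHeartbeats 1000000 in
theorem pr_lost (hφ : Primrec P.φ)
    (hev : Primrec fun q : ℕ × Bool × Wd × ℕ => P.ev q.1 q.2.1 q.2.2.1 q.2.2.2) :
    Primrec fun q : ℕ × List Bool × ℕ =>
      P.lostS q.1 q.2.1 q.2.2 (P.stf q.1 q.2.1.length (ext q.2.1)) (P.bt q.1 q.2.2) := by
  have hj : Primrec fun q : ℕ × List Bool × ℕ => q.1 := Primrec.fst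
  have hσ : Primrec fun q : ℕ × List Bool × ℕ => q.2.1 := Primrec.fst.comp Primrec.snd
  have ht : Primrec fun q : ℕ × List Bool × ℕ => q.2.2 := Primrec.snd.comp Primrec.snd
  have hs : Primrec fun q : ℕ × List Bool × ℕ => P.stf q.1 q.2.1.length (ext q.2.1) :=
    (pr_stf hφ hev).comp (Primrec.pair hj hσ)
  have hD := Primrec.fst.comp hs
  have k : Primrec fun q : (ℕ × List Bool × ℕ) × Md => q.1 := Primrec.fst
  have ke : Primrec fun q : (ℕ × List Bool × ℕ) × Md => q.2.1 := Primrec.fst.comp Primrec.snd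
  have kn : Primrec fun q : (ℕ × List Bool × ℕ) × Md => q.2.2.1 :=
    Primrec.fst.comp (Primrec.snd.comp Primrec.snd)
  have kr : Primrec fun q : (ℕ × List Bool × ℕ) × Md => q.2.2.2 :=
    Primrec.snd.comp (Primrec.snd.comp Primrec.snd)
  have hlt := pr_decide_lt ht (pr_len hσ)
  have B2 := pr_or (hlt.comp k) (pr_not ((pr_bt hφ hev).comp
    (Primrec.pair (hj.comp k) (Primrec.pair (ht.comp k) ke))))
  have l : Primrec fun q : ((ℕ × List Bool × ℕ) × Md) × (ℕ × Bool) => q.1 := Primrec.fst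
  have lt : Primrec fun q : ((ℕ × List Bool × ℕ) × Md) × (ℕ × Bool) => q.2.1 :=
    Primrec.fst.comp Primrec.snd
  have lp : Primrec fun q : ((ℕ × List Bool × ℕ) × Md) × (ℕ × Bool) => q.2.2 :=
    Primrec.snd.comp Primrec.snd
  have lj := hj.comp (k.comp l)
  have lσ := hσ.comp (k.comp l)
  have ltt := ht.comp (k.comp l)
  have le := ke.comp l
  have ln := kn.comp l
  have d1 := pr_not (Primrec.option_isSome.comp (pr_ev hev le lp (hD.comp (k.comp l)) ltt))
  have d2 := pr_not (pr_rl hφ lj ltt (pr_len lσ) lσ le ln lt lp)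
  have d3 := pr_decide_le (pr_mul (pr_mul (pr_cnt hφ ltt lσ) (pr_pow lt))
    (pr_pow (pr_mul (Primrec.cond lp (Primrec.const 2) (Primrec.const 1))
      (pr_add (pr_add le lj) (Primrec.const 3)))))
    (pr_mul (pr_cnt hφ lt (pr_pre lσ ln)) (pr_pow ltt))
  have B3 := pr_or (hlt.comp (k.comp l)) (pr_and (pr_and d1 d2) d3)
  have B23 := pr_elim kr B2 (g := fun (q : (ℕ × List Bool × ℕ) × Md) (r : ℕ × Bool) =>
      decide (q.1.2.2 < q.1.2.1.length) || (!(P.ev q.2.1 r.2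
          (P.stf q.1.1 q.1.2.1.length (ext q.1.2.1)).1 q.1.2.2).isSome &&
        !P.rl q.1.1 q.1.2.2 q.1.2.1.length (ext q.1.2.1) q.2.1 q.2.2.1 r.1 r.2 &&
        decide (P.cnt q.1.2.2 q.1.2.1 * 2 ^ r.1 * 2 ^ (cond r.2 2 1 * (q.2.1 + q.1.1 + 3)) ≤
          P.cnt r.1 (pre (ext q.1.2.1) q.2.2.1) * 2 ^ q.1.2.2))) B3
  have B := pr_elim (Primrec.snd.comp (Primrec.snd.comp hs)) (Primrec.const false)
    (g := fun q m => m.2.2.elim (decide (q.2.2 < q.2.1.length) || !P.bt q.1 q.2.2 m.1)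
      fun r => decide (q.2.2 < q.2.1.length) || (!(P.ev m.1 r.2
          (P.stf q.1 q.2.1.length (ext q.2.1)).1 q.2.2).isSome &&
        !P.rl q.1 q.2.2 q.2.1.length (ext q.2.1) m.1 m.2.1 r.1 r.2 &&
        decide (P.cnt q.2.2 q.2.1 * 2 ^ r.1 * 2 ^ (cond r.2 2 1 * (m.1 + q.1 + 3)) ≤
          P.cnt r.1 (pre (ext q.2.1) m.2.1) * 2 ^ q.2.2)))
    B23
  exact B.of_eq fun q => (lostS_elim _ _ _ _ _).symm

end
end Par

end

section
/-! ### Part VII: the test -/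

theorem stringMeasure_le {V : Set (List Bool)} {p : List Bool → Prop} {c : ℝ}
    (hV : ∀ x σ, σ ∈ V → σ <+: x → p x)
    (h : ∀ n, m n p ≤ c) : stringMeasure V ≤ ENNReal.ofReal c := by
  classical
  refine iSup_le fun n => ?_
  have h1 : Nat.card {f : Fin n → Bool // ∃ σ ∈ V, σ <+: List.ofFn f} ≤
      ((strs n).toFinset.filter p).card := by
    have := Nat.card_le_card_of_injective
      (fun f : {f : Fin n → Bool // ∃ σ ∈ V, σ <+: List.ofFn f} =>
        (⟨List.ofFn f.1, by
          obtain ⟨σ, h1, h2⟩ := f.2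
          rw [Finset.mem_filter, List.mem_toFinset, mem_strs]
          exact ⟨by simp, hV _ _ h1 h2⟩⟩ : ((strs n).toFinset.filter p : Finset _)))
      (fun f g hfg => by
        simp only [Subtype.mk.injEq] at hfg
        exact Subtype.ext (List.ofFn_injective hfg))
    rwa [Nat.card_eq_fintype_card (α := ((strs n).toFinset.filter p : Finset _)),
      Fintype.card_coe] at this
  have h2 := h n
  rw [m_eq_card] at h2
  have h3 : (Nat.card {f : Fin n → Bool // ∃ σ ∈ V, σ <+: List.ofFn f} : ℝ≥0∞) / 2 ^ n =
      ENNReal.ofReal ((Nat.card {f : Fin n → Bool // ∃ σ ∈ V, σ <+: List.ofFn f} : ℝ) / 2 ^ n) := by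
    rw [ENNReal.ofReal_div_of_pos (by positivity), ENNReal.ofReal_natCast,
      ENNReal.ofReal_pow (by norm_num)]
    norm_num
  rw [h3]
  refine ENNReal.ofReal_le_ofReal (le_trans ?_ h2)
  gcongr

namespace Par
variable {P : Par}

theorem exists_good (hφ : Primrec P.φ)
    (hev : Primrec fun q : ℕ × Bool × Wd × ℕ => P.ev q.1 q.2.1 q.2.2.1 q.2.2.2)
    {R C : ℕ → Bool} (hR : TwoRandom R) (hcov : ∀ a, ∃ t, pre C a <+: P.φ (pre R t)) :
    ∃ j, ∀ a, ¬ P.Lost j (pre C a) := by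
  let V : ℕ → Set (List Bool) := fun j => {x | ∃ σ, σ <+: P.φ x ∧ P.Lost j σ}
  have hT : MLTest zeroJump V := by
    constructor
    · let Q : ℕ → ℕ → ℕ → Bool := fun z a t =>
        P.lostS z.unpair.1 ((P.φ ((Encodable.decode (α := List Bool) z.unpair.2).getD [])).take a) t
          (P.stf z.unpair.1 ((P.φ ((Encodable.decode (α := List Bool) z.unpair.2).getD [])).take a).length
            (ext ((P.φ ((Encodable.decode (α := List Bool) z.unpair.2).getD [])).take a)))
          (P.bt z.unpair.1 t)
      have hQ : Computable fun p : ℕ × ℕ × ℕ => Q p.1 p.2.1 p.2.2 := by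
        have u : Primrec fun p : ℕ × ℕ × ℕ => p.1.unpair := Primrec.unpair.comp Primrec.fst
        have h1 : Primrec fun p : ℕ × ℕ × ℕ => p.1.unpair.1 := Primrec.fst.comp u
        have h2 : Primrec fun p : ℕ × ℕ × ℕ =>
            (Encodable.decode (α := List Bool) p.1.unpair.2).getD [] :=
          Primrec.option_getD.comp (Primrec.decode.comp (Primrec.snd.comp u)) (Primrec.const [])
        have h3 : Primrec fun p : ℕ × ℕ × ℕ =>
            (P.φ ((Encodable.decode (α := List Bool) p.1.unpair.2).getD [])).take p.2.1 :=
          Primrec.list_take.comp (Primrec.fst.comp Primrec.snd) (hφ.comp h2)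
        have h4 : Primrec fun p : ℕ × ℕ × ℕ => p.2.2 := Primrec.snd.comp Primrec.snd
        have := (pr_lost hφ hev).comp (Primrec.pair h1 (Primrec.pair h3 h4))
        exact this.to_comp
      obtain ⟨c, hc⟩ := exists_code_sigma2 Q hQ
      refine ⟨c, fun i x => ?_⟩
      rw [hc]
      simp only [Q, Nat.unpair_pair, Encodable.encodek, Option.getD_some]
      constructor
      · rintro ⟨σ, h1, h2⟩
        refine ⟨σ.length, fun t => ?_⟩
        rw [← List.prefix_iff_eq_take.1 h1]
        exact h2 t
      · rintro ⟨a, ha⟩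
        exact ⟨_, List.take_prefix _ _, ha⟩
    · intro i
      have h1 : stringMeasure (V i) ≤ ENNReal.ofReal (3 / 4 * (1 / 2) ^ i) := by
        refine stringMeasure_le (p := fun x => ∃ σ, σ <+: P.φ x ∧ P.Lost i σ) ?_
          (fun n => P.lost_bound i n)
        rintro x σ ⟨τ, h1, h2⟩ h3
        exact ⟨τ, h1.trans (P.φ_mono _ _ h3), h2⟩
      refine h1.trans_lt ?_
      have h2 : (2 : ℝ≥0∞)⁻¹ ^ i = ENNReal.ofReal ((1 / 2) ^ i) := by
        rw [ENNReal.ofReal_pow (by norm_num)]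
        congr 1
        rw [one_div, ENNReal.ofReal_inv_of_pos (by norm_num)]
        norm_num
      rw [h2]
      have h3 : (0 : ℝ) < (1 / 2) ^ i := by positivity
      exact (ENNReal.ofReal_lt_ofReal_iff h3).2 (by linarith)
  obtain ⟨j, hj⟩ := hR V hT
  refine ⟨j, fun a ha => hj ?_⟩
  obtain ⟨t, ht⟩ := hcov a
  refine ⟨pre R t, ⟨_, ht, ha⟩, fun i => ?_⟩
  have h1 : (i : ℕ) < t := by simpa [pre_length] using i.2
  simp [List.get_eq_getElem, pre_getElem]

end Par

end

section
/-! ### Part VIII: the functional and its measure -/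

theorem computableSeq_of_search {Y : ℕ → Bool} (D : ℕ → ℕ → Option Bool)
    (hD : Primrec fun q : ℕ × ℕ => D q.1 q.2) (h1 : ∀ k, ∃ z, (D k z).isSome)
    (h2 : ∀ k z b, D k z = some b → b = Y k) : ComputableSeq Y := by
  refine tred_of_approx (fun τ k => D k τ.length) ?_ _ _ ?_ ?_
  · exact (hD.comp (Primrec.pair Primrec.snd (pr_len Primrec.fst))).to_comp
  · intro k
    obtain ⟨z, hz⟩ := h1 k
    exact ⟨z, by rwa [pre_length]⟩
  · intro k N b h
    exact h2 _ _ _ h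

theorem m_disj_le {t : ℕ} {A B D : List Bool → Prop} (hA : ∀ x, A x → D x) (hB : ∀ x, B x → D x)
    (hAB : ∀ x, A x → ¬ B x) : m t A + m t B ≤ m t D := by
  classical
  simp only [m_eq_card]
  rw [← add_div]
  gcongr
  rw [← Nat.cast_add, ← Finset.card_union_of_disjoint, ← Finset.filter_or]
  · refine Nat.cast_le.2 (Finset.card_le_card ?_)
    refine Finset.monotone_filter_right _ fun x _ h => ?_
    rcases h with h | h
    exacts [hA x h, hB x h]
  · rw [Finset.disjoint_filter]
    exact fun x _ h => hAB x h

namespace Par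
variable {P : Par}

theorem lam_up (P : Par) (τ : List Bool) {t t' : ℕ} (h : t ≤ t') : P.lam t τ ≤ P.lam t' τ :=
  m_up (fun _ _ hx h => h.trans (P.φ_mono _ _ hx)) h

theorem nonAtom_of_not_computable (hφ : Primrec P.φ) {C : ℕ → Bool} (hC : ¬ ComputableSeq C) :
    P.NonAtom C := by
  by_contra hna
  unfold NonAtom at hna
  push Not at hna
  obtain ⟨ε, hε, hna⟩ := hna
  apply hC
  let S : Set ℝ := {q | ∀ l, ∃ t, q < P.lam t (pre C l)}
  have hεS : ε ∈ S := hna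
  have hbdd : BddAbove S := ⟨1, fun q hq => by
    obtain ⟨t, ht⟩ := hq 0
    exact ht.le.trans (m_le_one _ _)⟩
  have hc : ε ≤ sSup S := le_csSup hbdd hεS
  set c := sSup S with hcdef
  have hcpos : 0 < c := by linarith
  obtain ⟨q', hq'S, hq'⟩ := exists_lt_of_lt_csSup ⟨ε, hεS⟩ (show 3 / 4 * c < sSup S by linarith)
  have hns : 3 / 2 * c ∉ S := fun h => by
    have := le_csSup hbdd h
    linarith
  obtain ⟨l0, hl0⟩ : ∃ l, ∀ t, P.lam t (pre C l) ≤ 3 / 2 * c := by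
    simpa [S] using hns
  obtain ⟨q, hq1, hq2⟩ := exists_rat_btwn hq'
  have hq0 : (0 : ℝ) < q := by linarith [show 0 < 3 / 4 * c by linarith]
  have hqn : (q : ℝ) = (q.num.toNat : ℝ) / q.den := by
    have h1 : 0 ≤ q.num := Rat.num_nonneg.2 (by exact_mod_cast hq0.le)
    have h2 : ((q.num.toNat : ℤ) : ℝ) = (q.num : ℝ) := by rw [Int.toNat_of_nonneg h1]
    rw [Rat.cast_def, ← h2]
    push_cast
    rfl
  set a := q.num.toNat
  set b := q.den with hb
  have hbpos : (0 : ℝ) < b := by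
    have := q.den_pos
    exact_mod_cast this
  have hiff (t : ℕ) (σ : List Bool) : a * 2 ^ t < P.cnt t σ * b ↔ (q : ℝ) < P.lam t σ := by
    rw [hqn, div_lt_iff₀ hbpos]
    have h2 : (0 : ℝ) < 2 ^ t := by positivity
    rw [← Nat.cast_lt (α := ℝ)]
    push_cast
    rw [P.cnt_real, mul_right_comm, mul_lt_mul_iff_left₀ h2]
  let σ0 := pre C l0
  refine computableSeq_of_search (fun k z =>
    (Encodable.decode (α := ℕ × List Bool) z).elim none fun p =>
      bif decide (p.2.length = k + 1 + l0) && σ0.isPrefixOf p.2 &&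
        decide (a * 2 ^ p.1 < P.cnt p.1 p.2 * b) then some (ext p.2 k) else none) ?_ ?_ ?_
  · have hk : Primrec fun q : (ℕ × ℕ) × (ℕ × List Bool) => q.1.1 := Primrec.fst.comp Primrec.fst
    have ht : Primrec fun q : (ℕ × ℕ) × (ℕ × List Bool) => q.2.1 := Primrec.fst.comp Primrec.snd
    have hσ : Primrec fun q : (ℕ × ℕ) × (ℕ × List Bool) => q.2.2 := Primrec.snd.comp Primrec.snd
    have h1 := pr_decide_eq (pr_len hσ)
      (pr_add (pr_add hk (Primrec.const 1)) (Primrec.const l0))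
    have h2 := pr_pfx (Primrec.const σ0) hσ
    have h3 := pr_decide_lt (pr_mul (Primrec.const a) (pr_pow ht))
      (pr_mul (pr_cnt hφ ht hσ) (Primrec.const b))
    have h4 := Primrec.cond (pr_and (pr_and h1 h2) h3)
      (Primrec.option_some.comp (pr_ext hσ hk)) (Primrec.const none)
    exact pr_elim (Primrec.decode.comp Primrec.snd) (Primrec.const none) h4
  · intro k
    obtain ⟨t, ht⟩ := hq'S (k + 1 + l0)
    refine ⟨Encodable.encode (t, pre C (k + 1 + l0)), ?_⟩
    have h1 : σ0.isPrefixOf (pre C (k + 1 + l0)) = true := by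
      rw [List.isPrefixOf_iff_prefix]
      exact pre_pfx C (by omega)
    have h2 : a * 2 ^ t < P.cnt t (pre C (k + 1 + l0)) * b := (hiff _ _).2 (hq2.trans ht)
    simp [Encodable.encodek, h1, h2, pre_length]
  · intro k z v h
    cases hz : Encodable.decode (α := ℕ × List Bool) z with
    | none => simp [hz] at h
    | some p =>
      obtain ⟨t, σ⟩ := p
      simp only [hz, Option.elim] at h
      cases hcnd : (decide (σ.length = k + 1 + l0) && σ0.isPrefixOf σ &&
        decide (a * 2 ^ t < P.cnt t σ * b)) with
      | false => simp [hcnd] at h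
      | true =>
        rw [hcnd] at h
        simp only [Bool.and_eq_true, decide_eq_true_eq, List.isPrefixOf_iff_prefix] at hcnd
        obtain ⟨⟨hlen, hpre⟩, hcn⟩ := hcnd
        rw [hiff] at hcn
        have hσ : σ = pre C (k + 1 + l0) := by
          by_contra hne
          obtain ⟨t1, ht1⟩ := hq'S (k + 1 + l0)
          let T := max t t1
          have e1 := hcn.trans_le (P.lam_up σ (le_max_left t t1))
          have e2 := (hq2.trans ht1).trans_le (P.lam_up (pre C (k + 1 + l0)) (le_max_right t t1))
          have e3 : P.lam T σ + P.lam T (pre C (k + 1 + l0)) ≤ P.lam T σ0 := by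
            refine m_disj_le (fun x hx => hpre.trans hx)
              (fun x hx => (pre_pfx C (by omega)).trans hx) fun x hx hx2 => hne ?_
            refine (List.prefix_of_prefix_length_le hx hx2 ?_).eq_of_length ?_ <;>
              simp [hlen, pre_length]
          have e4 := hl0 T
          change P.lam T σ0 ≤ _ at e4
          linarith
        have h5 : v = ext σ k := by simpa using h.symm
        rw [h5, hσ]
        unfold ext
        rw [List.getD_eq_getElem?_getD, pre_getElem? _ _ _ (by omega)]
        rfl

end Par

/-- longest computed initial segment -/
def phi (G : List Bool → ℕ → Option Bool) (x : List Bool) : List Bool :=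
  (((List.range x.length).map (G x)).takeWhile Option.isSome).map fun o => o.getD false

theorem prefix_takeWhile (L : List (Option Bool)) (σ : List Bool) :
    σ <+: (L.takeWhile Option.isSome).map (fun o => o.getD false) ↔
      ∀ (i : ℕ) (b : Bool), σ[i]? = some b → L[i]? = some (some b) := by
  induction L generalizing σ with
  | nil =>
    simp only [List.takeWhile_nil, List.map_nil, List.prefix_nil]
    constructor
    · rintro rfl; simp
    · intro h
      cases σ with
      | nil => rfl
      | cons b σ => simpa using h 0 b (by simp)
  | cons o L ih =>
    cases σ with
    | nil => simp
    | cons c σ =>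
      constructor
      · intro h i b hb
        cases o with
        | none => simp at h
        | some d =>
          simp only [List.takeWhile_cons, Option.isSome_some, if_true, List.map_cons,
            Option.getD_some, List.cons_prefix_cons] at h
          cases i with
          | zero => simp at hb ⊢; rw [← h.1, hb]
          | succ i => simpa using (ih σ).1 h.2 i b (by simpa using hb)
      · intro h
        have h0 := h 0 c (by simp)
        simp only [List.getElem?_cons_zero, Option.some.injEq] at h0
        subst h0
        simp only [List.takeWhile_cons, Option.isSome_some, if_true, List.map_cons,
            Option.getD_some, List.cons_prefix_cons, true_and]
        refine (ih σ).2 fun i b hb => ?_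
        simpa using h (i + 1) b (by simpa using hb)

theorem prefix_phi (G : List Bool → ℕ → Option Bool) (σ x : List Bool) :
    σ <+: phi G x ↔ ∀ i b, σ[i]? = some b → i < x.length ∧ G x i = some b := by
  unfold phi
  rw [prefix_takeWhile]
  refine forall_congr' fun i => forall_congr' fun b => imp_congr_right fun _ => ?_
  rw [List.getElem?_map]
  by_cases h : i < x.length <;> simp [h]

theorem pr_phi {G : List Bool → ℕ → Option Bool} (hG : Primrec₂ G) : Primrec (phi G) := by
  have h1 : Primrec fun x : List Bool => (List.range x.length).map (G x) :=
    Primrec.list_map (Primrec.list_range.comp Primrec.list_length) hG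
  have h2 := (Primrec.list_takeWhile (Primrec.option_isSome (α := Bool))).comp h1
  have h3 : Primrec₂ fun (_ : List Bool) (o : Option Bool) => o.getD false :=
    Primrec.option_getD.comp Primrec.snd (Primrec.const false)
  exact Primrec.list_map h2 h3

theorem phi_mono {G : List Bool → ℕ → Option Bool}
    (hm : ∀ τ τ' n v, τ <+: τ' → G τ n = some v → G τ' n = some v) (x x' : List Bool)
    (h : x <+: x') : phi G x <+: phi G x' := by
  rw [prefix_phi]
  intro i b hb
  have h1 := (prefix_phi G (phi G x) x).1 (List.prefix_refl _) i b hb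
  exact ⟨h1.1.trans_le h.length_le, hm _ _ _ _ h h1.2⟩

theorem phi_len (G : List Bool → ℕ → Option Bool) (x : List Bool) :
    (phi G x).length ≤ x.length := by
  unfold phi
  rw [List.length_map]
  refine (List.takeWhile_prefix _).length_le.trans ?_
  simp

theorem phi_cover {G : List Bool → ℕ → Option Bool} {R C : ℕ → Bool}
    (hm : ∀ τ τ' n v, τ <+: τ' → G τ n = some v → G τ' n = some v)
    (hc : ∀ n, ∃ N, G (pre R N) n = some (C n)) (a : ℕ) : ∃ t, pre C a <+: phi G (pre R t) := by
  choose N hN using hc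
  refine ⟨a + ∑ i ∈ Finset.range a, N i, ?_⟩
  rw [prefix_phi]
  intro i b hb
  have hi : i < a := by
    have := (List.getElem?_eq_some_iff.1 hb).1
    simpa [pre_length] using this
  rw [pre_getElem? _ _ _ hi] at hb
  rw [pre_length]
  refine ⟨by omega, ?_⟩
  rw [← hb]
  refine hm _ _ _ _ (pre_pfx R ?_) (hN i)
  have := Finset.single_le_sum (f := N) (fun _ _ => Nat.zero_le _) (Finset.mem_range.2 hi)
  omega

end

section
/-! ### Part IX: searching for witnesses -/

open Nat.Partrec (Code)

/-- legality of words -/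
def legal (w : Wd) : Bool := w.all fun q => !(q.1 && q.2)

theorem legal_iff (w : Wd) : legal w = true ↔ (true, true) ∉ w := by
  unfold legal
  rw [List.all_eq_true]
  constructor
  · intro h hm
    simpa using h _ hm
  · rintro h ⟨_ | _, _ | _⟩ hm
    all_goals first | rfl | exact absurd hm h

/-- one search step -/
def chk (c : Code) (u s : ℕ) : Option Wd :=
  (Encodable.decode (α := Wd) s.unpair.1).elim none fun w =>
    bif legal w && (Code.evaln s.unpair.2 c (Nat.pair u (Encodable.encode w))).isSome
      then some w else none

/-- bounded search -/
def srch (c : Code) (u t : ℕ) : Option Wd := ((List.range t).filterMap (chk c u)).head?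

theorem chk_some {c : Code} {u s : ℕ} {w : Wd} (h : chk c u s = some w) :
    (true, true) ∉ w ∧ (c.eval (Nat.pair u (Encodable.encode w))).Dom := by
  unfold chk at h
  cases hd : Encodable.decode (α := Wd) s.unpair.1 with
  | none => simp [hd] at h
  | some w' =>
    simp only [hd, Option.elim] at h
    cases hc : (legal w' &&
        (Code.evaln s.unpair.2 c (Nat.pair u (Encodable.encode w'))).isSome) with
    | false => simp [hc] at h
    | true =>
      rw [hc] at h
      simp only [cond_true, Option.some.injEq] at h
      subst h
      simp only [Bool.and_eq_true, legal_iff] at hc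
      refine ⟨hc.1, ?_⟩
      obtain ⟨v, hv⟩ := Option.isSome_iff_exists.1 hc.2
      exact Part.dom_iff_mem.2 ⟨v, Code.evaln_sound hv⟩

theorem chk_exists {c : Code} {u : ℕ} {w : Wd} (hw : (true, true) ∉ w)
    (h : (c.eval (Nat.pair u (Encodable.encode w))).Dom) : ∃ s, chk c u s = some w := by
  obtain ⟨v, hv⟩ := Part.dom_iff_mem.1 h
  obtain ⟨k, hk⟩ := Code.evaln_complete.1 hv
  refine ⟨Nat.pair (Encodable.encode w) k, ?_⟩
  unfold chk
  have h1 : legal w = true := (legal_iff w).2 hw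
  have h2 : Code.evaln k c (Nat.pair u (Encodable.encode w)) = some v := hk
  simp only [Nat.unpair_pair, Encodable.encodek, Option.elim, h1, h2]
  rfl

theorem srch_stable {c : Code} {u t t' : ℕ} {w : Wd} (h : t ≤ t') (hw : srch c u t = some w) :
    srch c u t' = some w := by
  unfold srch at *
  obtain ⟨k, rfl⟩ := Nat.exists_eq_add_of_le h
  rw [List.range_add, List.filterMap_append, List.head?_append, hw]
  rfl

theorem srch_some {c : Code} {u t : ℕ} {w : Wd} (h : srch c u t = some w) :
    (true, true) ∉ w ∧ (c.eval (Nat.pair u (Encodable.encode w))).Dom := by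
  unfold srch at h
  have := List.mem_of_head? h
  rw [List.mem_filterMap] at this
  obtain ⟨s, _, hs⟩ := this
  exact chk_some hs

theorem srch_none {c : Code} {u : ℕ} (h : ∀ t, srch c u t = none) {w : Wd}
    (hw : (true, true) ∉ w) : ¬ (c.eval (Nat.pair u (Encodable.encode w))).Dom := by
  intro hd
  obtain ⟨s, hs⟩ := chk_exists hw hd
  have h1 := h (s + 1)
  unfold srch at h1
  rw [List.head?_eq_none_iff, List.filterMap_eq_nil_iff] at h1
  have := h1 s (by simp)
  rw [hs] at this
  cases this

/-- the two codes attached to a requirement -/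
def cdA (e : ℕ) : Code := Denumerable.ofNat Code e.unpair.1
/-- the two codes attached to a requirement -/
def cdB (e : ℕ) : Code := Denumerable.ofNat Code e.unpair.2

/-- the search functional of the construction -/
def evv (e : ℕ) (p : Bool) (d : Wd) (t : ℕ) : Option Wd :=
  bif p then (srch (cdA e) (Encodable.encode d) t).elim none fun w =>
      srch (cdB e) (Nat.pair (Encodable.encode d) (Encodable.encode w)) t
    else srch (cdA e) (Encodable.encode d) t

theorem evv_stable (e : ℕ) (p : Bool) (d : Wd) (t t' : ℕ) (w : Wd) (h : t ≤ t')
    (hw : evv e p d t = some w) : evv e p d t' = some w := by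
  unfold evv at *
  cases p with
  | false => exact srch_stable h hw
  | true =>
    simp only [cond_true] at hw ⊢
    cases h1 : srch (cdA e) (Encodable.encode d) t with
    | none => simp [h1] at hw
    | some w0 =>
      rw [h1] at hw
      rw [srch_stable h h1]
      exact srch_stable h hw

theorem evv_legal (e : ℕ) (p : Bool) (d : Wd) (t : ℕ) (w : Wd)
    (hw : evv e p d t = some w) : (true, true) ∉ w := by
  unfold evv at *
  cases p with
  | false => exact (srch_some hw).1
  | true =>
    simp only [cond_true] at hw
    cases h1 : srch (cdA e) (Encodable.encode d) t with
    | none => simp [h1] at hw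
    | some w0 =>
      rw [h1] at hw
      exact (srch_some hw).1

section
variable {α : Type*} [Primcodable α]

theorem pr_evaln {k n : α → ℕ} {c : α → Code} (hk : Primrec k) (hc : Primrec c) (hn : Primrec n) :
    Primrec fun a => Code.evaln (k a) (c a) (n a) :=
  Code.primrec_evaln.comp (Primrec.pair (Primrec.pair hk hc) hn)

theorem pr_pair {f g : α → ℕ} (hf : Primrec f) (hg : Primrec g) :
    Primrec fun a => Nat.pair (f a) (g a) := Primrec₂.natPair.comp hf hg

theorem pr_legal {w : α → Wd} (hw : Primrec w) : Primrec fun a => legal (w a) := by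
  have h : Primrec fun q : α × (Bool × Bool) => !(q.2.1 && q.2.2) :=
    pr_not (pr_and (Primrec.fst.comp Primrec.snd) (Primrec.snd.comp Primrec.snd))
  exact pr_all hw (p := fun _ q => !(q.1 && q.2)) h

theorem pr_srch {c : α → Code} {u t : α → ℕ} (hc : Primrec c) (hu : Primrec u) (ht : Primrec t) :
    Primrec fun a => srch (c a) (u a) (t a) := by
  have hs : Primrec fun q : (α × ℕ) × Wd => q.1.2.unpair.2 :=
    Primrec.snd.comp (Primrec.unpair.comp (Primrec.snd.comp Primrec.fst))
  have hw : Primrec fun q : (α × ℕ) × Wd => q.2 := Primrec.snd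
  have k : Primrec fun q : (α × ℕ) × Wd => q.1.1 := Primrec.fst.comp Primrec.fst
  have h1 := Primrec.cond (pr_and (pr_legal hw) (Primrec.option_isSome.comp
    (pr_evaln hs (hc.comp k) (pr_pair (hu.comp k) (Primrec.encode.comp hw)))))
    (Primrec.option_some.comp hw) (Primrec.const none)
  have h0 : Primrec fun q : α × ℕ => Encodable.decode (α := Wd) q.2.unpair.1 :=
    Primrec.decode.comp (Primrec.fst.comp (Primrec.unpair.comp Primrec.snd))
  have h2 : Primrec₂ fun (a : α) (s : ℕ) => chk (c a) (u a) s :=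
    pr_elim (g := fun (q : α × ℕ) (w : Wd) => bif legal w && (Code.evaln q.2.unpair.2 (c q.1)
      (Nat.pair (u q.1) (Encodable.encode w))).isSome then some w else none) h0
      (Primrec.const none) h1
  exact Primrec.list_head?.comp (Primrec.listFilterMap (Primrec.list_range.comp ht) h2)

theorem pr_evv' {c1 c2 : α → Code} {p : α → Bool} {d : α → Wd} {t : α → ℕ} (hA : Primrec c1)
    (hB : Primrec c2) (hp : Primrec p) (hd : Primrec d) (ht : Primrec t) :
    Primrec fun a => bif p a then (srch (c1 a) (Encodable.encode (d a)) (t a)).elim none fun w =>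
      srch (c2 a) (Nat.pair (Encodable.encode (d a)) (Encodable.encode w)) (t a)
    else srch (c1 a) (Encodable.encode (d a)) (t a) := by
  have h1 : Primrec fun a => srch (c1 a) (Encodable.encode (d a)) (t a) :=
    pr_srch hA (Primrec.encode.comp hd) ht
  have h2 : Primrec fun r : α × Wd =>
      srch (c2 r.1) (Nat.pair (Encodable.encode (d r.1)) (Encodable.encode r.2)) (t r.1) :=
    pr_srch (hB.comp Primrec.fst) (pr_pair (Primrec.encode.comp (hd.comp Primrec.fst))
      (Primrec.encode.comp Primrec.snd)) (ht.comp Primrec.fst)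
  have h3 := pr_elim h1 (Primrec.const none) (g := fun q w =>
      srch (c2 q) (Nat.pair (Encodable.encode (d q)) (Encodable.encode w)) (t q)) h2
  exact Primrec.cond hp h3 h1

end

theorem pr_evv : Primrec fun q : ℕ × Bool × Wd × ℕ => evv q.1 q.2.1 q.2.2.1 q.2.2.2 := by
  have he : Primrec fun q : ℕ × Bool × Wd × ℕ => q.1.unpair := Primrec.unpair.comp Primrec.fst
  have hA : Primrec fun q : ℕ × Bool × Wd × ℕ => cdA q.1 :=
    (Primrec.ofNat Code).comp (Primrec.fst.comp he)
  have hB : Primrec fun q : ℕ × Bool × Wd × ℕ => cdB q.1 :=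
    (Primrec.ofNat Code).comp (Primrec.snd.comp he)
  have hp : Primrec fun q : ℕ × Bool × Wd × ℕ => q.2.1 := Primrec.fst.comp Primrec.snd
  have hd : Primrec fun q : ℕ × Bool × Wd × ℕ => q.2.2.1 :=
    Primrec.fst.comp (Primrec.snd.comp Primrec.snd)
  have ht : Primrec fun q : ℕ × Bool × Wd × ℕ => q.2.2.2 :=
    Primrec.snd.comp (Primrec.snd.comp Primrec.snd)
  exact pr_evv' hA hB hp hd ht

/-- codes for existential searches -/
theorem ce_code {α : Type*} [Primcodable α] (Q : α → ℕ → Bool)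
    (hQ : Primrec fun q : α × ℕ => Q q.1 q.2) :
    ∃ c : Code, ∀ a, (∃ N, Q a N = true) ↔ (c.eval (Encodable.encode a)).Dom := by
  let S : ℕ → ℕ → Bool := fun z N => (Encodable.decode (α := α) z).elim false fun a => Q a N
  have hS : Primrec fun q : ℕ × ℕ => S q.1 q.2 :=
    pr_elim (Primrec.decode.comp Primrec.fst) (Primrec.const false)
      (g := fun (q : ℕ × ℕ) (a : α) => Q a q.2)
      (hQ.comp (Primrec.pair Primrec.snd (Primrec.snd.comp Primrec.fst)))
  have h1 : Partrec fun z : ℕ => Nat.rfind fun N => (Part.some (S z N) : Part Bool) := by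
    refine Partrec.rfind (p := fun z N => (Part.some (S z N) : Part Bool)) ?_
    exact hS.to_comp
  obtain ⟨c, hc⟩ := Code.exists_code.1 (Partrec.nat_iff.1 h1)
  refine ⟨c, fun a => ?_⟩
  rw [hc]
  refine Iff.trans ?_ (Nat.rfind_dom (p := fun N => (Part.some (S (Encodable.encode a) N) : Part Bool))).symm
  simp [S, Encodable.encodek]

end

section
/-! ### Part X: the requirements and the final assembly -/

open Nat.Partrec (Code)

/-- `d` is an initial segment of `X`. -/
def Ini (X : ℕ → Bool × Bool) (d : Wd) : Prop := d = (List.range d.length).map X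

theorem Ini.left {X : ℕ → Bool × Bool} {d w : Wd} (h : Ini X (d ++ w)) : Ini X d := by
  unfold Ini at *
  have := congrArg (List.take d.length) h
  rw [List.take_left, ← List.map_take, List.take_range] at this
  rw [this]
  simp

theorem Ini.map {X : ℕ → Bool × Bool} {d : Wd} (h : Ini X d) (π : Bool × Bool → Bool) :
    d.map π = pre (fun n => π (X n)) d.length := by
  unfold Ini at h
  conv_lhs => rw [h]
  simp [pre, Function.comp_def]

/-- All requirements are met along `X`. -/
def Meets (X : ℕ → Bool × Bool) : Prop :=
  ∀ (Q0 : Wd × Wd → ℕ → Bool) (Q1 : (Wd × Wd) × Wd → ℕ → Bool),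
    (Primrec fun q : (Wd × Wd) × ℕ => Q0 q.1 q.2) →
    (Primrec fun q : ((Wd × Wd) × Wd) × ℕ => Q1 q.1 q.2) →
    ∃ d, Ini X d ∧ ((∀ w, (true, true) ∉ w → ∀ N, Q0 (d, w) N = false) ∨
      ∃ w, (∃ N, Q0 (d, w) N = true) ∧
        ((Ini X (d ++ w) ∧ ∀ w1, (true, true) ∉ w1 → ∀ N, Q1 ((d, w), w1) N = false) ∨
          ∃ w1, Ini X (d ++ w1) ∧ ∃ N, Q1 ((d, w), w1) N = true))

theorem extendsStr_pre (A : ℕ → Bool) (n : ℕ) : extendsStr A (pre A n) := by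
  intro i
  rw [List.get_eq_getElem, pre_getElem]

theorem oneGeneric_of_meets {X : ℕ → Bool × Bool} (hX : Meets X) (π : Bool × Bool → Bool)
    (hπ : Primrec π) (ι : Bool → Bool × Bool) (hι : ∀ b, π (ι b) = b)
    (hι2 : ∀ b, ι b ≠ (true, true)) : OneGeneric fun n => π (X n) := by
  rintro W ⟨c0, hc0⟩
  obtain ⟨c, hc⟩ := exists_code_false c0
  have hW : ∀ σ, σ ∈ W ↔ ∃ N, (Code.evaln N c (Encodable.encode σ)).isSome = true := by
    intro σ
    rw [hc0, ← hc, Part.dom_iff_mem]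
    constructor
    · rintro ⟨v, hv⟩
      obtain ⟨k, hk⟩ := Code.evaln_complete.1 hv
      exact ⟨k, Option.isSome_iff_exists.2 ⟨v, hk⟩⟩
    · rintro ⟨N, hN⟩
      obtain ⟨v, hv⟩ := Option.isSome_iff_exists.1 hN
      exact ⟨v, Code.evaln_sound hv⟩
  have hmp : Primrec fun q : ((Wd × Wd) × Wd) × ℕ => (q.1.1.1 ++ q.1.2).map π :=
    Primrec.list_map (pr_app (Primrec.fst.comp (Primrec.fst.comp Primrec.fst))
      (Primrec.snd.comp Primrec.fst)) (hπ.comp Primrec.snd)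
  obtain ⟨d, hd, h⟩ := hX (fun _ _ => true)
    (fun q N => (Code.evaln N c (Encodable.encode ((q.1.1 ++ q.2).map π))).isSome)
    (Primrec.const true) (Primrec.option_isSome.comp (pr_evaln Primrec.snd (Primrec.const c)
      (Primrec.encode.comp hmp)))
  rcases h with h | ⟨w, _, ⟨_, h⟩ | ⟨w1, hw1, N, h⟩⟩
  · exact absurd (h [] (by simp) 0) (by simp)
  · refine ⟨d.map π, ?_, Or.inr ?_⟩
    · rw [hd.map]
      exact extendsStr_pre _ _
    · rintro τ ⟨ρ, rfl⟩ hτ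
      obtain ⟨N, hN⟩ := (hW _).1 hτ
      have := h (ρ.map ι) (by
        intro hm
        obtain ⟨b, _, hb⟩ := List.mem_map.1 hm
        exact hι2 b hb) N
      simp only [List.map_append, List.map_map] at this
      have h2 : List.map (π ∘ ι) ρ = ρ := by
        conv_rhs => rw [← List.map_id ρ]
        exact List.map_congr_left fun b _ => hι b
      rw [h2, hN] at this
      cases this
  · refine ⟨(d ++ w1).map π, ?_, Or.inl ?_⟩
    · rw [hw1.map]
      exact extendsStr_pre _ _
    · exact (hW _).2 ⟨N, h⟩

theorem not_computable_of_oneGeneric {A : ℕ → Bool} (hA : OneGeneric A) : ¬ ComputableSeq A := by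
  intro hc
  obtain ⟨G, hG, _, h1, h2⟩ := TRed.approx hc
  let Q : List Bool → ℕ → Bool := fun σ N =>
    (List.range σ.length).any fun i => decide (G (pre (ext []) N) i = some (!(ext σ i)))
  have hQ : Primrec fun q : List Bool × ℕ => Q q.1 q.2 := by
    refine pr_any (p := fun (q : List Bool × ℕ) i =>
      decide (G (pre (ext []) q.2) i = some (!(ext q.1 i))))
      (Primrec.list_range.comp (pr_len Primrec.fst)) ?_
    refine pr_decide_eq (hG.comp (pr_pre (Primrec.const []) (Primrec.snd.comp Primrec.fst))
      Primrec.snd) (Primrec.option_some.comp (pr_not (pr_ext (Primrec.fst.comp Primrec.fst)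
      Primrec.snd)))
  obtain ⟨c, hcd⟩ := ce_code Q hQ
  obtain ⟨c', hc'⟩ := exists_oracleCode (Partrec.nat_iff.2 (Code.exists_code.2 ⟨c, rfl⟩))
  have he : ext [] = fun _ => false := by
    funext i
    simp [ext]
  obtain ⟨σ, hσ, h⟩ := hA {σ | ∃ N, Q σ N = true} ⟨c', fun σ => by
    rw [hc']
    exact hcd σ⟩
  have hext : ∀ i, i < σ.length → ext σ i = A i := by
    intro i hi
    have := hσ ⟨i, hi⟩
    simp only [List.get_eq_getElem] at this
    simp [ext, this, hi]
  rcases h with ⟨N, hN⟩ | h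
  · simp only [Q, List.any_eq_true, List.mem_range, decide_eq_true_eq] at hN
    obtain ⟨i, hi, hN⟩ := hN
    rw [he] at hN
    have := h2 _ _ _ hN
    rw [hext i hi] at this
    cases hA : A i <;> simp [hA] at this
  · obtain ⟨N, hN⟩ := h1 σ.length
    refine h (σ ++ [!(A σ.length)]) ⟨_, rfl⟩ ⟨N, ?_⟩
    simp only [Q, List.any_eq_true, List.mem_range, decide_eq_true_eq]
    refine ⟨σ.length, by simp, ?_⟩
    rw [he, hN]
    simp [ext]

end

section
theorem minimal_of_meets {X : ℕ → Bool × Bool} (hX : Meets X) {Z : ℕ → Bool}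
    (hA : TRed Z fun n => (X n).1) (hB : TRed Z fun n => (X n).2) : ComputableSeq Z := by
  obtain ⟨G1, hG1, m1, c1, s1⟩ := hA.approx
  obtain ⟨G2, hG2, m2, c2, s2⟩ := hB.approx
  let hit : Wd → ℕ → ℕ → Bool → Bool := fun d l n b =>
    (strs l).any fun ρ => decide (G1 (d.map Prod.fst ++ ρ) n = some b)
  have hhit : ∀ b, Primrec fun q : (Wd × Wd) × ℕ => hit q.1.1 q.1.2.length q.2 b := by
    intro b
    refine pr_any (p := fun (q : (Wd × Wd) × ℕ) ρ =>
      decide (G1 (q.1.1.map Prod.fst ++ ρ) q.2 = some b))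
      (pr_strs (pr_len (Primrec.snd.comp Primrec.fst))) ?_
    refine pr_decide_eq (hG1.comp (pr_app ?_ Primrec.snd) (Primrec.snd.comp Primrec.fst))
      (Primrec.const _)
    exact Primrec.list_map (Primrec.fst.comp (Primrec.fst.comp Primrec.fst))
      (Primrec.fst.comp Primrec.snd)
  have hit_iff : ∀ d l n b, hit d l n b = true ↔
      ∃ ρ : List Bool, ρ.length = l ∧ G1 (d.map Prod.fst ++ ρ) n = some b := by
    intro d l n b
    simp only [hit, List.any_eq_true, mem_strs, decide_eq_true_eq]
  let Q0 : Wd × Wd → ℕ → Bool := fun q n =>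
    (q.2.all fun x => decide (x = (false, false))) &&
      (hit q.1 q.2.length n true && hit q.1 q.2.length n false)
  have hQ0 : Primrec fun q : (Wd × Wd) × ℕ => Q0 q.1 q.2 := by
    refine pr_and ?_ (pr_and (hhit true) (hhit false))
    exact pr_all (p := fun _ x => decide (x = (false, false))) (Primrec.snd.comp Primrec.fst)
      (pr_decide_eq Primrec.snd (Primrec.const _))
  let dis : Wd → ℕ → Bool → Bool := fun u n b =>
    decide (G1 (u.map Prod.fst) n = some b) && decide (G2 (u.map Prod.snd) n = some (!b))
  have hdis : ∀ b, Primrec fun q : ((Wd × Wd) × Wd) × ℕ => dis (q.1.1.1 ++ q.1.2) q.2 b := by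
    intro b
    have h0 : Primrec fun q : ((Wd × Wd) × Wd) × ℕ => q.1.1.1 ++ q.1.2 :=
      pr_app (Primrec.fst.comp (Primrec.fst.comp Primrec.fst)) (Primrec.snd.comp Primrec.fst)
    exact pr_and
      (pr_decide_eq (hG1.comp (Primrec.list_map h0 (Primrec.fst.comp Primrec.snd)) Primrec.snd)
        (Primrec.const _))
      (pr_decide_eq (hG2.comp (Primrec.list_map h0 (Primrec.snd.comp Primrec.snd)) Primrec.snd)
        (Primrec.const _))
  have dis_iff : ∀ u n b, dis u n b = true ↔
      G1 (u.map Prod.fst) n = some b ∧ G2 (u.map Prod.snd) n = some (!b) := by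
    intro u n b
    simp only [dis, Bool.and_eq_true, decide_eq_true_eq]
  obtain ⟨d, hd, h⟩ := hX Q0 (fun q n => dis (q.1.1 ++ q.2) n true || dis (q.1.1 ++ q.2) n false)
    hQ0 (pr_or (hdis true) (hdis false))
  rcases h with h | ⟨w, ⟨n, hw⟩, ⟨hdw, h⟩ | ⟨w1, hw1, n', h⟩⟩
  · -- no splitting
    have key : ∀ (ρ ρ' : List Bool) n, G1 (d.map Prod.fst ++ ρ) n = some true →
        G1 (d.map Prod.fst ++ ρ') n = some false → False := by
      intro ρ ρ' n h1 h2
      have := h (List.replicate (ρ.length + ρ'.length) (false, false)) (by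
        intro hm
        simpa using List.eq_of_mem_replicate hm) n
      have ht : Q0 (d, List.replicate (ρ.length + ρ'.length) (false, false)) n = true := by
        simp only [Q0, Bool.and_eq_true, List.length_replicate, List.all_eq_true,
          decide_eq_true_eq]
        refine ⟨fun x hx => List.eq_of_mem_replicate hx, (hit_iff _ _ _ _).2
          ⟨ρ ++ List.replicate ρ'.length false, by simp, ?_⟩, (hit_iff _ _ _ _).2
          ⟨ρ' ++ List.replicate ρ.length false, by simp [Nat.add_comm], ?_⟩⟩
        · exact m1 _ _ _ _ ⟨List.replicate ρ'.length false, by simp⟩ h1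
        · exact m1 _ _ _ _ ⟨List.replicate ρ.length false, by simp⟩ h2
      rw [ht] at this
      cases this
    have hex : ∀ k, ∃ ρ : List Bool, G1 (d.map Prod.fst ++ ρ) k = some (Z k) := by
      intro k
      obtain ⟨N, hN⟩ := c1 k
      have h1 := m1 _ _ _ _ (pre_pfx _ (Nat.le_add_left N d.length)) hN
      have h2 : d.map Prod.fst <+: pre (fun n => (X n).1) (d.length + N) := by
        rw [hd.map]
        exact pre_pfx _ (Nat.le_add_right _ _)
      obtain ⟨ρ, hρ⟩ := h2
      exact ⟨ρ, by rw [hρ]; exact h1⟩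
    refine computableSeq_of_search (fun k z => (Encodable.decode (α := List Bool) z).elim none
      fun ρ => G1 (d.map Prod.fst ++ ρ) k) ?_ ?_ ?_
    · exact pr_elim (Primrec.decode.comp Primrec.snd) (Primrec.const none)
        (g := fun (q : ℕ × ℕ) (ρ : List Bool) => G1 (d.map Prod.fst ++ ρ) q.1)
        (hG1.comp (pr_app (Primrec.const _) Primrec.snd) (Primrec.fst.comp Primrec.fst))
    · intro k
      obtain ⟨ρ, hρ⟩ := hex k
      exact ⟨Encodable.encode ρ, by simp [hρ]⟩
    · intro k z b hb
      cases hz : Encodable.decode (α := List Bool) z with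
      | none => simp [hz] at hb
      | some ρ =>
        simp only [hz, Option.elim] at hb
        obtain ⟨ρ', hρ'⟩ := hex k
        by_contra hne
        cases hZ : Z k <;> rw [hZ] at hne hρ' <;> cases b <;> simp at hne
        · exact key _ _ _ hb hρ'
        · exact key _ _ _ hρ' hb
  · exfalso
    simp only [Q0, Bool.and_eq_true, List.all_eq_true, decide_eq_true_eq] at hw
    obtain ⟨hw0, ht, hf⟩ := hw
    have hρ : ∃ ρ : List Bool, ρ.length = w.length ∧
        G1 (d.map Prod.fst ++ ρ) n = some (!(Z n)) := by
      cases Z n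
      · exact (hit_iff _ _ _ _).1 ht
      · exact (hit_iff _ _ _ _).1 hf
    obtain ⟨ρ, hρl, hρ⟩ := hρ
    obtain ⟨N, hN⟩ := c2 n
    have h1 := m2 _ _ _ _ (pre_pfx _ (Nat.le_add_left N (d ++ w).length)) hN
    have h2 : (d ++ w).map Prod.snd <+: pre (fun n => (X n).2) ((d ++ w).length + N) := by
      rw [hdw.map]
      exact pre_pfx _ (Nat.le_add_right _ _)
    obtain ⟨β, hβ⟩ := h2
    have hwr : w.map Prod.snd = List.replicate w.length false := by
      rw [List.eq_replicate_iff]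
      refine ⟨by simp, fun b hb => ?_⟩
      obtain ⟨x, hx, rfl⟩ := List.mem_map.1 hb
      rw [hw0 x hx]
    have h3 := h (ρ.map (fun b => (b, false)) ++ β.map (fun b => (false, b))) (by
      intro hm
      simp at hm) n
    have e1 : (d ++ (ρ.map (fun b => (b, false)) ++ β.map (fun b => (false, b)))).map Prod.fst
        = (d.map Prod.fst ++ ρ) ++ List.replicate β.length false := by
      simp [Function.comp_def]
    have e2 : (d ++ (ρ.map (fun b => (b, false)) ++ β.map (fun b => (false, b)))).map Prod.snd
        = (d ++ w).map Prod.snd ++ β := by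
      simp [Function.comp_def, hwr, hρl]
    have h4 : dis (d ++ (ρ.map (fun b => (b, false)) ++ β.map (fun b => (false, b)))) n
        (!(Z n)) = true := by
      rw [dis_iff, e1, e2, hβ, h1, Bool.not_not]
      exact ⟨m1 _ _ _ _ ⟨_, rfl⟩ hρ, rfl⟩
    simp only [Bool.or_eq_false_iff] at h3
    cases hZ : Z n <;> rw [hZ] at h4
    · rw [Bool.not_false, h3.1] at h4
      cases h4
    · rw [Bool.not_true, h3.2] at h4
      cases h4
  · exfalso
    have : ∃ b, dis (d ++ w1) n' b = true := by
      rcases (Bool.or_eq_true_iff).1 h with h | h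
      exacts [⟨_, h⟩, ⟨_, h⟩]
    obtain ⟨b, hb⟩ := this
    rw [dis_iff, hw1.map, hw1.map] at hb
    have q1 := s1 _ _ _ hb.1
    have q2 := s2 _ _ _ hb.2
    rw [← q1] at q2
    cases b <;> simp at q2

end

section
open Nat.Partrec (Code)

theorem Ini_of_pfx {X : ℕ → Bool × Bool} {d u : Wd} (hu : Ini X u) (h : d <+: u) : Ini X d := by
  obtain ⟨w, rfl⟩ := h
  exact hu.left

/-- The construction attached to a functional. -/
def mkPar (G : List Bool → ℕ → Option Bool)
    (hm : ∀ τ τ' n v, τ <+: τ' → G τ n = some v → G τ' n = some v) : Par where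
  φ := phi G
  ev := evv
  φ_mono := fun x x' h => phi_mono hm x x' h
  φ_len := fun x => phi_len G x
  ev_stable := evv_stable
  ev_legal := evv_legal

theorem pr_dec : Primrec Par.dec := by
  have hstep : Primrec fun q : (Bool × List Bool) × (Bool × Bool) => Par.decStep q.1 q.2 :=
    Primrec.cond (Primrec.fst.comp Primrec.fst)
      (Primrec.pair (Primrec.const false) (pr_app (Primrec.snd.comp Primrec.fst)
        (pr_single (Primrec.snd.comp Primrec.snd))))
      (Primrec.pair (pr_and (Primrec.fst.comp Primrec.snd) (Primrec.snd.comp Primrec.snd))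
        (Primrec.snd.comp Primrec.fst))
  have h2 : Primrec₂ fun (_ : Wd) (q : (Bool × List Bool) × (Bool × Bool)) =>
      Par.decStep q.1 q.2 := hstep.comp Primrec.snd
  exact Primrec.list_foldl (f := fun D : Wd => D) (g := fun _ => (false, []))
    Primrec.id (Primrec.const (false, [])) h2

theorem dec_pfx {D E : Wd} (h : D <+: E) : (Par.dec D).2 <+: (Par.dec E).2 := by
  obtain ⟨w, rfl⟩ := h
  unfold Par.dec
  rw [List.foldl_append]
  exact (Par.foldl_decStep_pfx w _).1

namespace Par
variable {P : Par}

theorem exists_limit {j : ℕ} {C : ℕ → Bool} (hlen : ∀ M, ∃ t, M ≤ (P.LL j t C).length) :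
    ∃ X : ℕ → Bool × Bool, (∀ t, Ini X (P.Dd j t C)) ∧ ∀ M, ∃ t, M ≤ (P.Dd j t C).length := by
  have hD : ∀ M, ∃ t, M ≤ (P.Dd j t C).length := by
    intro M
    obtain ⟨t, ht⟩ := hlen M
    refine ⟨t, ht.trans ?_⟩
    have h1 := (Par.foldl_decStep_pfx (P.Dd j t C) (false, [])).2
    have h2 := congrArg (fun q => q.2.length) (P.dec_inv j t C)
    unfold dec at h2
    simp only [pre_length] at h2
    rw [h2] at h1
    simpa using h1
  refine ⟨fun n => (P.Dd j (hD (n + 1)).choose C).getD n (false, false), fun t => ?_, hD⟩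
  unfold Ini
  refine List.ext_getElem (by simp) fun i h1 h2 => ?_
  simp only [List.getElem_map, List.getElem_range]
  have h3 : i < (P.Dd j (hD (i + 1)).choose C).length := (hD (i + 1)).choose_spec
  rw [List.getD_eq_getElem _ _ h3]
  rcases le_total t (hD (i + 1)).choose with h | h
  · exact (P.Dd_mono j h C).getElem h1
  · exact ((P.Dd_mono j h C).getElem h3).symm

theorem meets_of_outcome {j : ℕ} {C : ℕ → Bool} {X : ℕ → Bool × Bool} (hev : P.ev = evv)
    (hX : ∀ t, Ini X (P.Dd j t C))
    (hout : ∀ e, ∃ t, (∃ d, d <+: P.Dd j t C ∧ ∀ s, P.ev e false d s = none) ∨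
      (∃ d w s, d ++ w <+: P.Dd j t C ∧ P.ev e false d s = some w ∧ ∀ s, P.ev e true d s = none) ∨
      (∃ d w s, d ++ w <+: P.Dd j t C ∧ P.ev e true d s = some w)) : Meets X := by
  intro Q0 Q1 hQ0 hQ1
  obtain ⟨c1, hc1⟩ := ce_code Q0 hQ0
  obtain ⟨c2, hc2⟩ := ce_code Q1 hQ1
  have hc1' : ∀ d w, (∃ N, Q0 (d, w) N = true) ↔
      (c1.eval (Nat.pair (Encodable.encode d) (Encodable.encode w))).Dom := fun d w => hc1 (d, w)
  have hc2' : ∀ d w w1, (∃ N, Q1 ((d, w), w1) N = true) ↔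
      (c2.eval (Nat.pair (Nat.pair (Encodable.encode d) (Encodable.encode w))
        (Encodable.encode w1))).Dom := fun d w w1 => hc2 ((d, w), w1)
  obtain ⟨t, h⟩ := hout (Nat.pair (Encodable.encode c1) (Encodable.encode c2))
  have eA : cdA (Nat.pair (Encodable.encode c1) (Encodable.encode c2)) = c1 := by
    simp [cdA]
  have eB : cdB (Nat.pair (Encodable.encode c1) (Encodable.encode c2)) = c2 := by
    simp [cdB]
  simp only [hev, evv, eA, eB, cond_true, cond_false] at h
  rcases h with ⟨d, hd, h⟩ | ⟨d, w, s, hd, hw, h⟩ | ⟨d, w1, s, hd, h⟩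
  · refine ⟨d, Ini_of_pfx (hX t) hd, Or.inl fun w hw N => ?_⟩
    have := srch_none h hw
    rw [← hc1'] at this
    rw [← Bool.not_eq_true]
    exact fun hN => this ⟨N, hN⟩
  · have hi := Ini_of_pfx (hX t) hd
    refine ⟨d, hi.left, Or.inr ⟨w, (hc1' _ _).2 (srch_some hw).2, Or.inl ⟨hi, fun w1 hw1 N => ?_⟩⟩⟩
    have hn : ∀ r, srch c2 (Nat.pair (Encodable.encode d) (Encodable.encode w)) r = none := by
      intro r
      cases hr : srch c2 (Nat.pair (Encodable.encode d) (Encodable.encode w)) r with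
      | none => rfl
      | some v =>
        have h1 := h (max s r)
        rw [srch_stable (le_max_left s r) hw] at h1
        simp only [Option.elim] at h1
        rw [srch_stable (le_max_right s r) hr] at h1
        cases h1
    have := srch_none hn hw1
    rw [← hc2'] at this
    rw [← Bool.not_eq_true]
    exact fun hN => this ⟨N, hN⟩
  · have hi := Ini_of_pfx (hX t) hd
    cases hw : srch c1 (Encodable.encode d) s with
    | none => simp [hw] at h
    | some w =>
      simp only [hw, Option.elim] at h
      exact ⟨d, hi.left, Or.inr ⟨w, (hc1' _ _).2 (srch_some hw).2,
        Or.inr ⟨w1, hi, (hc2' _ _ _).2 (srch_some h).2⟩⟩⟩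

theorem join_le {j : ℕ} {C : ℕ → Bool} {X : ℕ → Bool × Bool} (hφ : Primrec P.φ)
    (hev : Primrec fun q : ℕ × Bool × Wd × ℕ => P.ev q.1 q.2.1 q.2.2.1 q.2.2.2)
    (hX : ∀ t, Ini X (P.Dd j t C)) (hlen : ∀ M, ∃ t, M ≤ (P.Dd j t C).length) :
    TRed (join (fun n => (X n).1) (fun n => (X n).2)) C := by
  let F : List Bool → ℕ → Option Bool := fun τ k =>
    (P.stf j τ.length (ext τ)).1[k / 2]?.elim none fun x => some (bif decide (k % 2 = 0) then x.1 else x.2)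
  have hF : Primrec₂ F := by
    have h1 : Primrec fun q : List Bool × ℕ => (P.stf j q.1.length (ext q.1)).1[q.2 / 2]? :=
      Primrec.list_getElem?.comp
        (Primrec.fst.comp ((pr_stf hφ hev).comp (Primrec.pair (Primrec.const j) Primrec.fst)))
        (Primrec.nat_div.comp Primrec.snd (Primrec.const 2))
    refine pr_elim h1 (Primrec.const none)
      (g := fun q x => some (bif decide (q.2 % 2 = 0) then x.1 else x.2)) ?_
    exact Primrec.option_some.comp (Primrec.cond
      (pr_decide_eq (Primrec.nat_mod.comp (Primrec.snd.comp Primrec.fst) (Primrec.const 2))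
        (Primrec.const 0))
      (Primrec.fst.comp Primrec.snd) (Primrec.snd.comp Primrec.snd))
  have hFv : ∀ N k, F (pre C N) k = (P.Dd j N C)[k / 2]?.elim none
      fun x => some (bif decide (k % 2 = 0) then x.1 else x.2) := by
    intro N k
    simp only [F, pre_length, Dd, P.stf_pre j N N C le_rfl]
  have hget : ∀ N i x, (P.Dd j N C)[i]? = some x → x = X i := by
    intro N i x hx
    rw [hX N] at hx
    rw [List.getElem?_eq_some_iff] at hx
    obtain ⟨_, hx⟩ := hx
    simp at hx
    exact hx.symm
  refine tred_of_approx F hF.to_comp _ _ ?_ ?_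
  · intro k
    obtain ⟨t, ht⟩ := hlen (k / 2 + 1)
    refine ⟨t, ?_⟩
    rw [hFv, List.getElem?_eq_getElem ht]
    rfl
  · intro k N b hb
    rw [hFv] at hb
    cases hx : (P.Dd j N C)[k / 2]? with
    | none => simp [hx] at hb
    | some x =>
      have := hget _ _ _ hx
      subst this
      simp only [hx, Option.elim, Option.some.injEq] at hb
      rw [← hb]
      unfold join
      by_cases hk : k % 2 = 0 <;> simp [hk]

theorem le_join {j : ℕ} {C : ℕ → Bool} {X : ℕ → Bool × Bool}
    (hX : ∀ t, Ini X (P.Dd j t C)) (hlen : ∀ M, ∃ t, M ≤ (P.Dd j t C).length)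
    (hLL : ∀ M, ∃ t, M ≤ (P.LL j t C).length) :
    TRed C (join (fun n => (X n).1) (fun n => (X n).2)) := by
  let F : List Bool → ℕ → Option Bool := fun τ k =>
    (dec ((List.range (τ.length / 2)).map fun i => (ext τ (2 * i), ext τ (2 * i + 1)))).2[k]?
  have hF : Primrec₂ F := by
    refine Primrec.list_getElem?.comp (Primrec.snd.comp (pr_dec.comp ?_)) Primrec.snd
    refine Primrec.list_map (Primrec.list_range.comp
      (Primrec.nat_div.comp (pr_len Primrec.fst) (Primrec.const 2))) ?_
    exact Primrec.pair
      (pr_ext (Primrec.fst.comp Primrec.fst) (pr_mul (Primrec.const 2) Primrec.snd))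
      (pr_ext (Primrec.fst.comp Primrec.fst)
        (pr_add (pr_mul (Primrec.const 2) Primrec.snd) (Primrec.const 1)))
  have hFv : ∀ N k, F (pre (join (fun n => (X n).1) (fun n => (X n).2)) N) k =
      (dec ((List.range (N / 2)).map X)).2[k]? := by
    intro N k
    simp only [F, pre_length]
    congr 3
    refine List.map_congr_left fun i hi => ?_
    rw [List.mem_range] at hi
    have a1 : 2 * i < N := by omega
    have a2 : 2 * i + 1 < N := by omega
    simp only [ext, List.getD_eq_getElem?_getD, pre_getElem? _ _ _ a1, pre_getElem? _ _ _ a2,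
      Option.getD_some, join]
    have a3 : 2 * i % 2 = 0 := by omega
    have a4 : (2 * i + 1) % 2 ≠ 0 := by omega
    have a5 : 2 * i / 2 = i := by omega
    have a6 : (2 * i + 1) / 2 = i := by omega
    simp [a3, a4, a5, a6]
  refine tred_of_approx F hF.to_comp _ _ ?_ ?_
  · intro k
    obtain ⟨t, ht⟩ := hLL (k + 1)
    refine ⟨2 * (P.Dd j t C).length, ?_⟩
    rw [hFv, Nat.mul_div_cancel_left _ two_pos, ← hX t, P.dec_inv j t C,
      pre_getElem? _ _ _ ht]
    rfl
  · intro k N b hb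
    rw [hFv] at hb
    obtain ⟨t, ht⟩ := hlen (N / 2)
    have h1 : (List.range (N / 2)).map X <+: P.Dd j t C := by
      rw [hX t]
      refine List.IsPrefix.map X ?_
      obtain ⟨k, hk⟩ := Nat.exists_eq_add_of_le ht
      rw [hk, List.range_add]
      exact ⟨_, rfl⟩
    have h2 := dec_pfx h1
    rw [P.dec_inv j t C] at h2
    obtain ⟨ρ, hρ⟩ := h2
    simp only at hρ
    have h3 : k < (dec ((List.range (N / 2)).map X)).2.length :=
      (List.getElem?_eq_some_iff.1 hb).1
    have h4 : (pre C (P.LL j t C).length)[k]? = some b := by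
      rw [← hρ, List.getElem?_append_left h3, hb]
    have h5 : k < (P.LL j t C).length := by
      have := (List.getElem?_eq_some_iff.1 h4).1
      rwa [pre_length] at this
    rw [pre_getElem? _ _ _ h5] at h4
    exact (Option.some.inj h4).symm

end Par

theorem main_thm (C R : ℕ → Bool)
    (hR : TwoRandom R) (hCR : TRed C R) (hC : ¬ ComputableSeq C) :
    ∃ A B : ℕ → Bool, OneGeneric A ∧ OneGeneric B ∧
      ¬ ComputableSeq A ∧ ¬ ComputableSeq B ∧
      (∀ Z : ℕ → Bool, TRed Z A → TRed Z B → ComputableSeq Z) ∧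
      TEquiv (join A B) C := by
  obtain ⟨G, hG, hm, hc, _⟩ := hCR.approx
  have hφ : Primrec (mkPar G hm).φ := pr_phi hG
  have hev : Primrec fun q : ℕ × Bool × Wd × ℕ =>
    (mkPar G hm).ev q.1 q.2.1 q.2.2.1 q.2.2.2 := pr_evv
  obtain ⟨j, hj⟩ := Par.exists_good hφ hev hR (fun a => phi_cover hm hc a)
  have hna := Par.nonAtom_of_not_computable hφ hC
  have hLL := Par.length_unbounded hj hna
  obtain ⟨X, hX, hlen⟩ := Par.exists_limit hLL
  have hM : Meets X := Par.meets_of_outcome rfl hX (Par.outcome hj hna)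
  have hA : OneGeneric fun n => (X n).1 := oneGeneric_of_meets hM Prod.fst Primrec.fst
    (fun b => (b, false)) (fun _ => rfl) (fun _ => by simp)
  have hB : OneGeneric fun n => (X n).2 := oneGeneric_of_meets hM Prod.snd Primrec.snd
    (fun b => (false, b)) (fun _ => rfl) (fun _ => by simp)
  exact ⟨_, _, hA, hB, not_computable_of_oneGeneric hA, not_computable_of_oneGeneric hB,
    fun Z h1 h2 => minimal_of_meets hM h1 h2, Par.join_le hφ hev hX hlen, Par.le_join hX hlen hLL⟩

end

/-- every non-zero Turing degree bounded by a 2-random Turing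
degree is the join of a minimal pair of 1-generic Turing degrees. -/
theorem join_of_minimal_pair_of_oneGenerics (C R : ℕ → Bool)
    (hR : TwoRandom R) (hCR : TRed C R) (hC : ¬ ComputableSeq C) :
    ∃ A B : ℕ → Bool, OneGeneric A ∧ OneGeneric B ∧
      ¬ ComputableSeq A ∧ ¬ ComputableSeq B ∧
      (∀ Z : ℕ → Bool, TRed Z A → TRed Z B → ComputableSeq Z) ∧
      TEquiv (join A B) C := by
  exact main_thm C R hR hCR hC

end TypicalDegree
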